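/- arXiv:2605.18737 — 2 statements merged into one kernel-verified Lean document; each statement's English description precedes it below -/
import Mathlib

section
/- Let 𝒱 = (V, {a₀, a₁}) be a primitive 2-generated M(α,β)-axial algebra over F. Assume α ≠ 2β and that 𝒱 has a regular axet with |a₀^{Miy(𝒱)}| = 3. Then either 𝒱 is isomorphic to a quotient of a symmetric algebra, or V = V_e, or V = V_o. -/
namespace AxialFormal

universe u v

variable (F : Type u) [Field F] {V : Type v} [NonUnitalNonAssocCommRing V]
  [Module F V] [SMulCommClass F V V] [IsScalarTower F V V]

/-- The `μ`-eigenspace of the adjoint map `ad_a : x ↦ a * x`. -/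
def eigSp (a : V) (μ : F) : Submodule F V where
  carrier := {w | a * w = μ • w}
  add_mem' := by
    intro x y hx hy
    simp only [Set.mem_setOf_eq] at hx hy ⊢
    rw [mul_add, hx, hy, smul_add]
  zero_mem' := by
    simp only [Set.mem_setOf_eq, mul_zero, smul_zero]
  smul_mem' := by
    intro c x hx
    simp only [Set.mem_setOf_eq] at hx ⊢
    rw [mul_smul_comm, hx, smul_comm]

/-- `a` is a primitive axis of Monster type `(α, β)` in the commutative
(not necessarily associative or unital) `F`-algebra `V`. -/
structure IsAxis (α β : F) (a : V) : Prop where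
  idem : a * a = a
  primitive : eigSp F a 1 = Submodule.span F {a}
  decomp : eigSp F a 1 ⊔ eigSp F a 0 ⊔ eigSp F a α ⊔ eigSp F a β = ⊤
  fusion_one_zero : ∀ u ∈ eigSp F a 1, ∀ w ∈ eigSp F a 0, u * w = 0
  fusion_one_alpha : ∀ u ∈ eigSp F a 1, ∀ w ∈ eigSp F a α, u * w ∈ eigSp F a α
  fusion_one_beta : ∀ u ∈ eigSp F a 1, ∀ w ∈ eigSp F a β, u * w ∈ eigSp F a β
  fusion_zero_zero : ∀ u ∈ eigSp F a 0, ∀ w ∈ eigSp F a 0, u * w ∈ eigSp F a 0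
  fusion_zero_alpha : ∀ u ∈ eigSp F a 0, ∀ w ∈ eigSp F a α, u * w ∈ eigSp F a α
  fusion_zero_beta : ∀ u ∈ eigSp F a 0, ∀ w ∈ eigSp F a β, u * w ∈ eigSp F a β
  fusion_alpha_alpha : ∀ u ∈ eigSp F a α, ∀ w ∈ eigSp F a α,
    u * w ∈ eigSp F a 1 ⊔ eigSp F a 0
  fusion_alpha_beta : ∀ u ∈ eigSp F a α, ∀ w ∈ eigSp F a β, u * w ∈ eigSp F a β
  fusion_beta_beta : ∀ u ∈ eigSp F a β, ∀ w ∈ eigSp F a β,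
    u * w ∈ eigSp F a 1 ⊔ eigSp F a 0 ⊔ eigSp F a α

/-- `(V, {a₀, a₁})` is a primitive 2-generated axial algebra of Monster type `(α, β)`. -/
structure IsTwoGenerated (α β : F) (a₀ a₁ : V) : Prop where
  axis₀ : IsAxis F α β a₀
  axis₁ : IsAxis F α β a₁
  generates : NonUnitalAlgebra.adjoin F {a₀, a₁} = ⊤

/-- `τ` is the Miyamoto involution associated to the axis `a` : it is an algebra
automorphism fixing `V₁ᵃ + V₀ᵃ + Vαᵃ` pointwise and negating `Vβᵃ`. -/
structure IsMiyamoto (α β : F) (a : V) (τ : V ≃ₗ[F] V) : Prop where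
  map_mul : ∀ x y : V, τ (x * y) = τ x * τ y
  fix_plus : ∀ w ∈ eigSp F a 1 ⊔ eigSp F a 0 ⊔ eigSp F a α, τ w = w
  neg_beta : ∀ w ∈ eigSp F a β, τ w = -w

/-- The bi-infinite sequence of axes `a_j`, with `a_{2i} = a₀^{ρ^i}` and
`a_{2i+1} = a₁^{ρ^i}` where `ρ = τ₀τ₁` (as a right action, `v^ρ = τ₁ (τ₀ v)`). -/
def axSeq (a₀ a₁ : V) (τ₀ τ₁ : V ≃ₗ[F] V) (j : ℤ) : V :=
  if j % 2 = 0 then ((τ₁ * τ₀) ^ (j / 2)) a₀ else ((τ₁ * τ₀) ^ ((j - 1) / 2)) a₁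

/-- The orbit of `b` under the Miyamoto group `⟨τ₀, τ₁⟩`. -/
def miyOrbit (τ₀ τ₁ : V ≃ₗ[F] V) (b : V) : Set V :=
  {w | ∃ g ∈ Subgroup.closure ({τ₀, τ₁} : Set (V ≃ₗ[F] V)), g b = w}

/-- The axet of `(V,{a₀,a₁})` is regular: the two orbits have the same cardinality. -/
def HasRegularAxet (a₀ a₁ : V) (τ₀ τ₁ : V ≃ₗ[F] V) : Prop :=
  Nonempty ((miyOrbit F τ₀ τ₁ a₀) ≃ (miyOrbit F τ₀ τ₁ a₁))

/-- The 2-generated axial algebra `(V, {a₀, a₁})` is symmetric: it admits a flip,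
i.e. an algebra automorphism interchanging `a₀` and `a₁`. -/
def IsSymmetric (a₀ a₁ : V) : Prop :=
  ∃ f : V ≃ₗ[F] V, (∀ x y : V, f (x * y) = f x * f y) ∧ f a₀ = a₁ ∧ f a₁ = a₀

/-- A bundled commutative (not necessarily associative or unital) `F`-algebra. -/
structure AlgModel where
  carrier : Type (max u v)
  [isRing : NonUnitalNonAssocCommRing carrier]
  [isModule : Module F carrier]
  [isSMulComm : SMulCommClass F carrier carrier]
  [isTower : IsScalarTower F carrier carrier]

attribute [instance] AlgModel.isRing AlgModel.isModule AlgModel.isSMulComm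
  AlgModel.isTower

/-- `(V,{a₀,a₁})` is isomorphic to a quotient of a symmetric primitive 2-generated
`M(α,β)`-axial algebra: there are such an algebra `(W,{b₀,b₁})` and a surjective
multiplication-preserving linear map `W → V` sending `{b₀,b₁}` to `{a₀,a₁}`. -/
def IsQuotientOfSymmetric (α β : F) (a₀ a₁ : V) : Prop :=
  ∃ M : AlgModel.{u, v} F, ∃ b₀ b₁ : M.carrier,
    IsTwoGenerated F α β b₀ b₁ ∧ IsSymmetric F b₀ b₁ ∧
    ∃ θ : M.carrier →ₗ[F] V, Function.Surjective θ ∧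
      (∀ x y : M.carrier, θ (x * y) = θ x * θ y) ∧
      ({θ b₀, θ b₁} : Set V) = {a₀, a₁}

set_option linter.all false
section Basic
variable {F}

/-- equational package for a (not nec. primitive) axis `c` with projection `P` and involution `τ` -/
structure Cen {A : Type*} [NonUnitalNonAssocCommRing A] [Module F A] (α β : F) (c : A)
    (P τ : A →ₗ[F] A) : Prop where
  idem : c * c = c
  P_one : ∀ x, c * x = x → P x = x
  P_mul : ∀ x, P (c * x) = P x
  mul_P : ∀ x, c * P x = P x
  P_τ : ∀ x, P (τ x) = P x
  τ_c : τ c = c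
  τ_τ : ∀ x, τ (τ x) = x
  τ_mul : ∀ x y, τ (x * y) = τ x * τ y
  neg : ∀ x, c * (x - τ x) = β • (x - τ x)
  quad : ∀ x, τ x = x → c * (c * x) = α • (c * x) + (1 - α) • P x
  J : ∀ y z, τ y = y → τ z = z → P y = 0 → P z = 0 →
    α • (c * (y * z)) = α • P (y * z) + α • (y * (c * z)) + α • (z * (c * y))
      - (2 : F) • ((c * y) * (c * z))
  J' : ∀ y z, τ y = y → τ z = z → P y = 0 → P z = 0 →
    α • (c * (y * z)) + α • P (y * z) = c * (y * (c * z)) + c * (z * (c * y))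
  J3 : ∀ y z, τ y = y → τ z = z → P y = 0 → P z = 0 →
    c * (y * (c * z)) - c * (z * (c * y)) = α • (y * (c * z) - z * (c * y))

instance prodCommRing {A B : Type*} [NonUnitalNonAssocCommRing A] [NonUnitalNonAssocCommRing B] :
    NonUnitalNonAssocCommRing (A × B) :=
  { (inferInstance : NonUnitalNonAssocRing (A × B)) with
    mul_comm := fun x y => Prod.ext (mul_comm _ _) (mul_comm _ _) }

theorem Cen.prod {A B : Type*} [NonUnitalNonAssocCommRing A] [Module F A]
    [NonUnitalNonAssocCommRing B] [Module F B] {α β : F} {c : A} {P τ : A →ₗ[F] A}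
    {d : B} {Q σ : B →ₗ[F] B} (h : Cen α β c P τ) (k : Cen α β d Q σ) :
    Cen α β ((c, d) : A × B) (P.prodMap Q) (τ.prodMap σ) where
  idem := by ext <;> simp [h.idem, k.idem]
  P_one := by
    rintro ⟨x, y⟩ hx
    simp only [Prod.mk_mul_mk, Prod.mk.injEq] at hx
    simp [h.P_one _ hx.1, k.P_one _ hx.2]
  P_mul := by rintro ⟨x, y⟩; simp [h.P_mul, k.P_mul]
  mul_P := by rintro ⟨x, y⟩; simp [h.mul_P, k.mul_P]
  P_τ := by rintro ⟨x, y⟩; simp [h.P_τ, k.P_τ]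
  τ_c := by simp [h.τ_c, k.τ_c]
  τ_τ := by rintro ⟨x, y⟩; simp [h.τ_τ, k.τ_τ]
  τ_mul := by rintro ⟨x, y⟩ ⟨x', y'⟩; simp [h.τ_mul, k.τ_mul]
  neg := by rintro ⟨x, y⟩; simp [h.neg, k.neg]
  quad := by
    rintro ⟨x, y⟩ hx
    simp only [LinearMap.prodMap_apply, Prod.mk.injEq] at hx
    simp [h.quad _ hx.1, k.quad _ hx.2]
  J := by
    rintro ⟨x, y⟩ ⟨x', y'⟩ h1 h2 h3 h4
    simp only [LinearMap.prodMap_apply, Prod.mk.injEq, Prod.mk_eq_zero] at h1 h2 h3 h4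
    have e1 := h.J x x' h1.1 h2.1 h3.1 h4.1
    have e2 := k.J y y' h1.2 h2.2 h3.2 h4.2
    ext <;> simp only [LinearMap.prodMap_apply, Prod.mk_mul_mk, Prod.smul_mk, Prod.mk_add_mk,
      Prod.mk_sub_mk, e1, e2]
  J' := by
    rintro ⟨x, y⟩ ⟨x', y'⟩ h1 h2 h3 h4
    simp only [LinearMap.prodMap_apply, Prod.mk.injEq, Prod.mk_eq_zero] at h1 h2 h3 h4
    have e1 := h.J' x x' h1.1 h2.1 h3.1 h4.1
    have e2 := k.J' y y' h1.2 h2.2 h3.2 h4.2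
    ext <;> simp only [LinearMap.prodMap_apply, Prod.mk_mul_mk, Prod.smul_mk, Prod.mk_add_mk,
      Prod.mk_sub_mk, e1, e2]
  J3 := by
    rintro ⟨x, y⟩ ⟨x', y'⟩ h1 h2 h3 h4
    simp only [LinearMap.prodMap_apply, Prod.mk.injEq, Prod.mk_eq_zero] at h1 h2 h3 h4
    have e1 := h.J3 x x' h1.1 h2.1 h3.1 h4.1
    have e2 := k.J3 y y' h1.2 h2.2 h3.2 h4.2
    ext <;> simp only [LinearMap.prodMap_apply, Prod.mk_mul_mk, Prod.smul_mk, Prod.mk_add_mk,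
      Prod.mk_sub_mk, e1, e2]

/-- transport along an automorphism -/
theorem Cen.map {A : Type*} [NonUnitalNonAssocCommRing A] [Module F A] {α β : F} {c : A}
    {P τ : A →ₗ[F] A} (h : Cen α β c P τ) (g : A ≃ₗ[F] A) (hg : ∀ x y, g (x * y) = g x * g y) :
    Cen α β (g c) (g.toLinearMap ∘ₗ P ∘ₗ g.symm.toLinearMap)
      (g.toLinearMap ∘ₗ τ ∘ₗ g.symm.toLinearMap) := by
  have key : ∀ x, ∃ y, x = g y := fun x => ⟨g.symm x, by simp⟩
  refine ⟨?_, ?_, ?_, ?_, ?_, ?_, ?_, ?_, ?_, ?_, ?_, ?_, ?_⟩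
  · rw [← hg, h.idem]
  · intro x hx
    obtain ⟨x, rfl⟩ := key x
    rw [← hg] at hx
    simp [h.P_one _ (g.injective hx)]
  · intro x; obtain ⟨x, rfl⟩ := key x; simp [← hg, h.P_mul]
  · intro x; obtain ⟨x, rfl⟩ := key x; simp [← hg, h.mul_P]
  · intro x; obtain ⟨x, rfl⟩ := key x; simp [h.P_τ]
  · simp [h.τ_c]
  · intro x; obtain ⟨x, rfl⟩ := key x; simp [h.τ_τ]
  · intro x y; obtain ⟨x, rfl⟩ := key x; obtain ⟨y, rfl⟩ := key y; simp [← hg, h.τ_mul]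
  · intro x; obtain ⟨x, rfl⟩ := key x
    simp only [LinearMap.comp_apply, LinearEquiv.coe_coe, LinearEquiv.symm_apply_apply,
      ← map_sub, ← hg, ← map_smul, h.neg]
  · intro x hx; obtain ⟨x, rfl⟩ := key x
    simp only [LinearMap.comp_apply, LinearEquiv.coe_coe, LinearEquiv.symm_apply_apply] at hx ⊢
    rw [← hg, ← hg, h.quad _ (g.injective hx)]; simp
  · intro x y h1 h2 h3 h4; obtain ⟨x, rfl⟩ := key x; obtain ⟨y, rfl⟩ := key y
    simp only [LinearMap.comp_apply, LinearEquiv.coe_coe, LinearEquiv.symm_apply_apply,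
      EmbeddingLike.map_eq_zero_iff] at h1 h2 h3 h4 ⊢
    have e := congrArg g (h.J _ _ (g.injective h1) (g.injective h2) h3 h4)
    simp only [map_add, map_sub, map_smul, hg] at e
    simpa only [← hg, LinearEquiv.symm_apply_apply] using e
  · intro x y h1 h2 h3 h4; obtain ⟨x, rfl⟩ := key x; obtain ⟨y, rfl⟩ := key y
    simp only [LinearMap.comp_apply, LinearEquiv.coe_coe, LinearEquiv.symm_apply_apply,
      EmbeddingLike.map_eq_zero_iff] at h1 h2 h3 h4 ⊢
    have e := congrArg g (h.J' _ _ (g.injective h1) (g.injective h2) h3 h4)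
    simp only [map_add, map_sub, map_smul, hg] at e
    simpa only [← hg, LinearEquiv.symm_apply_apply] using e
  · intro x y h1 h2 h3 h4; obtain ⟨x, rfl⟩ := key x; obtain ⟨y, rfl⟩ := key y
    simp only [LinearMap.comp_apply, LinearEquiv.coe_coe, LinearEquiv.symm_apply_apply,
      EmbeddingLike.map_eq_zero_iff] at h1 h2 h3 h4 ⊢
    have e := congrArg g (h.J3 _ _ (g.injective h1) (g.injective h2) h3 h4)
    simp only [map_add, map_sub, map_smul, hg] at e
    simpa only [← hg, LinearEquiv.symm_apply_apply] using e

/-- the projection onto the `1`-eigenspace as a polynomial in `ad_c` -/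
def Pm (α β : F) (c : V) : V →ₗ[F] V :=
  ((1 - α) * (1 - β))⁻¹ • (LinearMap.mulLeft F c ∘ₗ LinearMap.mulLeft F c ∘ₗ LinearMap.mulLeft F c
    - (α + β) • (LinearMap.mulLeft F c ∘ₗ LinearMap.mulLeft F c)
    + (α * β) • LinearMap.mulLeft F c)

theorem mem_eigSp {a w : V} {μ : F} : w ∈ eigSp F a μ ↔ a * w = μ • w := Iff.rfl

theorem IsAxis.dec {α β : F} {a : V} (h : IsAxis F α β a) (x : V) :
    ∃ x1 x0 xa xb : V, a * x1 = x1 ∧ a * x0 = 0 ∧ a * xa = α • xa ∧ a * xb = β • xb ∧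
      x = x1 + x0 + xa + xb := by
  have : x ∈ eigSp F a 1 ⊔ eigSp F a 0 ⊔ eigSp F a α ⊔ eigSp F a β := by
    rw [h.decomp]; trivial
  obtain ⟨y, hy, xb, hb, rfl⟩ := Submodule.mem_sup.1 this
  obtain ⟨z, hz, xa, ha, rfl⟩ := Submodule.mem_sup.1 hy
  obtain ⟨x1, h1, x0, h0, rfl⟩ := Submodule.mem_sup.1 hz
  rw [mem_eigSp] at h1 h0 ha hb
  exact ⟨x1, x0, xa, xb, by simpa using h1, by simpa using h0, ha, hb, rfl⟩

theorem Pm_dec {α β : F} (hα1 : α ≠ 1) (hβ1 : β ≠ 1) {a x1 x0 xa xb : V}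
    (h1 : a * x1 = x1) (h0 : a * x0 = 0) (ha : a * xa = α • xa) (hb : a * xb = β • xb) :
    Pm α β a (x1 + x0 + xa + xb) = x1 := by
  have e1 : (1 - α) ≠ 0 := sub_ne_zero.2 hα1.symm
  have e2 : (1 - β) ≠ 0 := sub_ne_zero.2 hβ1.symm
  have : x1 = ((1 - α) * (1 - β))⁻¹ • (((1 - α) * (1 - β)) • x1) := by
    rw [smul_smul, inv_mul_cancel₀ (mul_ne_zero e1 e2), one_smul]
  conv_rhs => rw [this]
  simp only [Pm, LinearMap.smul_apply, LinearMap.add_apply, LinearMap.sub_apply,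
    LinearMap.comp_apply, LinearMap.mulLeft_apply, mul_add, h1, h0, ha, hb, mul_smul_comm, mul_zero]
  congr 1
  module

theorem IsAxis.P_span {α β : F} (hα1 : α ≠ 1) (hβ1 : β ≠ 1) {a : V} (h : IsAxis F α β a) (x : V) :
    ∃ t : F, Pm α β a x = t • a := by
  obtain ⟨x1, x0, xa, xb, h1, h0, ha, hb, rfl⟩ := h.dec x
  rw [Pm_dec hα1 hβ1 h1 h0 ha hb]
  have : x1 ∈ eigSp F a 1 := by rw [mem_eigSp, h1, one_smul]
  rw [h.primitive, Submodule.mem_span_singleton] at this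
  obtain ⟨t, ht⟩ := this
  exact ⟨t, ht.symm⟩

theorem IsAxis.cen {α β : F} (hchar : (2 : F) ≠ 0) (hα0 : α ≠ 0) (hα1 : α ≠ 1) (hβ1 : β ≠ 1)
    {a : V} (h : IsAxis F α β a) {τ : V ≃ₗ[F] V} (hτ : IsMiyamoto F α β a τ) :
    Cen α β a (Pm α β a) τ.toLinearMap := by
  have t1 : ∀ x, a * x = x → τ x = x := fun x hx => hτ.fix_plus x
    (Submodule.mem_sup_left (Submodule.mem_sup_left (by rw [mem_eigSp, hx, one_smul])))
  have t0 : ∀ x, a * x = 0 → τ x = x := fun x hx => hτ.fix_plus x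
    (Submodule.mem_sup_left (Submodule.mem_sup_right (by rw [mem_eigSp, hx, zero_smul])))
  have ta : ∀ x, a * x = α • x → τ x = x := fun x hx => hτ.fix_plus x
    (Submodule.mem_sup_right hx)
  have tb : ∀ x, a * x = β • x → τ x = -x := fun x hx => hτ.neg_beta x hx
  -- fixed elements with zero projection
  have fx : ∀ x, τ x = x → ∃ x1 x0 xa : V, a * x1 = x1 ∧ a * x0 = 0 ∧ a * xa = α • xa ∧
      x = x1 + x0 + xa ∧ Pm α β a x = x1 := by
    intro x hx
    obtain ⟨x1, x0, xa, xb, h1, h0, ha, hb, rfl⟩ := h.dec x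
    have : xb = 0 := by
      rw [map_add, map_add, map_add, t1 _ h1, t0 _ h0, ta _ ha, tb _ hb] at hx
      have : (2 : F) • xb = 0 := by
        have := add_left_cancel hx
        rw [two_smul]; nth_rewrite 1 [← this]; simp
      exact (smul_eq_zero.1 this).resolve_left hchar
    subst this
    exact ⟨x1, x0, xa, h1, h0, ha, by simp, Pm_dec hα1 hβ1 h1 h0 ha hb⟩
  have fx' : ∀ x, τ x = x → Pm α β a x = 0 → ∃ x0 xa : V, a * x0 = 0 ∧ a * xa = α • xa ∧
      x = x0 + xa := by
    intro x hx hp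
    obtain ⟨x1, x0, xa, h1, h0, ha, e, e'⟩ := fx x hx
    exact ⟨x0, xa, h0, ha, by rw [e, ← e', hp, zero_add]⟩
  have f00 : ∀ u w, a * u = 0 → a * w = 0 → a * (u * w) = 0 := by
    intro u w hu hw
    have := h.fusion_zero_zero u (by rw [mem_eigSp, hu, zero_smul]) w
      (by rw [mem_eigSp, hw, zero_smul])
    rwa [mem_eigSp, zero_smul] at this
  have f0a : ∀ u w, a * u = 0 → a * w = α • w → a * (u * w) = α • (u * w) := by
    intro u w hu hw
    exact h.fusion_zero_alpha u (by rw [mem_eigSp, hu, zero_smul]) w hw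
  have faa : ∀ u w, a * u = α • u → a * w = α • w → ∃ r1 r0, a * r1 = r1 ∧ a * r0 = 0 ∧
      u * w = r1 + r0 := by
    intro u w hu hw
    obtain ⟨r1, h1, r0, h0, e⟩ := Submodule.mem_sup.1 (h.fusion_alpha_alpha u hu w hw)
    rw [mem_eigSp] at h1 h0
    exact ⟨r1, r0, by simpa using h1, by simpa using h0, e.symm⟩
  have prodform : ∀ y z, τ y = y → τ z = z → Pm α β a y = 0 → Pm α β a z = 0 →
      ∃ r1 r0 k l m : V, a * r1 = r1 ∧ a * r0 = 0 ∧ a * k = 0 ∧ a * l = α • l ∧ a * m = α • m ∧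
        y * z = r1 + r0 + k + l + m ∧ Pm α β a (y * z) = r1 ∧
        y * (a * z) = α • (r1 + r0 + l) ∧ z * (a * y) = α • (r1 + r0 + m) ∧
        (a * y) * (a * z) = (α * α) • (r1 + r0) := by
    intro y z hy hz py pz
    obtain ⟨y0, ya, hy0, hya, rfl⟩ := fx' y hy py
    obtain ⟨z0, za, hz0, hza, rfl⟩ := fx' z hz pz
    obtain ⟨r1, r0, h1, h0, e⟩ := faa ya za hya hza
    have hk := f00 _ _ hy0 hz0
    have hl := f0a _ _ hy0 hza
    have hm := f0a _ _ hz0 hya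
    refine ⟨r1, r0, y0 * z0, y0 * za, z0 * ya, h1, h0, hk, hl, hm, ?_, ?_, ?_, ?_, ?_⟩
    · simp only [add_mul, mul_add, e, mul_comm ya z0]; abel
    · have := Pm_dec (xb := (0 : V)) hα1 hβ1 h1 (show a * (r0 + y0 * z0) = 0 by
        rw [mul_add, h0, hk, add_zero]) (show a * (y0 * za + z0 * ya) = α • (y0 * za + z0 * ya) by
        rw [mul_add, hl, hm, smul_add]) (by simp)
      rw [← this]; congr 1
      simp only [add_mul, mul_add, e, mul_comm ya z0]; abel
    · rw [mul_add a, hz0, hza, zero_add, mul_smul_comm, add_mul, e]; congr 1; abel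
    · rw [mul_add a, hy0, hya, zero_add, mul_smul_comm, add_mul, mul_comm za, e]; congr 1; abel
    · rw [mul_add a, hy0, hya, zero_add, mul_add a, hz0, hza, zero_add, smul_mul_smul_comm, e]
  refine ⟨h.idem, ?_, ?_, ?_, ?_, ?_, ?_, ?_, ?_, ?_, ?_, ?_, ?_⟩
  · intro x hx
    have := Pm_dec (xa := (0 : V)) (xb := (0 : V)) (x0 := (0 : V)) hα1 hβ1 hx (by simp) (by simp)
      (by simp)
    simpa using this
  · intro x
    obtain ⟨x1, x0, xa, xb, h1, h0, ha, hb, rfl⟩ := h.dec x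
    rw [Pm_dec hα1 hβ1 h1 h0 ha hb]
    have := Pm_dec (x1 := x1) (x0 := 0) (xa := α • xa) (xb := β • xb) hα1 hβ1 h1
      (by simp) (by rw [mul_smul_comm, ha]) (by rw [mul_smul_comm, hb])
    rw [mul_add, mul_add, mul_add, h1, h0, ha, hb, this]
  · intro x
    obtain ⟨x1, x0, xa, xb, h1, h0, ha, hb, rfl⟩ := h.dec x
    rw [Pm_dec hα1 hβ1 h1 h0 ha hb, h1]
  · intro x
    obtain ⟨x1, x0, xa, xb, h1, h0, ha, hb, rfl⟩ := h.dec x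
    rw [Pm_dec hα1 hβ1 h1 h0 ha hb]
    simp only [LinearEquiv.coe_coe, map_add, t1 _ h1, t0 _ h0, ta _ ha, tb _ hb]
    simp only [← map_add]
    exact Pm_dec hα1 hβ1 h1 h0 ha (by rw [mul_neg, hb, smul_neg])
  · exact t1 _ h.idem
  · intro x
    obtain ⟨x1, x0, xa, xb, h1, h0, ha, hb, rfl⟩ := h.dec x
    simp only [LinearEquiv.coe_coe, map_add, t1 _ h1, t0 _ h0, ta _ ha, tb _ hb, map_neg, neg_neg]
  · intro x y; exact hτ.map_mul x y
  · intro x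
    obtain ⟨x1, x0, xa, xb, h1, h0, ha, hb, rfl⟩ := h.dec x
    simp only [LinearEquiv.coe_coe, map_add, t1 _ h1, t0 _ h0, ta _ ha, tb _ hb]
    have : x1 + x0 + xa + xb - (x1 + x0 + xa + -xb) = (2 : F) • xb := by module
    rw [this, mul_smul_comm, hb, smul_comm]
  · intro x hx
    obtain ⟨x1, x0, xa, h1, h0, ha, e, e'⟩ := fx x hx
    rw [e', e]
    simp only [mul_add, h1, h0, ha, mul_smul_comm, mul_zero]
    module
  · intro y z hy hz py pz
    obtain ⟨r1, r0, k, l, m, h1, h0, hk, hl, hm, e, ep, e1, e2, e3⟩ := prodform y z hy hz py pz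
    rw [ep, e1, e2, e3, e]
    simp only [mul_add, h1, h0, hk, hl, hm]
    module
  · intro y z hy hz py pz
    obtain ⟨r1, r0, k, l, m, h1, h0, hk, hl, hm, e, ep, e1, e2, e3⟩ := prodform y z hy hz py pz
    rw [ep, e1, e2, e]
    simp only [mul_add, mul_smul_comm, h1, h0, hk, hl, hm]
    module
  · intro y z hy hz py pz
    obtain ⟨r1, r0, k, l, m, h1, h0, hk, hl, hm, e, ep, e1, e2, e3⟩ := prodform y z hy hz py pz
    rw [e1, e2]
    simp only [mul_add, mul_smul_comm, h1, h0, hk, hl, hm]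
    module

end Basic

set_option linter.all false
section Key
variable {F}
variable {A : Type*} [NonUnitalNonAssocCommRing A] [Module F A] [SMulCommClass F A A]
  [IsScalarTower F A A] {α β : F} {c : A} {P τ : A →ₗ[F] A}

theorem Cen.P_c (h : Cen α β c P τ) : P c = c := h.P_one c h.idem

theorem Cen.quadg (h : Cen α β c P τ) {y : A} {f : F} (hy : τ y = y) (py : P y = f • c) :
    c * (c * y) = α • (c * y) + ((1 - α) * f) • c := by
  rw [h.quad y hy, py, smul_smul]

theorem Cen.Jg (h : Cen α β c P τ) {y z : A} {f g : F} (hy : τ y = y) (hz : τ z = z)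
    (py : P y = f • c) (pz : P z = g • c) :
    α • (c * (y * z)) = α • P (y * z) + α • (y * (c * z)) + α • (z * (c * y))
      - (2 : F) • ((c * y) * (c * z)) + (α * g) • (c * y) + (α * f) • (c * z)
      + ((2 - 4 * α) * f * g) • c := by
  have k := h.J (y - f • c) (z - g • c) (by simp [hy, h.τ_c]) (by simp [hz, h.τ_c])
    (by simp [py, h.P_c]) (by simp [pz, h.P_c])
  have q1 := h.quadg hy py
  have q2 := h.quadg hz pz
  have e1 : z * c = c * z := mul_comm _ _
  have e2 : y * c = c * y := mul_comm _ _
  have e3 : (c * y) * c = c * (c * y) := mul_comm _ _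
  have e4 : (c * z) * c = c * (c * z) := mul_comm _ _
  simp only [mul_sub, sub_mul, smul_mul_assoc, mul_smul_comm, map_sub, map_smul, h.P_mul, h.idem,
    e1, e2, e3, e4, q1, q2, py, pz, h.P_c, mul_add, add_mul] at k
  linear_combination (norm := module) k

theorem Cen.J'g (h : Cen α β c P τ) {y z : A} {f g : F} (hy : τ y = y) (hz : τ z = z)
    (py : P y = f • c) (pz : P z = g • c) :
    α • (c * (y * z)) + α • P (y * z) = c * (y * (c * z)) + c * (z * (c * y))
      - (α * g) • (c * y) - (α * f) • (c * z) + ((4 * α - 2) * f * g) • c := by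
  have k := h.J' (y - f • c) (z - g • c) (by simp [hy, h.τ_c]) (by simp [hz, h.τ_c])
    (by simp [py, h.P_c]) (by simp [pz, h.P_c])
  have q1 := h.quadg hy py
  have q2 := h.quadg hz pz
  have e1 : z * c = c * z := mul_comm _ _
  have e2 : y * c = c * y := mul_comm _ _
  have e3 : (c * y) * c = c * (c * y) := mul_comm _ _
  have e4 : (c * z) * c = c * (c * z) := mul_comm _ _
  simp only [mul_sub, sub_mul, smul_mul_assoc, mul_smul_comm, map_sub, map_smul, h.P_mul, h.idem,
    e1, e2, e3, e4, q1, q2, py, pz, h.P_c, mul_add, add_mul] at k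
  linear_combination (norm := module) k

theorem Cen.J3g (h : Cen α β c P τ) {y z : A} {f g : F} (hy : τ y = y) (hz : τ z = z)
    (py : P y = f • c) (pz : P z = g • c) :
    c * (y * (c * z)) - c * (z * (c * y)) = α • (y * (c * z) - z * (c * y)) := by
  have k := h.J3 (y - f • c) (z - g • c) (by simp [hy, h.τ_c]) (by simp [hz, h.τ_c])
    (by simp [py, h.P_c]) (by simp [pz, h.P_c])
  have q1 := h.quadg hy py
  have q2 := h.quadg hz pz
  have e1 : z * c = c * z := mul_comm _ _
  have e2 : y * c = c * y := mul_comm _ _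
  have e3 : (c * y) * c = c * (c * y) := mul_comm _ _
  have e4 : (c * z) * c = c * (c * z) := mul_comm _ _
  simp only [mul_sub, sub_mul, smul_mul_assoc, mul_smul_comm, map_sub, map_smul, h.P_mul, h.idem,
    e1, e2, e3, e4, q1, q2, py, pz, h.P_c, mul_add, add_mul] at k
  linear_combination (norm := module) k

theorem Cen.PJg (h : Cen α β c P τ) {y z : A} {f g : F} (hy : τ y = y) (hz : τ z = z)
    (py : P y = f • c) (pz : P z = g • c) :
    P (y * (c * z)) + P (z * (c * y)) = (2 * α) • P (y * z) + ((2 - 2 * α) * f * g) • c := by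
  have k := congrArg P (h.J'g hy hz py pz)
  have pp : P (P (y * z)) = P (y * z) := h.P_one _ (h.mul_P _)
  simp only [map_sub, map_add, map_smul, h.P_mul, h.P_c, py, pz, pp] at k
  linear_combination (norm := module) -k

/-- the action of `c` on `s` where `c t = 2s + 2βc + βt`. -/
theorem Cen.cs (h : Cen α β c P τ) {t s : A} {l : F}
    (ht : τ t = t) (pt : P t = (2 * l) • c)
    (ct : c * t = (2 : F) • s + (2 * β) • c + β • t) :
    (2 : F) • (c * s) = (2 * (α - β)) • s + (2 * ((1 - α) * l + β * (α - β - 1))) • c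
      + (β * (α - β)) • t := by
  have q := h.quadg ht pt
  rw [ct] at q
  simp only [mul_add, mul_smul_comm, h.idem, ct] at q
  linear_combination (norm := module) q

theorem Cen.Ps (h : Cen α β c P τ) {t s : A} {l : F}
    (pt : P t = (2 * l) • c)
    (ct : c * t = (2 : F) • s + (2 * β) • c + β • t) :
    (2 : F) • (P s) = (2 * (l - β - β * l)) • c := by
  have q := h.P_mul t
  rw [ct] at q
  simp only [map_add, map_smul, h.P_c, pt] at q
  linear_combination (norm := module) q

section K
variable (h : Cen α β c P τ) {t s o t' e : A} {l l' m : F}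
    (ht : τ t = t) (pt : P t = (2 * l) • c)
    (ct : c * t = (2 : F) • s + (2 * β) • c + β • t)
    (pt' : P t' = (2 * m) • c)
    (ct' : c * t' = (2 : F) • e + (2 * β) • c + β • t')
    (tt : t * t = (1 + 2 * β) • t + (2 : F) • o)
    (ts : (2 : F) • (t * s) = (4 * (α - β)) • s + (2 * ((1 - α) * l' + β * (α - β - 1))) • t
      + (β * (α - β)) • ((2 : F) • c + t'))
include h ht pt ct pt' ct' tt ts

theorem Cen.K1 (h2 : (2 : F) ≠ 0) (hαβ : α - β ≠ 0) {ω : F}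
    (hω : (α - β) * ω = -2*(α-β)*β*l+(α-β)*β*m-(α-β)*β+(α-β)*l+2*(α-1)*(l^2-l*l')) :
    P o = ω • c := by
  have q := h.PJg ht ht pt pt
  have ps := h.Ps pt ct
  have e1 : t * c = c * t := mul_comm _ _
  have tct : t * (c * t) = (4 * (α - β)) • s + (2 * ((1 - α) * l' + β * (α - β - 1))) • t
      + (β * (α - β)) • ((2 : F) • c + t') + (2 * β) • (c * t) +
      β • ((1 + 2 * β) • t + (2 : F) • o) := by
    rw [ct, mul_add, mul_add, mul_smul_comm, mul_smul_comm, mul_smul_comm, ts, tt, e1, ct]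
  rw [tct] at q
  simp only [tt, map_add, map_smul, pt, pt', h.P_c, h.P_mul] at q
  have r : (4 * (α - β)) • P o = (4 * (α - β)) • (ω • c) := by
    have : (4 * (α - β)) • (ω • c) = (4 * (-2*(α-β)*β*l+(α-β)*β*m-(α-β)*β+(α-β)*l+2*(α-1)*(l^2-l*l'))) • c := by
      rw [smul_smul, ← hω, mul_assoc]
    rw [this]
    linear_combination (norm := module) -q + (4 * (α - β)) • ps
  have h4 : (4 * (α - β)) ≠ 0 := by
    have : (4 : F) = 2 * 2 := by norm_num
    rw [this]; exact mul_ne_zero (mul_ne_zero h2 h2) hαβ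
  exact smul_right_injective A h4 r

theorem Cen.K2 {ω : F} (po : P o = ω • c)
    (hω : (α - β) * ω = -2*(α-β)*β*l+(α-β)*β*m-(α-β)*β+(α-β)*l+2*(α-1)*(l^2-l*l')) :
    (2 * (α - 2 * β)) • (c * o) = (2 * (α - 2 * β) * ω) • c +
      (4*α^2-2*α*β+4*β^2-α-2*β-4*α*(l+l')+4*l') • ((2 : F) • s + β • t + (2 * (β - l)) • c)
      + (2 * β * (α - β)) • ((2 : F) • e + β • t' + (2 * (β - m)) • c) := by
  have q := h.J'g ht ht pt pt
  have cs := h.cs ht pt ct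
  have ps := h.Ps pt ct
  have e1 : t * c = c * t := mul_comm _ _
  have tct : t * (c * t) = (4 * (α - β)) • s + (2 * ((1 - α) * l' + β * (α - β - 1))) • t
      + (β * (α - β)) • ((2 : F) • c + t') + (2 * β) • (c * t) +
      β • ((1 + 2 * β) • t + (2 : F) • o) := by
    rw [ct, mul_add, mul_add, mul_smul_comm, mul_smul_comm, mul_smul_comm, ts, tt, e1, ct]
  rw [tct] at q
  simp only [tt, map_add, map_smul, mul_add, mul_smul_comm, pt, pt', po, h.P_c, h.P_mul, ct, ct', h.idem] at q
  have k : (4 * ((α - β) * ω)) • c = (4 * (-2*(α-β)*β*l+(α-β)*β*m-(α-β)*β+(α-β)*l+2*(α-1)*(l^2-l*l'))) • c := by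
    rw [hω]
  linear_combination (norm := module) q + (4 * α) • cs - k

theorem Cen.K3 {ω : F} (po : P o = ω • c)
    (hω : (α - β) * ω = -2*(α-β)*β*l+(α-β)*β*m-(α-β)*β+(α-β)*l+2*(α-1)*(l^2-l*l')) :
    (8 * (α - 2 * β)) • (s * s) = (2 : F) • (
      (-2*α^3*β+4*α^3*l-16*α^2*β^2+16*α^2*β*l+4*α^2*β*l'+2*α^2*β*m-12*α^2*l^2-4*α^2*l*l'+26*α*β^3
        -24*α*β^2*l-2*α*β^2*m+8*α*β^2+16*α*β*l^2-12*α*β*l-4*α*β*l'+4*α*l^2+4*α*l*l'-8*β^4-8*β^3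
        +16*β^2*l-8*β*l^2) • c
      + ((α-β)*(-2*(α-1)*(α-4*β)*l'+4*α*β*l+β*(4*β^2-10*α*β-α+6*β))) • t
      + (β*(α-β)^2*(α-4*β)) • t' + (-2*α^2*β+2*α*β^2) • e + (2*α^2*β-6*α*β^2+4*β^3) • o
      + (-24*α^2*β+8*α^2*l+4*α^2*l'+40*α*β^2-8*α*β*l+4*α*β-4*α*l'-16*β^3) • s) := by
  have q := h.Jg ht ht pt pt
  have cs := h.cs ht pt ct
  have K := h.K2 ht pt ct pt' ct' tt ts po hω
  have e1 : t * c = c * t := mul_comm _ _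
  have e2 : s * c = c * s := mul_comm _ _
  have e3 : s * t = t * s := mul_comm _ _
  have tct : t * (c * t) = (4 * (α - β)) • s + (2 * ((1 - α) * l' + β * (α - β - 1))) • t
      + (β * (α - β)) • ((2 : F) • c + t') + (2 * β) • (c * t) +
      β • ((1 + 2 * β) • t + (2 : F) • o) := by
    rw [ct, mul_add, mul_add, mul_smul_comm, mul_smul_comm, mul_smul_comm, ts, tt, e1, ct]
  rw [tct] at q
  simp only [tt, map_add, map_smul, mul_add, add_mul, smul_mul_assoc, mul_smul_comm, pt, pt', po,
    h.P_c, h.P_mul, ct, ct', h.idem, e1, e2, e3] at q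
  have k : (4 * ((α - β) * ω)) • c = (4 * (-2*(α-β)*β*l+(α-β)*β*m-(α-β)*β+(α-β)*l+2*(α-1)*(l^2-l*l'))) • c := by
    rw [hω]
  linear_combination (norm := module) (α - 2 * β) • q - α • K - (8 * β * (α - 2 * β)) • cs -
    (4 * β * (α - 2 * β)) • ts

end K
end Key

set_option linter.all false
section Hexa
variable {F}
variable {A : Type*} [NonUnitalNonAssocCommRing A] [Module F A]

def Loc (α β l m n : F) (c x1 x5 x2 x4 x3 : A) : Prop :=
  ∃ P τ : A →ₗ[F] A, Cen α β c P τ ∧ τ x1 = x5 ∧ τ x2 = x4 ∧ τ x3 = x3 ∧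
    P x1 = l • c ∧ P x2 = m • c ∧ P x3 = n • c

theorem Loc.symm {α β l m n : F} {c x1 x5 x2 x4 x3 : A} (h : Loc α β l m n c x1 x5 x2 x4 x3) :
    Loc α β l m n c x5 x1 x4 x2 x3 := by
  obtain ⟨P, τ, h, h1, h2, h3, h4, h5, h6⟩ := h
  refine ⟨P, τ, h, ?_, ?_, h3, ?_, ?_, h6⟩
  · rw [← h1, h.τ_τ]
  · rw [← h2, h.τ_τ]
  · rw [← h1, h.P_τ, h4]
  · rw [← h2, h.P_τ, h5]

structure Hx (α β l l' m m' n n' : F) (b0 b1 b2 b3 b4 b5 s e o p0 p1 p2 : A) : Prop where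
  L0 : Loc α β l m n b0 b1 b5 b2 b4 b3
  L1 : Loc α β l' m' n' b1 b2 b0 b3 b5 b4
  L2 : Loc α β l m n b2 b3 b1 b4 b0 b5
  L3 : Loc α β l' m' n' b3 b4 b2 b5 b1 b0
  L4 : Loc α β l m n b4 b5 b3 b0 b2 b1
  L5 : Loc α β l' m' n' b5 b0 b4 b1 b3 b2
  s01 : b0 * b1 = s + β • (b0 + b1)
  s12 : b1 * b2 = s + β • (b1 + b2)
  s23 : b2 * b3 = s + β • (b2 + b3)
  s34 : b3 * b4 = s + β • (b3 + b4)
  s45 : b4 * b5 = s + β • (b4 + b5)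
  s50 : b5 * b0 = s + β • (b5 + b0)
  e02 : b0 * b2 = e + β • (b0 + b2)
  e24 : b2 * b4 = e + β • (b2 + b4)
  e40 : b4 * b0 = e + β • (b4 + b0)
  o13 : b1 * b3 = o + β • (b1 + b3)
  o35 : b3 * b5 = o + β • (b3 + b5)
  o51 : b5 * b1 = o + β • (b5 + b1)
  p03 : b0 * b3 = p0
  p14 : b1 * b4 = p1
  p25 : b2 * b5 = p2

variable {α β l l' m m' n n' : F} {b0 b1 b2 b3 b4 b5 s e o p0 p1 p2 : A}

theorem Hx.rot (h : Hx α β l l' m m' n n' b0 b1 b2 b3 b4 b5 s e o p0 p1 p2) :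
    Hx α β l' l m' m n' n b1 b2 b3 b4 b5 b0 s o e p1 p2 p0 where
  L0 := h.L1
  L1 := h.L2
  L2 := h.L3
  L3 := h.L4
  L4 := h.L5
  L5 := h.L0
  s01 := h.s12
  s12 := h.s23
  s23 := h.s34
  s34 := h.s45
  s45 := h.s50
  s50 := h.s01
  e02 := h.o13
  e24 := h.o35
  e40 := h.o51
  o13 := h.e24
  o35 := h.e40
  o51 := h.e02
  p03 := h.p14
  p14 := h.p25
  p25 := by rw [mul_comm, h.p03]

theorem Hx.refl (h : Hx α β l l' m m' n n' b0 b1 b2 b3 b4 b5 s e o p0 p1 p2) :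
    Hx α β l l' m m' n n' b0 b5 b4 b3 b2 b1 s e o p0 p2 p1 where
  L0 := h.L0.symm
  L1 := h.L5.symm
  L2 := h.L4.symm
  L3 := h.L3.symm
  L4 := h.L2.symm
  L5 := h.L1.symm
  s01 := by rw [mul_comm, h.s50, add_comm b5]
  s12 := by rw [mul_comm, h.s45, add_comm b4]
  s23 := by rw [mul_comm, h.s34, add_comm b3]
  s34 := by rw [mul_comm, h.s23, add_comm b2]
  s45 := by rw [mul_comm, h.s12, add_comm b1]
  s50 := by rw [mul_comm, h.s01, add_comm b0]
  e02 := by rw [mul_comm, h.e40, add_comm b4]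
  e24 := by rw [mul_comm, h.e24, add_comm b2]
  e40 := by rw [mul_comm, h.e02, add_comm b0]
  o13 := by rw [mul_comm, h.o35, add_comm b3]
  o35 := by rw [mul_comm, h.o13, add_comm b1]
  o51 := by rw [mul_comm, h.o51, add_comm b5]
  p03 := h.p03
  p14 := by rw [mul_comm, h.p25]
  p25 := by rw [mul_comm, h.p14]

variable [SMulCommClass F A A] [IsScalarTower F A A]

theorem Hx.cen (h : Hx α β l l' m m' n n' b0 b1 b2 b3 b4 b5 s e o p0 p1 p2) :
    ∃ P τ : A →ₗ[F] A, Cen α β b0 P τ ∧ τ (b1 + b5) = b1 + b5 ∧ τ (b2 + b4) = b2 + b4 ∧ τ b3 = b3 ∧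
      P (b1 + b5) = (2 * l) • b0 ∧ P (b2 + b4) = (2 * m) • b0 ∧ P b3 = n • b0 ∧
      τ s = s ∧ τ e = e ∧ τ o = o ∧ τ p0 = p0 ∧ τ p1 = p2 := by
  obtain ⟨P, τ, c, h1, h2, h3, h4, h5, h6⟩ := h.L0
  have h1' : τ b5 = b1 := by rw [← h1, c.τ_τ]
  have h2' : τ b4 = b2 := by rw [← h2, c.τ_τ]
  have h4' : P b5 = l • b0 := by rw [← h1, c.P_τ, h4]
  have h5' : P b4 = m • b0 := by rw [← h2, c.P_τ, h5]
  refine ⟨P, τ, c, ?_, ?_, h3, ?_, ?_, h6, ?_, ?_, ?_, ?_, ?_⟩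
  · rw [map_add, h1, h1', add_comm]
  · rw [map_add, h2, h2', add_comm]
  · rw [map_add, h4, h4']; module
  · rw [map_add, h5, h5']; module
  · have := congrArg τ h.s01
    rw [c.τ_mul, map_add, map_smul, map_add, c.τ_c, h1, mul_comm, h.s50] at this
    linear_combination (norm := module) -this
  · have := congrArg τ h.e24
    rw [c.τ_mul, map_add, map_smul, map_add, h2, h2', mul_comm, h.e24] at this
    linear_combination (norm := module) -this
  · have := congrArg τ h.o51
    rw [c.τ_mul, map_add, map_smul, map_add, h1, h1', mul_comm, h.o51] at this
    linear_combination (norm := module) -this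
  · rw [← h.p03, c.τ_mul, c.τ_c, h3]
  · rw [← h.p14, c.τ_mul, h1, h2', mul_comm, h.p25]

theorem Hx.ct1 (h : Hx α β l l' m m' n n' b0 b1 b2 b3 b4 b5 s e o p0 p1 p2) :
    b0 * (b1 + b5) = (2 : F) • s + (2 * β) • b0 + β • (b1 + b5) := by
  rw [mul_add, h.s01, mul_comm b0 b5, h.s50]; module

theorem Hx.ct2 (h : Hx α β l l' m m' n n' b0 b1 b2 b3 b4 b5 s e o p0 p1 p2) :
    b0 * (b2 + b4) = (2 : F) • e + (2 * β) • b0 + β • (b2 + b4) := by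
  rw [mul_add, h.e02, mul_comm b0 b4, h.e40]; module

theorem Hx.b0s (h : Hx α β l l' m m' n n' b0 b1 b2 b3 b4 b5 s e o p0 p1 p2) :
    (2 : F) • (b0 * s) = (2 * (α - β)) • s + (2 * ((1 - α) * l + β * (α - β - 1))) • b0
      + (β * (α - β)) • (b1 + b5) := by
  obtain ⟨P, τ, c, h1, h2, h3, h4, h5, h6, -⟩ := h.cen
  exact c.cs h1 h4 h.ct1

theorem Hx.b0e (h : Hx α β l l' m m' n n' b0 b1 b2 b3 b4 b5 s e o p0 p1 p2) :
    (2 : F) • (b0 * e) = (2 * (α - β)) • e + (2 * ((1 - α) * m + β * (α - β - 1))) • b0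
      + (β * (α - β)) • (b2 + b4) := by
  obtain ⟨P, τ, c, h1, h2, h3, h4, h5, h6, -⟩ := h.cen
  exact c.cs h2 h5 h.ct2

theorem Hx.tt (h : Hx α β l l' m m' n n' b0 b1 b2 b3 b4 b5 s e o p0 p1 p2) :
    (b1 + b5) * (b1 + b5) = (1 + 2 * β) • (b1 + b5) + (2 : F) • o := by
  obtain ⟨P, τ, c1, -⟩ := h.L1
  obtain ⟨P, τ, c5, -⟩ := h.L5
  rw [mul_add, add_mul, add_mul, c1.idem, c5.idem, mul_comm b1 b5, h.o51]; module

theorem Hx.tt2 (h : Hx α β l l' m m' n n' b0 b1 b2 b3 b4 b5 s e o p0 p1 p2) :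
    (b2 + b4) * (b2 + b4) = (1 + 2 * β) • (b2 + b4) + (2 : F) • e := by
  have := h.rot.rot.rot.tt
  rw [add_comm b4 b2] at this
  exact this

theorem Hx.ts (h : Hx α β l l' m m' n n' b0 b1 b2 b3 b4 b5 s e o p0 p1 p2) :
    (2 : F) • ((b1 + b5) * s) = (4 * (α - β)) • s +
      (2 * ((1 - α) * l' + β * (α - β - 1))) • (b1 + b5)
      + (β * (α - β)) • ((2 : F) • b0 + (b2 + b4)) := by
  have k1 := h.rot.b0s
  have k5 := h.rot.rot.rot.rot.rot.b0s
  rw [add_mul]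
  linear_combination (norm := module) k1 + k5

theorem Hx.ts2 (h : Hx α β l l' m m' n n' b0 b1 b2 b3 b4 b5 s e o p0 p1 p2) :
    (2 : F) • ((b2 + b4) * e) = (4 * (α - β)) • e +
      (2 * ((1 - α) * m + β * (α - β - 1))) • (b2 + b4)
      + (β * (α - β)) • ((2 : F) • b0 + (b2 + b4)) := by
  have k1 := h.rot.rot.b0e
  have k5 := h.rot.rot.rot.rot.b0e
  rw [add_mul]
  linear_combination (norm := module) k1 + k5

def om (α β l l' m : F) : F :=
  (-2*(α-β)*β*l+(α-β)*β*m-(α-β)*β+(α-β)*l+2*(α-1)*(l^2-l*l')) / (α - β)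

theorem om_eq (hαβ : α - β ≠ 0) : (α - β) * om α β l l' m =
    -2*(α-β)*β*l+(α-β)*β*m-(α-β)*β+(α-β)*l+2*(α-1)*(l^2-l*l') := by
  unfold om; field_simp

theorem Hx.Po (h2 : (2 : F) ≠ 0) (hαβ : α - β ≠ 0)
    (h : Hx α β l l' m m' n n' b0 b1 b2 b3 b4 b5 s e o p0 p1 p2) {P τ : A →ₗ[F] A}
    (c : Cen α β b0 P τ) (h1 : τ (b1 + b5) = b1 + b5) (h4 : P (b1 + b5) = (2 * l) • b0)
    (h5 : P (b2 + b4) = (2 * m) • b0) : P o = om α β l l' m • b0 :=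
  c.K1 h1 h4 h.ct1 h5 h.ct2 h.tt h.ts h2 hαβ (om_eq hαβ)

theorem Hx.b0o (h2 : (2 : F) ≠ 0) (hαβ : α - β ≠ 0)
    (h : Hx α β l l' m m' n n' b0 b1 b2 b3 b4 b5 s e o p0 p1 p2) :
    (2 * (α - 2 * β)) • (b0 * o) = (2 * (α - 2 * β) * om α β l l' m) • b0 +
      (4*α^2-2*α*β+4*β^2-α-2*β-4*α*(l+l')+4*l') •
        ((2 : F) • s + β • (b1 + b5) + (2 * (β - l)) • b0)
      + (2 * β * (α - β)) • ((2 : F) • e + β • (b2 + b4) + (2 * (β - m)) • b0) := by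
  obtain ⟨P, τ, c, h1, h2', h3, h4, h5, h6, -⟩ := h.cen
  exact c.K2 h1 h4 h.ct1 h5 h.ct2 h.tt h.ts (h.Po h2 hαβ c h1 h4 h5) (om_eq hαβ)

theorem Hx.ss (h2 : (2 : F) ≠ 0) (hαβ : α - β ≠ 0)
    (h : Hx α β l l' m m' n n' b0 b1 b2 b3 b4 b5 s e o p0 p1 p2) :
    (8 * (α - 2 * β)) • (s * s) = (2 : F) • (
      (-2*α^3*β+4*α^3*l-16*α^2*β^2+16*α^2*β*l+4*α^2*β*l'+2*α^2*β*m-12*α^2*l^2-4*α^2*l*l'+26*α*β^3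
        -24*α*β^2*l-2*α*β^2*m+8*α*β^2+16*α*β*l^2-12*α*β*l-4*α*β*l'+4*α*l^2+4*α*l*l'-8*β^4-8*β^3
        +16*β^2*l-8*β*l^2) • b0
      + ((α-β)*(-2*(α-1)*(α-4*β)*l'+4*α*β*l+β*(4*β^2-10*α*β-α+6*β))) • (b1 + b5)
      + (β*(α-β)^2*(α-4*β)) • (b2 + b4) + (-2*α^2*β+2*α*β^2) • e + (2*α^2*β-6*α*β^2+4*β^3) • o
      + (-24*α^2*β+8*α^2*l+4*α^2*l'+40*α*β^2-8*α*β*l+4*α*β-4*α*l'-16*β^3) • s) := by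
  obtain ⟨P, τ, c, h1, h2', h3, h4, h5, h6, -⟩ := h.cen
  exact c.K3 h1 h4 h.ct1 h5 h.ct2 h.tt h.ts (h.Po h2 hαβ c h1 h4 h5) (om_eq hαβ)

theorem Hx.ee (h2 : (2 : F) ≠ 0) (hαβ : α - β ≠ 0)
    (h : Hx α β l l' m m' n n' b0 b1 b2 b3 b4 b5 s e o p0 p1 p2) :
    (8 * (α - 2 * β)) • (e * e) = (2 : F) • (
      (-2*α^3*β+4*α^3*m-16*α^2*β^2+16*α^2*β*m+4*α^2*β*m+2*α^2*β*m-12*α^2*m^2-4*α^2*m*m+26*α*β^3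
        -24*α*β^2*m-2*α*β^2*m+8*α*β^2+16*α*β*m^2-12*α*β*m-4*α*β*m+4*α*m^2+4*α*m*m-8*β^4-8*β^3
        +16*β^2*m-8*β*m^2) • b0
      + ((α-β)*(-2*(α-1)*(α-4*β)*m+4*α*β*m+β*(4*β^2-10*α*β-α+6*β))) • (b2 + b4)
      + (β*(α-β)^2*(α-4*β)) • (b2 + b4) + (-2*α^2*β+2*α*β^2) • e + (2*α^2*β-6*α*β^2+4*β^3) • e
      + (-24*α^2*β+8*α^2*m+4*α^2*m+40*α*β^2-8*α*β*m+4*α*β-4*α*m-16*β^3) • e) := by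
  obtain ⟨P, τ, c, h1, h2', h3, h4, h5, h6, -⟩ := h.cen
  exact c.K3 h2' h5 h.ct2 h5 h.ct2 h.tt2 h.ts2
    (c.K1 h2' h5 h.ct2 h5 h.ct2 h.tt2 h.ts2 h2 hαβ (om_eq hαβ)) (om_eq hαβ)

end Hexa

set_option linter.all false
section Clos
variable {F}

structure Par (α β : F) : Prop where
  h2 : (2 : F) ≠ 0
  a0 : α ≠ 0
  a1 : α - 1 ≠ 0
  b0 : β ≠ 0
  b1 : β - 1 ≠ 0
  ab : α - β ≠ 0
  ab2 : α - 2 * β ≠ 0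

variable {A : Type*} [NonUnitalNonAssocCommRing A] [Module F A]

theorem mem_of_smul {S : Submodule F A} {k : F} {x : A} (hk : k ≠ 0) (h : k • x ∈ S) : x ∈ S :=
  (Submodule.smul_mem_iff S hk).1 h

def Tm (b0 b1 b2 b3 b4 b5 s e o : A) : Submodule F A :=
  Submodule.span F {b0, b1, b2, b3, b4, b5, s, e, o}

def Tp (b0 b1 b2 b3 b4 b5 s e o p0 : A) : Submodule F A :=
  Submodule.span F {b0, b1, b2, b3, b4, b5, s, e, o, p0}

def TT (b0 b1 b2 b3 b4 b5 s e o p0 p1 p2 : A) : Submodule F A :=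
  Submodule.span F {b0, b1, b2, b3, b4, b5, s, e, o, p0, p1, p2}

variable {α β l l' m m' n n' : F} {b0 b1 b2 b3 b4 b5 s e o p0 p1 p2 : A}

theorem Tm_rot : Tm (F := F) b1 b2 b3 b4 b5 b0 s o e = Tm b0 b1 b2 b3 b4 b5 s e o := by
  unfold Tm; congr 1; ext x; simp only [Set.mem_insert_iff, Set.mem_singleton_iff]; tauto

theorem TT_rot : TT (F := F) b1 b2 b3 b4 b5 b0 s o e p1 p2 p0 = TT b0 b1 b2 b3 b4 b5 s e o p0 p1 p2 := by
  unfold TT; congr 1; ext x; simp only [Set.mem_insert_iff, Set.mem_singleton_iff]; tauto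

theorem Tm_le_Tp : Tm (F := F) b0 b1 b2 b3 b4 b5 s e o ≤ Tp b0 b1 b2 b3 b4 b5 s e o p0 := by
  apply Submodule.span_mono; intro x; simp only [Set.mem_insert_iff, Set.mem_singleton_iff]; tauto

theorem Tp_le_TT : Tp (F := F) b0 b1 b2 b3 b4 b5 s e o p0 ≤ TT b0 b1 b2 b3 b4 b5 s e o p0 p1 p2 := by
  apply Submodule.span_mono; intro x; simp only [Set.mem_insert_iff, Set.mem_singleton_iff]; tauto

theorem Tm_gen (S : Submodule F A) (hS : Tm b0 b1 b2 b3 b4 b5 s e o ≤ S) :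
    b0 ∈ S ∧ b1 ∈ S ∧ b2 ∈ S ∧ b3 ∈ S ∧ b4 ∈ S ∧ b5 ∈ S ∧ s ∈ S ∧ e ∈ S ∧ o ∈ S := by
  have : ∀ x ∈ ({b0, b1, b2, b3, b4, b5, s, e, o} : Set A), x ∈ S :=
    fun x hx => hS (Submodule.subset_span hx)
  refine ⟨?_, ?_, ?_, ?_, ?_, ?_, ?_, ?_, ?_⟩ <;> apply this <;> simp

theorem TT_gen (S : Submodule F A) (hS : TT b0 b1 b2 b3 b4 b5 s e o p0 p1 p2 ≤ S) :
    b0 ∈ S ∧ b1 ∈ S ∧ b2 ∈ S ∧ b3 ∈ S ∧ b4 ∈ S ∧ b5 ∈ S ∧ s ∈ S ∧ e ∈ S ∧ o ∈ S ∧ p0 ∈ S ∧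
    p1 ∈ S ∧ p2 ∈ S := by
  have : ∀ x ∈ ({b0, b1, b2, b3, b4, b5, s, e, o, p0, p1, p2} : Set A), x ∈ S :=
    fun x hx => hS (Submodule.subset_span hx)
  refine ⟨?_, ?_, ?_, ?_, ?_, ?_, ?_, ?_, ?_, ?_, ?_, ?_⟩ <;> apply this <;> simp

theorem Tp_gen : p0 ∈ Tp (F := F) b0 b1 b2 b3 b4 b5 s e o p0 := by
  apply Submodule.subset_span; simp

theorem span_map_le {ι : Set A} {S : Submodule F A} (f : A →ₗ[F] A) (hx : ∀ x ∈ ι, f x ∈ S) :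
    ∀ x ∈ Submodule.span F ι, f x ∈ S := by
  intro x h
  have : Submodule.span F ι ≤ S.comap f := Submodule.span_le.2 hx
  exact this h

variable [SMulCommClass F A A] [IsScalarTower F A A]

section gen
variable {c : A} {P τ : A →ₗ[F] A} {S : Submodule F A} {y z : A} {f g : F}
  (h : Cen α β c P τ) (hp : Par α β) (hy : τ y = y) (hz : τ z = z) (py : P y = f • c)
  (pz : P z = g • c) (hc : c ∈ S) (hcy : c * y ∈ S) (hcz : c * z ∈ S) (h1 : c * (y * z) ∈ S)
  (h2 : P (y * z) ∈ S) (h3 : z * (c * y) ∈ S)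
include h hp hy hz py pz hc hcy hcz h1 h2

theorem Cen.mJ1 (h3 : z * (c * y) ∈ S) (h4 : y * (c * z) ∈ S) : (c * y) * (c * z) ∈ S := by
  have k := h.Jg hy hz py pz
  have k' : (2 : F) • ((c * y) * (c * z)) = α • P (y * z) + α • (y * (c * z)) + α • (z * (c * y))
      - α • (c * (y * z)) + (α * g) • (c * y) + (α * f) • (c * z)
      + ((2 - 4 * α) * f * g) • c := by
    linear_combination (norm := module) k
  apply mem_of_smul hp.h2
  rw [k']
  repeat' first | assumption | apply Submodule.add_mem | apply Submodule.sub_mem | apply Submodule.smul_mem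

theorem Cen.mJ2 (h3 : (c * y) * (c * z) ∈ S) (h4 : y * (c * z) ∈ S) : z * (c * y) ∈ S := by
  have k := h.Jg hy hz py pz
  have k' : α • (z * (c * y)) = α • (c * (y * z)) + (2 : F) • ((c * y) * (c * z))
      - α • P (y * z) - α • (y * (c * z)) - (α * g) • (c * y) - (α * f) • (c * z)
      - ((2 - 4 * α) * f * g) • c := by
    linear_combination (norm := module) -k
  apply mem_of_smul hp.a0
  rw [k']
  repeat' first | assumption | apply Submodule.add_mem | apply Submodule.sub_mem | apply Submodule.smul_mem

theorem Cen.mJ3 (h3 : z * (c * y) ∈ S) (h4 : c * (z * (c * y)) ∈ S) : y * (c * z) ∈ S := by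
  have k := h.J'g hy hz py pz
  have k2 := h.J3g hy hz py pz
  have k' : α • (y * (c * z)) = α • (c * (y * z)) + α • P (y * z) - (2 : F) • (c * (z * (c * y)))
     + α • (z * (c * y)) + (α * g) • (c * y) + (α * f) • (c * z)
      - ((4 * α - 2) * f * g) • c := by
    linear_combination (norm := module) -k2 - k
  apply mem_of_smul hp.a0
  rw [k']
  repeat' first | assumption | apply Submodule.add_mem | apply Submodule.sub_mem | apply Submodule.smul_mem

end gen

theorem Hx.mem1 (hp : Par α β) (h : Hx α β l l' m m' n n' b0 b1 b2 b3 b4 b5 s e o p0 p1 p2) :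
    let S := Tm (F := F) b0 b1 b2 b3 b4 b5 s e o
    b0 * b0 ∈ S ∧ b0 * b1 ∈ S ∧ b0 * b2 ∈ S ∧ b0 * b4 ∈ S ∧ b0 * b5 ∈ S ∧ b0 * s ∈ S ∧ b0 * e ∈ S ∧
      b0 * o ∈ S ∧ s * s ∈ S ∧ e * e ∈ S := by
  intro S
  obtain ⟨i0, i1, i2, i3, i4, i5, is, ie, io⟩ := Tm_gen S le_rfl
  obtain ⟨P, τ, c0, -⟩ := h.L0
  have h4 : (2 * (α - 2 * β)) ≠ 0 := mul_ne_zero hp.h2 hp.ab2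
  have h8 : (8 * (α - 2 * β)) ≠ 0 := by
    have : (8 : F) = 2 * 2 * 2 := by norm_num
    rw [this]; exact mul_ne_zero (mul_ne_zero (mul_ne_zero hp.h2 hp.h2) hp.h2) hp.ab2
  refine ⟨?_, ?_, ?_, ?_, ?_, ?_, ?_, ?_, ?_, ?_⟩
  · rwa [c0.idem]
  · rw [h.s01]
    repeat' first | assumption | apply Submodule.add_mem | apply Submodule.sub_mem | apply Submodule.smul_mem
  · rw [h.e02]
    repeat' first | assumption | apply Submodule.add_mem | apply Submodule.sub_mem | apply Submodule.smul_mem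
  · rw [mul_comm, h.e40]
    repeat' first | assumption | apply Submodule.add_mem | apply Submodule.sub_mem | apply Submodule.smul_mem
  · rw [mul_comm, h.s50]
    repeat' first | assumption | apply Submodule.add_mem | apply Submodule.sub_mem | apply Submodule.smul_mem
  · apply mem_of_smul hp.h2
    rw [h.b0s]
    repeat' first | assumption | apply Submodule.add_mem | apply Submodule.sub_mem | apply Submodule.smul_mem
  · apply mem_of_smul hp.h2
    rw [h.b0e]
    repeat' first | assumption | apply Submodule.add_mem | apply Submodule.sub_mem | apply Submodule.smul_mem
  · apply mem_of_smul h4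
    rw [h.b0o hp.h2 hp.ab]
    repeat' first | assumption | apply Submodule.add_mem | apply Submodule.sub_mem | apply Submodule.smul_mem
  · apply mem_of_smul h8
    rw [h.ss hp.h2 hp.ab]
    repeat' first | assumption | apply Submodule.add_mem | apply Submodule.sub_mem | apply Submodule.smul_mem
  · apply mem_of_smul h8
    rw [h.ee hp.h2 hp.ab]
    repeat' first | assumption | apply Submodule.add_mem | apply Submodule.sub_mem | apply Submodule.smul_mem

theorem Hx.b0Tm (hp : Par α β) (h : Hx α β l l' m m' n n' b0 b1 b2 b3 b4 b5 s e o p0 p1 p2) :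
    ∀ x ∈ Tm (F := F) b0 b1 b2 b3 b4 b5 s e o, b0 * x ∈ Tp (F := F) b0 b1 b2 b3 b4 b5 s e o p0 := by
  obtain ⟨k0, k1, k2, k4, k5, k6, k7, k8, -⟩ := h.mem1 hp
  apply span_map_le (LinearMap.mulLeft F b0)
  simp only [Set.mem_insert_iff, Set.mem_singleton_iff, LinearMap.mulLeft_apply]
  rintro x (rfl | rfl | rfl | rfl | rfl | rfl | rfl | rfl | rfl)
  all_goals first | (apply Tm_le_Tp; assumption) | (rw [h.p03]; exact Tp_gen)

theorem Hx.b0p0 (h : Hx α β l l' m m' n n' b0 b1 b2 b3 b4 b5 s e o p0 p1 p2) :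
    b0 * p0 = α • p0 + ((1 - α) * n) • b0 := by
  obtain ⟨P, τ, c, h1, h2, h3, h4, h5, h6, -⟩ := h.cen
  have := c.quadg h3 h6
  rwa [h.p03] at this

theorem Hx.b0Tp (hp : Par α β) (h : Hx α β l l' m m' n n' b0 b1 b2 b3 b4 b5 s e o p0 p1 p2) :
    ∀ x ∈ Tp (F := F) b0 b1 b2 b3 b4 b5 s e o p0, b0 * x ∈ Tp (F := F) b0 b1 b2 b3 b4 b5 s e o p0 := by
  have i0 := (Tm_gen (b0 := b0) (b1 := b1) (b2 := b2) (b3 := b3) (b4 := b4) (b5 := b5) (s := s) (e := e) (o := o) _ (Tm_le_Tp (F := F) (p0 := p0))).1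
  obtain ⟨k0, k1, k2, k4, k5, k6, k7, k8, -⟩ := h.mem1 hp
  apply span_map_le (LinearMap.mulLeft F b0)
  simp only [Set.mem_insert_iff, Set.mem_singleton_iff, LinearMap.mulLeft_apply]
  rintro x (rfl | rfl | rfl | rfl | rfl | rfl | rfl | rfl | rfl | rfl)
  all_goals first | (apply Tm_le_Tp; assumption) | (rw [h.p03]; exact Tp_gen) | skip
  rw [h.b0p0]
  exact Submodule.add_mem _ (Submodule.smul_mem _ _ Tp_gen) (Submodule.smul_mem _ _ i0)

theorem Hx.PTm (hp : Par α β) (h : Hx α β l l' m m' n n' b0 b1 b2 b3 b4 b5 s e o p0 p1 p2)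
    {P τ : A →ₗ[F] A}
    (c : Cen α β b0 P τ) (h1 : τ b1 = b5) (h2 : τ b2 = b4) (q1 : P b1 = l • b0)
    (q2 : P b2 = m • b0) (q3 : P b3 = n • b0) :
    ∀ x ∈ Tm (F := F) b0 b1 b2 b3 b4 b5 s e o, P x ∈ Submodule.span F {b0} := by
  have i0 : b0 ∈ Submodule.span F {b0} := Submodule.mem_span_singleton_self _
  have q5 : P b5 = l • b0 := by rw [← h1, c.P_τ, q1]
  have q4 : P b4 = m • b0 := by rw [← h2, c.P_τ, q2]
  have h1' : τ b5 = b1 := by rw [← h1, c.τ_τ]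
  have t1 : τ (b1 + b5) = b1 + b5 := by rw [map_add, h1, h1', add_comm]
  have r1 : P (b1 + b5) = (2 * l) • b0 := by rw [map_add, q1, q5]; module
  have r2 : P (b2 + b4) = (2 * m) • b0 := by rw [map_add, q2, q4]; module
  apply span_map_le P
  simp only [Set.mem_insert_iff, Set.mem_singleton_iff]
  rintro x (rfl | rfl | rfl | rfl | rfl | rfl | rfl | rfl | rfl)
  · rwa [c.P_c]
  · rw [q1]; exact Submodule.smul_mem _ _ i0
  · rw [q2]; exact Submodule.smul_mem _ _ i0
  · rw [q3]; exact Submodule.smul_mem _ _ i0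
  · rw [q4]; exact Submodule.smul_mem _ _ i0
  · rw [q5]; exact Submodule.smul_mem _ _ i0
  · apply mem_of_smul hp.h2; rw [c.Ps r1 h.ct1]; exact Submodule.smul_mem _ _ i0
  · apply mem_of_smul hp.h2; rw [c.Ps r2 h.ct2]; exact Submodule.smul_mem _ _ i0
  · rw [h.Po hp.h2 hp.ab c t1 r1 r2]; exact Submodule.smul_mem _ _ i0

end Clos

set_option linter.all false
section Clos2
variable {F}
variable {A : Type*} [NonUnitalNonAssocCommRing A] [Module F A]
  [SMulCommClass F A A] [IsScalarTower F A A]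
variable {α β l l' m m' n n' : F} {b0 b1 b2 b3 b4 b5 s e o p0 p1 p2 : A}

theorem Par.h4 {α β : F} (hp : Par α β) : (4 : F) ≠ 0 := by
  have : (4 : F) = 2 * 2 := by norm_num
  rw [this]; exact mul_ne_zero hp.h2 hp.h2

set_option maxHeartbeats 1000000 in
/-- step (t1,t2) -/
theorem Hx.stepq (hp : Par α β) (h : Hx α β l l' m m' n n' b0 b1 b2 b3 b4 b5 s e o p0 p1 p2)
    {P τ : A →ₗ[F] A}
    (c : Cen α β b0 P τ) (h1 : τ b1 = b5) (h2 : τ b2 = b4) (q1 : P b1 = l • b0)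
    (q2 : P b2 = m • b0) (q3 : P b3 = n • b0) :
    P (p1 + p2) ∈ Submodule.span F {b0} ∧
    b0 * (p1 + p2) ∈ Tp (F := F) b0 b1 b2 b3 b4 b5 s e o p0 ∧
    s * e ∈ TT (F := F) b0 b1 b2 b3 b4 b5 s e o p0 p1 p2 := by
  have hPT := h.PTm hp c h1 h2 q1 q2 q3
  have i0 : b0 ∈ Submodule.span F {b0} := Submodule.mem_span_singleton_self _
  have q5 : P b5 = l • b0 := by rw [← h1, c.P_τ, q1]
  have q4 : P b4 = m • b0 := by rw [← h2, c.P_τ, q2]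
  have h1' : τ b5 = b1 := by rw [← h1, c.τ_τ]
  have h2' : τ b4 = b2 := by rw [← h2, c.τ_τ]
  have t1 : τ (b1 + b5) = b1 + b5 := by rw [map_add, h1, h1', add_comm]
  have t2 : τ (b2 + b4) = b2 + b4 := by rw [map_add, h2, h2', add_comm]
  have r1 : P (b1 + b5) = (2 * l) • b0 := by rw [map_add, q1, q5]; module
  have r2 : P (b2 + b4) = (2 * m) • b0 := by rw [map_add, q2, q4]; module
  -- memberships in Tm
  obtain ⟨k0, k1, k2, k4, k5, k6, k7, k8, -⟩ := h.mem1 hp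
  have g1 := h.rot.mem1 hp
  have g2 := h.rot.rot.mem1 hp
  have g4 := h.rot.rot.rot.rot.mem1 hp
  have g5 := h.rot.rot.rot.rot.rot.mem1 hp
  simp only [Tm_rot] at g1 g2 g4 g5
  have u1 : (b1 + b5) * e ∈ Tm (F := F) b0 b1 b2 b3 b4 b5 s e o := by
    rw [add_mul]; exact Submodule.add_mem _ g1.2.2.2.2.2.2.2.1 g5.2.2.2.2.2.2.2.1
  have u2 : (b2 + b4) * s ∈ Tm (F := F) b0 b1 b2 b3 b4 b5 s e o := by
    rw [add_mul]; exact Submodule.add_mem _ g2.2.2.2.2.2.1 g4.2.2.2.2.2.1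
  obtain ⟨j0, j1, j2, j3, j4, j5, js, je, jo⟩ :=
    Tm_gen (b0 := b0) (b1 := b1) (b2 := b2) (b3 := b3) (b4 := b4) (b5 := b5) (s := s) (e := e)
      (o := o) (F := F) _ le_rfl
  have ct1 := h.ct1
  have ct2 := h.ct2
  have tt : (b1 + b5) * (b2 + b4) = (p1 + p2) + ((2 : F) • s + β • (b1 + b5 + (b2 + b4))) := by
    rw [add_mul, mul_add, mul_add, h.s12, h.p14, mul_comm b5 b2, h.p25, mul_comm b5 b4, h.s45]
    module
  -- generalize
  obtain ⟨w, hw, hwe⟩ : ∃ w, w ∈ Tm (F := F) b0 b1 b2 b3 b4 b5 s e o ∧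
      (b1 + b5) * (b2 + b4) = (p1 + p2) + w := by
    refine ⟨_, ?_, tt⟩
    repeat' first | assumption | apply Submodule.add_mem | apply Submodule.sub_mem | apply Submodule.smul_mem
  have hct1 : b0 * (b1 + b5) ∈ Tm (F := F) b0 b1 b2 b3 b4 b5 s e o := by
    rw [ct1]
    repeat' first | assumption | apply Submodule.add_mem | apply Submodule.sub_mem | apply Submodule.smul_mem
  have hct2 : b0 * (b2 + b4) ∈ Tm (F := F) b0 b1 b2 b3 b4 b5 s e o := by
    rw [ct2]
    repeat' first | assumption | apply Submodule.add_mem | apply Submodule.sub_mem | apply Submodule.smul_mem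
  have a1 : (b1 + b5) * (b0 * (b2 + b4)) = β • (p1 + p2) +
      ((2 : F) • ((b1 + b5) * e) + (2 * β) • (b0 * (b1 + b5)) + β • w) := by
    rw [ct2, mul_add, mul_add, mul_smul_comm, mul_smul_comm, mul_smul_comm, hwe,
      mul_comm (b1 + b5) b0]; module
  have a2 : (b2 + b4) * (b0 * (b1 + b5)) = β • (p1 + p2) +
      ((2 : F) • ((b2 + b4) * s) + (2 * β) • (b0 * (b2 + b4)) + β • w) := by
    rw [ct1, mul_add, mul_add, mul_smul_comm, mul_smul_comm, mul_smul_comm, mul_comm (b2 + b4) (b1 + b5), hwe,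
      mul_comm (b2 + b4) b0]; module
  obtain ⟨w1, hw1, e1⟩ : ∃ w, w ∈ Tm (F := F) b0 b1 b2 b3 b4 b5 s e o ∧
      (b1 + b5) * (b0 * (b2 + b4)) = β • (p1 + p2) + w := by
    refine ⟨_, ?_, a1⟩
    repeat' first | assumption | apply Submodule.add_mem | apply Submodule.sub_mem | apply Submodule.smul_mem
  obtain ⟨w2, hw2, e2⟩ : ∃ w, w ∈ Tm (F := F) b0 b1 b2 b3 b4 b5 s e o ∧
      (b2 + b4) * (b0 * (b1 + b5)) = β • (p1 + p2) + w := by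
    refine ⟨_, ?_, a2⟩
    repeat' first | assumption | apply Submodule.add_mem | apply Submodule.sub_mem | apply Submodule.smul_mem
  have PJ := c.PJg t1 t2 r1 r2
  rw [e1, e2, hwe] at PJ
  simp only [map_add P (β • (p1 + p2)), map_add P (p1 + p2), map_smul] at PJ
  have Pq : P (p1 + p2) ∈ Submodule.span F {b0} := by
    apply mem_of_smul (mul_ne_zero hp.h2 hp.ab)
    have : (2 * (α - β)) • P (p1 + p2) = P w1 + P w2 - (2 * α) • P w -
        ((2 - 2 * α) * (2 * l) * (2 * m)) • b0 := by
      linear_combination (norm := module) -PJ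
    rw [this]
    have z1 := hPT w hw
    have z2 := hPT w1 hw1
    have z3 := hPT w2 hw2
    repeat' first | assumption | apply Submodule.add_mem | apply Submodule.sub_mem | apply Submodule.smul_mem
  have hle : Submodule.span F {b0} ≤ Tp (F := F) b0 b1 b2 b3 b4 b5 s e o p0 :=
    (Submodule.span_singleton_le_iff_mem _ _).2 (Tm_le_Tp j0)
  have J' := c.J'g t1 t2 r1 r2
  rw [e1, e2, hwe] at J'
  simp only [mul_add b0 (β • (p1 + p2)), mul_add b0 (p1 + p2), map_add P (p1 + p2), mul_smul_comm] at J'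
  have v := h.b0Tm hp w hw
  have v1 := h.b0Tm hp w1 hw1
  have v2 := h.b0Tm hp w2 hw2
  have y1 := Tm_le_Tp (p0 := p0) hct1
  have y2 := Tm_le_Tp (p0 := p0) hct2
  have y0 := Tm_le_Tp (p0 := p0) j0
  have z1 := hle (hPT w hw)
  have z2 := hle Pq
  have cq : b0 * (p1 + p2) ∈ Tp (F := F) b0 b1 b2 b3 b4 b5 s e o p0 := by
    apply mem_of_smul hp.ab2
    have : (α - 2 * β) • (b0 * (p1 + p2)) = b0 * w1 + b0 * w2 - α • (b0 * w) - α • P (p1 + p2)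
        - α • P w - (α * (2 * m)) • (b0 * (b1 + b5)) - (α * (2 * l)) • (b0 * (b2 + b4))
        + ((4 * α - 2) * (2 * l) * (2 * m)) • b0 := by
      linear_combination (norm := module) J'
    rw [this]
    repeat' first | assumption | apply Submodule.add_mem | apply Submodule.sub_mem | apply Submodule.smul_mem
  refine ⟨Pq, cq, ?_⟩
  have hle2 : Tp (F := F) b0 b1 b2 b3 b4 b5 s e o p0 ≤ TT b0 b1 b2 b3 b4 b5 s e o p0 p1 p2 := Tp_le_TT
  have hle3 : Tm (F := F) b0 b1 b2 b3 b4 b5 s e o ≤ TT b0 b1 b2 b3 b4 b5 s e o p0 p1 p2 :=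
    Tm_le_Tp.trans hle2
  obtain ⟨-, -, -, -, -, -, -, -, -, -, x1, x2⟩ := TT_gen (F := F) (b0 := b0) (b1 := b1) (b2 := b2)
    (b3 := b3) (b4 := b4) (b5 := b5) (s := s) (e := e) (o := o) (p0 := p0) (p1 := p1) (p2 := p2) _ le_rfl
  have f1 : (b1 + b5) * (b0 * (b2 + b4)) ∈ TT (F := F) b0 b1 b2 b3 b4 b5 s e o p0 p1 p2 := by
    rw [e1]
    have := hle3 hw1
    repeat' first | assumption | apply Submodule.add_mem | apply Submodule.sub_mem | apply Submodule.smul_mem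
  have f2 : (b2 + b4) * (b0 * (b1 + b5)) ∈ TT (F := F) b0 b1 b2 b3 b4 b5 s e o p0 p1 p2 := by
    rw [e2]
    have := hle3 hw2
    repeat' first | assumption | apply Submodule.add_mem | apply Submodule.sub_mem | apply Submodule.smul_mem
  have f3 : b0 * ((b1 + b5) * (b2 + b4)) ∈ TT (F := F) b0 b1 b2 b3 b4 b5 s e o p0 p1 p2 := by
    rw [hwe, mul_add]
    exact Submodule.add_mem _ (hle2 cq) (hle2 v)
  have f4 : P ((b1 + b5) * (b2 + b4)) ∈ TT (F := F) b0 b1 b2 b3 b4 b5 s e o p0 p1 p2 := by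
    rw [hwe, map_add]
    exact Submodule.add_mem _ (hle2 z2) (hle2 z1)
  have J := c.mJ1 hp t1 t2 r1 r2 (hle3 j0) (hle3 hct1) (hle3 hct2) f3 f4 f2 f1
  have ex : (4 : F) • (s * e) = b0 * (b1 + b5) * (b0 * (b2 + b4)) - (4 * β) • (b0 * s)
     - (2 * β) • ((b2 + b4) * s) - (4 * β) • (b0 * e) - (4 * β ^ 2) • b0 - (2 * β ^ 2) • (b0 * (b2 + b4))
     - (2 * β) • ((b1 + b5) * e) - (2 * β ^ 2) • (b0 * (b1 + b5)) - (β ^ 2) • ((p1 + p2) + w) := by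
    rw [← hwe]
    conv_rhs => enter [1,1,1,1,1,1,1,1]; rw [ct1, ct2]
    rw [mul_comm b0 s, mul_comm (b2 + b4) s, mul_comm b0 (b1 + b5)]
    simp only [mul_add ((2 : F) • s + (2 * β) • b0 + β • (b1 + b5)), add_mul _ (β • (b1 + b5)),
      add_mul ((2 : F) • s), smul_mul_assoc, mul_smul_comm, c.idem]
    module
  apply mem_of_smul hp.h4
  rw [ex]
  have m1 := hle3 k6
  have m2 := hle3 k7
  have m3 := hle3 u1
  have m4 := hle3 u2
  have m5 := hle3 j0
  have m6 := hle3 hct1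
  have m7 := hle3 hct2
  have m8 := hle3 hw
  repeat' first | assumption | apply Submodule.add_mem | apply Submodule.sub_mem | apply Submodule.smul_mem

end Clos2

set_option linter.all false
section Clos3
variable {F}
variable {A : Type*} [NonUnitalNonAssocCommRing A] [Module F A]
  [SMulCommClass F A A] [IsScalarTower F A A]
variable {α β l l' m m' n n' : F} {b0 b1 b2 b3 b4 b5 s e o p0 p1 p2 : A}

set_option maxHeartbeats 1000000 in
theorem Hx.stepb (hp : Par α β) (h : Hx α β l l' m m' n n' b0 b1 b2 b3 b4 b5 s e o p0 p1 p2)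
    {P τ : A →ₗ[F] A}
    (c : Cen α β b0 P τ) (h1 : τ b1 = b5) (h2 : τ b2 = b4) (h3 : τ b3 = b3) (q1 : P b1 = l • b0)
    (q2 : P b2 = m • b0) (q3 : P b3 = n • b0) {y w : A} {f : F}
    (ty : τ y = y) (py : P y = f • b0) (cy : b0 * y = (2 : F) • w + (2 * β) • b0 + β • y)
    (yz : y * b3 ∈ Tm (F := F) b0 b1 b2 b3 b4 b5 s e o)
    (bw : b3 * w ∈ Tm (F := F) b0 b1 b2 b3 b4 b5 s e o)
    (hw : w ∈ Tm (F := F) b0 b1 b2 b3 b4 b5 s e o)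
    (hy : y ∈ Tm (F := F) b0 b1 b2 b3 b4 b5 s e o) :
    w * p0 ∈ Tp (F := F) b0 b1 b2 b3 b4 b5 s e o p0 := by
  have hPT := h.PTm hp c h1 h2 q1 q2 q3
  obtain ⟨j0, -⟩ :=
    Tm_gen (b0 := b0) (b1 := b1) (b2 := b2) (b3 := b3) (b4 := b4) (b5 := b5) (s := s) (e := e)
      (o := o) (F := F) _ le_rfl
  have hle1 : Tm (F := F) b0 b1 b2 b3 b4 b5 s e o ≤ Tp b0 b1 b2 b3 b4 b5 s e o p0 := Tm_le_Tp
  have hle : Submodule.span F {b0} ≤ Tp (F := F) b0 b1 b2 b3 b4 b5 s e o p0 :=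
    (Submodule.span_singleton_le_iff_mem _ _).2 (Tm_le_Tp j0)
  have ip : p0 ∈ Tp (F := F) b0 b1 b2 b3 b4 b5 s e o p0 := Tp_gen
  have y0 := hle1 j0
  have x1 := hle1 yz
  have x2 := hle1 bw
  have x3 := hle1 hw
  have x4 := hle1 hy
  have hcy : b0 * y ∈ Tp (F := F) b0 b1 b2 b3 b4 b5 s e o p0 := h.b0Tp hp _ x4
  have hcz : b0 * b3 ∈ Tp (F := F) b0 b1 b2 b3 b4 b5 s e o p0 := by rwa [h.p03]
  have hz : b3 * (b0 * y) ∈ Tp (F := F) b0 b1 b2 b3 b4 b5 s e o p0 := by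
    have : b3 * (b0 * y) = (2 : F) • (b3 * w) + (2 * β) • p0 + β • (y * b3) := by
      rw [cy, mul_add, mul_add, mul_smul_comm, mul_smul_comm, mul_smul_comm, mul_comm b3 b0, h.p03,
        mul_comm b3 y]
    rw [this]
    repeat' first | assumption | apply Submodule.add_mem | apply Submodule.sub_mem | apply Submodule.smul_mem
  have U := c.mJ3 hp ty h3 py q3 y0 hcy hcz (h.b0Tp hp _ x1) (hle (hPT _ yz)) hz (h.b0Tp hp _ hz)
  have W := c.mJ1 hp ty h3 py q3 y0 hcy hcz (h.b0Tp hp _ x1) (hle (hPT _ yz)) hz U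
  have hcp := h.b0Tp hp _ ip
  rw [h.p03] at U W
  apply mem_of_smul hp.h2
  have : (2 : F) • (w * p0) = b0 * y * p0 - (2 * β) • (b0 * p0) - β • (y * p0) := by
    rw [cy, add_mul, add_mul, smul_mul_assoc, smul_mul_assoc, smul_mul_assoc]; module
  rw [this]
  repeat' first | assumption | apply Submodule.add_mem | apply Submodule.sub_mem | apply Submodule.smul_mem

/-- all products needed at center 0 -/
theorem Hx.ctr1 (hp : Par α β) (h : Hx α β l l' m m' n n' b0 b1 b2 b3 b4 b5 s e o p0 p1 p2) :
    s * p0 ∈ Tp (F := F) b0 b1 b2 b3 b4 b5 s e o p0 ∧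
    e * p0 ∈ Tp (F := F) b0 b1 b2 b3 b4 b5 s e o p0 ∧
    b0 * p1 ∈ TT (F := F) b0 b1 b2 b3 b4 b5 s e o p0 p1 p2 ∧
    b0 * p2 ∈ TT (F := F) b0 b1 b2 b3 b4 b5 s e o p0 p1 p2 ∧
    s * e ∈ TT (F := F) b0 b1 b2 b3 b4 b5 s e o p0 p1 p2 := by
  obtain ⟨P, τ, c, h1, h2, h3, q1, q2, q3⟩ := h.L0
  have q5 : P b5 = l • b0 := by rw [← h1, c.P_τ, q1]
  have q4 : P b4 = m • b0 := by rw [← h2, c.P_τ, q2]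
  have h1' : τ b5 = b1 := by rw [← h1, c.τ_τ]
  have h2' : τ b4 = b2 := by rw [← h2, c.τ_τ]
  have t1 : τ (b1 + b5) = b1 + b5 := by rw [map_add, h1, h1', add_comm]
  have t2 : τ (b2 + b4) = b2 + b4 := by rw [map_add, h2, h2', add_comm]
  have r1 : P (b1 + b5) = (2 * l) • b0 := by rw [map_add, q1, q5]; module
  have r2 : P (b2 + b4) = (2 * m) • b0 := by rw [map_add, q2, q4]; module
  obtain ⟨sq1, sq2, sq3⟩ := h.stepq hp c h1 h2 q1 q2 q3
  obtain ⟨j0, j1, j2, j3, j4, j5, js, je, jo⟩ :=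
    Tm_gen (b0 := b0) (b1 := b1) (b2 := b2) (b3 := b3) (b4 := b4) (b5 := b5) (s := s) (e := e)
      (o := o) (F := F) _ le_rfl
  have g3 := h.rot.rot.rot.mem1 hp
  simp only [Tm_rot] at g3
  obtain ⟨k0, k1, k2, k4, k5, k6, k7, k8, -⟩ := g3
  have hq : b0 * p1 - b0 * p2 = β • (p1 - p2) := by
    have t := c.neg p1
    have : τ p1 = p2 := by rw [← h.p14, c.τ_mul, h1, h2', mul_comm, h.p25]
    rwa [this, mul_sub] at t
  have hle2 : Tp (F := F) b0 b1 b2 b3 b4 b5 s e o p0 ≤ TT b0 b1 b2 b3 b4 b5 s e o p0 p1 p2 := Tp_le_TT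
  obtain ⟨-, -, -, -, -, -, -, -, -, -, x1, x2⟩ := TT_gen (F := F) (b0 := b0) (b1 := b1) (b2 := b2)
    (b3 := b3) (b4 := b4) (b5 := b5) (s := s) (e := e) (o := o) (p0 := p0) (p1 := p1) (p2 := p2) _ le_rfl
  have x3 := hle2 sq2
  refine ⟨?_, ?_, ?_, ?_, sq3⟩
  · refine h.stepb hp c h1 h2 h3 q1 q2 q3 t1 r1 h.ct1 ?_ k6 js (Submodule.add_mem _ j1 j5)
    rw [mul_comm, mul_add]; exact Submodule.add_mem _ k4 k2
  · refine h.stepb hp c h1 h2 h3 q1 q2 q3 t2 r2 h.ct2 ?_ k8 je (Submodule.add_mem _ j2 j4)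
    rw [mul_comm, mul_add]; exact Submodule.add_mem _ k5 k1
  · apply mem_of_smul hp.h2
    have : (2 : F) • (b0 * p1) = b0 * (p1 + p2) + β • (p1 - p2) := by
      rw [mul_add]; linear_combination (norm := module) hq
    rw [this]
    repeat' first | assumption | apply Submodule.add_mem | apply Submodule.sub_mem | apply Submodule.smul_mem
  · apply mem_of_smul hp.h2
    have : (2 : F) • (b0 * p2) = b0 * (p1 + p2) - β • (p1 - p2) := by
      rw [mul_add]; linear_combination (norm := module) -hq
    rw [this]
    repeat' first | assumption | apply Submodule.add_mem | apply Submodule.sub_mem | apply Submodule.smul_mem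

theorem Hx.b0TT (hp : Par α β) (h : Hx α β l l' m m' n n' b0 b1 b2 b3 b4 b5 s e o p0 p1 p2) :
    ∀ x ∈ TT (F := F) b0 b1 b2 b3 b4 b5 s e o p0 p1 p2,
      b0 * x ∈ TT (F := F) b0 b1 b2 b3 b4 b5 s e o p0 p1 p2 := by
  obtain ⟨k0, k1, k2, k4, k5, k6, k7, k8, -⟩ := h.mem1 hp
  obtain ⟨-, -, z1, z2, -⟩ := h.ctr1 hp
  have hle2 : Tp (F := F) b0 b1 b2 b3 b4 b5 s e o p0 ≤ TT b0 b1 b2 b3 b4 b5 s e o p0 p1 p2 := Tp_le_TT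
  have z3 := hle2 (h.b0Tp hp p0 Tp_gen)
  apply span_map_le (LinearMap.mulLeft F b0)
  simp only [Set.mem_insert_iff, Set.mem_singleton_iff, LinearMap.mulLeft_apply]
  rintro x (rfl | rfl | rfl | rfl | rfl | rfl | rfl | rfl | rfl | rfl | rfl | rfl)
  all_goals first | assumption | (apply hle2; apply Tm_le_Tp; assumption) | (rw [h.p03]; apply hle2; exact Tp_gen)

theorem Hx.PTT (hp : Par α β) (h : Hx α β l l' m m' n n' b0 b1 b2 b3 b4 b5 s e o p0 p1 p2)
    {P τ : A →ₗ[F] A}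
    (c : Cen α β b0 P τ) (h1 : τ b1 = b5) (h2 : τ b2 = b4) (q1 : P b1 = l • b0)
    (q2 : P b2 = m • b0) (q3 : P b3 = n • b0) :
    ∀ x ∈ TT (F := F) b0 b1 b2 b3 b4 b5 s e o p0 p1 p2, P x ∈ Submodule.span F {b0} := by
  have hPT := h.PTm hp c h1 h2 q1 q2 q3
  have Pq := (h.stepq hp c h1 h2 q1 q2 q3).1
  have h2' : τ b4 = b2 := by rw [← h2, c.τ_τ]
  have P12 : P p2 = P p1 := by
    have : τ p1 = p2 := by rw [← h.p14, c.τ_mul, h1, h2', mul_comm, h.p25]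
    rw [← this, c.P_τ]
  have Pp1 : P p1 ∈ Submodule.span F {b0} := by
    apply mem_of_smul hp.h2
    rw [map_add, P12] at Pq
    rwa [two_smul]
  obtain ⟨j0, j1, j2, j3, j4, j5, js, je, jo⟩ :=
    Tm_gen (b0 := b0) (b1 := b1) (b2 := b2) (b3 := b3) (b4 := b4) (b5 := b5) (s := s) (e := e)
      (o := o) (F := F) _ le_rfl
  apply span_map_le P
  simp only [Set.mem_insert_iff, Set.mem_singleton_iff]
  rintro x (rfl | rfl | rfl | rfl | rfl | rfl | rfl | rfl | rfl | rfl | rfl | rfl)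
  all_goals first | (apply hPT; assumption) | skip
  · rw [← h.p03, c.P_mul]; apply hPT; assumption
  · exact Pp1
  · rw [P12]; exact Pp1


set_option maxHeartbeats 1000000 in
theorem Hx.ctr2 (hp : Par α β) (h : Hx α β l l' m m' n n' b0 b1 b2 b3 b4 b5 s e o p0 p1 p2) :
    o * e ∈ TT (F := F) b0 b1 b2 b3 b4 b5 s e o p0 p1 p2 ∧
    p0 * p0 ∈ TT (F := F) b0 b1 b2 b3 b4 b5 s e o p0 p1 p2 ∧
    (p1 + p2) * p0 ∈ TT (F := F) b0 b1 b2 b3 b4 b5 s e o p0 p1 p2 := by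
  obtain ⟨P, τ, c, h1, h2, h3, q1, q2, q3⟩ := h.L0
  have q5 : P b5 = l • b0 := by rw [← h1, c.P_τ, q1]
  have q4 : P b4 = m • b0 := by rw [← h2, c.P_τ, q2]
  have h1' : τ b5 = b1 := by rw [← h1, c.τ_τ]
  have h2' : τ b4 = b2 := by rw [← h2, c.τ_τ]
  have t1 : τ (b1 + b5) = b1 + b5 := by rw [map_add, h1, h1', add_comm]
  have t2 : τ (b2 + b4) = b2 + b4 := by rw [map_add, h2, h2', add_comm]
  have r1 : P (b1 + b5) = (2 * l) • b0 := by rw [map_add, q1, q5]; module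
  have r2 : P (b2 + b4) = (2 * m) • b0 := by rw [map_add, q2, q4]; module
  have τo : τ o = o := by
    have := congrArg τ h.o51
    rw [c.τ_mul, map_add, map_smul, map_add, h1, h1', mul_comm, h.o51] at this
    linear_combination (norm := module) -this
  have τp : τ p1 = p2 := by rw [← h.p14, c.τ_mul, h1, h2', mul_comm, h.p25]
  have τq : τ (p1 + p2) = p1 + p2 := by
    have τp' : τ p2 = p1 := by rw [← τp, c.τ_τ]
    rw [map_add, τp, τp', add_comm]
  have po := h.Po hp.h2 hp.ab c t1 r1 r2
  obtain ⟨Pq, cq, -⟩ := h.stepq hp c h1 h2 q1 q2 q3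
  obtain ⟨g, hg⟩ := Submodule.mem_span_singleton.1 Pq
  have hPTT := h.PTT hp c h1 h2 q1 q2 q3
  have m0 := h.b0TT hp
  have m2 := h.rot.rot.b0TT hp
  have m3 := h.rot.rot.rot.b0TT hp
  have m1 := h.rot.b0TT hp
  have m4 := h.rot.rot.rot.rot.b0TT hp
  have m5 := h.rot.rot.rot.rot.rot.b0TT hp
  have k0 := h.ctr1 hp
  have k3 := h.rot.rot.rot.ctr1 hp
  have d0 := h.mem1 hp
  simp only [TT_rot] at m1 m2 m3 m4 m5
  set T := TT (F := F) b0 b1 b2 b3 b4 b5 s e o p0 p1 p2 with hT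
  have hle2 : Tp (F := F) b0 b1 b2 b3 b4 b5 s e o p0 ≤ T := Tp_le_TT
  have hle1 : Tm (F := F) b0 b1 b2 b3 b4 b5 s e o ≤ T := Tm_le_Tp.trans Tp_le_TT
  have hle3 : Tp (F := F) b3 b4 b5 b0 b1 b2 s o e p0 ≤ T := by
    refine le_trans (Tp_le_TT (p1 := p1) (p2 := p2)) ?_
    rw [TT_rot (b0 := b2), TT_rot (b0 := b1), TT_rot (b0 := b0)]
  obtain ⟨i0, i1, i2, i3, i4, i5, is, ie, io, ip0, ip1, ip2⟩ := TT_gen (F := F) T hT.ge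
  have hle : Submodule.span F {b0} ≤ T := (Submodule.span_singleton_le_iff_mem _ _).2 i0
  have sp := hle2 k0.1
  have ep := hle2 k0.2.1
  have op := hle3 k3.2.1
  have se := k0.2.2.2.2
  have ee := hle1 d0.2.2.2.2.2.2.2.2.2
  -- p0 p0
  have pp : p0 * p0 ∈ T := by
    have x3 : b3 * b3 = b3 := by obtain ⟨_, _, c3, -⟩ := h.L3; exact c3.idem
    have hb3p : b3 * (b0 * b3) ∈ T := m3 _ (m0 _ i3)
    have := c.mJ1 hp h3 h3 q3 q3 i0 (m0 _ i3) (m0 _ i3) (by rw [x3]; exact m0 _ i3)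
      (by rw [x3]; exact hle (hPTT _ i3)) hb3p hb3p
    rwa [h.p03] at this
  refine ⟨?_, pp, ?_⟩
  · have hco : b0 * o ∈ T := m0 _ io
    have a1 : (b2 + b4) * o ∈ T := by rw [add_mul]; exact Submodule.add_mem _ (m2 _ io) (m4 _ io)
    have a2 : (b2 + b4) * (b0 * o) ∈ T := by
      rw [add_mul]; exact Submodule.add_mem _ (m2 _ hco) (m4 _ hco)
    have a3 : b0 * (b2 + b4) * (b0 * o) ∈ T := by
      have h4 : (2 * (α - 2 * β)) ≠ 0 := mul_ne_zero hp.h2 hp.ab2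
      have a4 : e * (b0 * o) ∈ T := by
        apply mem_of_smul h4
        rw [← mul_smul_comm, h.b0o hp.h2 hp.ab]
        have u0 : e * b0 ∈ T := by rw [mul_comm]; exact m0 _ ie
        have u1 : e * (b1 + b5) ∈ T := by
          rw [mul_comm, add_mul]; exact Submodule.add_mem _ (m1 _ ie) (m5 _ ie)
        have u2 : e * (b2 + b4) ∈ T := by
          rw [mul_comm, add_mul]; exact Submodule.add_mem _ (m2 _ ie) (m4 _ ie)
        have u3 : e * s ∈ T := by rwa [mul_comm]
        simp only [mul_add e ((2 * (α - 2 * β) * om α β l l' m) • b0 +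
          (4*α^2-2*α*β+4*β^2-α-2*β-4*α*(l+l')+4*l') •
          ((2 : F) • s + β • (b1 + b5) + (2 * (β - l)) • b0)),
          mul_add e ((2 * (α - 2 * β) * om α β l l' m) • b0), mul_add e ((2 : F) • s + β • (b1 + b5)),
          mul_add e ((2 : F) • e + β • (b2 + b4)), mul_add e ((2 : F) • s),
          mul_add e ((2 : F) • e), mul_smul_comm]
        repeat' first | assumption | apply Submodule.add_mem | apply Submodule.sub_mem | apply Submodule.smul_mem
      have a5 : b0 * (b0 * o) ∈ T := m0 _ hco
      rw [h.ct2]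
      simp only [add_mul _ _ (b0 * o), smul_mul_assoc]
      rw [add_mul] at a2
      repeat' first | assumption | apply Submodule.add_mem | apply Submodule.sub_mem | apply Submodule.smul_mem
    have r := c.mJ2 hp t2 τo r2 po i0 (m0 _ (Submodule.add_mem _ i2 i4)) hco (m0 _ a1)
      (hle (hPTT _ a1)) a3 a2
    apply mem_of_smul hp.h2
    have : (2 : F) • (o * e) = o * (b0 * (b2 + b4)) - (2 * β) • (b0 * o) - β • ((b2 + b4) * o) := by
      rw [h.ct2, mul_comm b0 o, mul_comm (b2 + b4) o, mul_add o, mul_add o, mul_smul_comm, mul_smul_comm,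
        mul_smul_comm]; module
    rw [this]
    repeat' first | assumption | apply Submodule.add_mem | apply Submodule.sub_mem | apply Submodule.smul_mem
  · have iq : p1 + p2 ∈ T := Submodule.add_mem _ ip1 ip2
    have a1 : b3 * (p1 + p2) ∈ T := m3 _ iq
    have a2 : b3 * (b0 * (p1 + p2)) ∈ T := m3 _ (m0 _ iq)
    have p0Tp : ∀ x ∈ Tp (F := F) b0 b1 b2 b3 b4 b5 s e o p0, p0 * x ∈ T := by
      apply span_map_le (LinearMap.mulLeft F p0)
      simp only [Set.mem_insert_iff, Set.mem_singleton_iff, LinearMap.mulLeft_apply]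
      rintro x (rfl | rfl | rfl | rfl | rfl | rfl | rfl | rfl | rfl | rfl)
      · rw [mul_comm]; exact m0 _ ip0
      · rw [mul_comm]; exact m1 _ ip0
      · rw [mul_comm]; exact m2 _ ip0
      · rw [mul_comm]; exact m3 _ ip0
      · rw [mul_comm]; exact m4 _ ip0
      · rw [mul_comm]; exact m5 _ ip0
      · rwa [mul_comm]
      · rwa [mul_comm]
      · rwa [mul_comm]
      · exact pp
    have r := c.mJ2 hp h3 τq q3 hg.symm i0 (m0 _ i3) (m0 _ iq) (m0 _ a1) (hle (hPTT _ a1))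
      (by rw [h.p03]; exact p0Tp _ cq) a2
    rwa [h.p03] at r

theorem Hx.closed (hp : Par α β) (h : Hx α β l l' m m' n n' b0 b1 b2 b3 b4 b5 s e o p0 p1 p2) :
    ∀ x ∈ TT (F := F) b0 b1 b2 b3 b4 b5 s e o p0 p1 p2,
    ∀ y ∈ TT (F := F) b0 b1 b2 b3 b4 b5 s e o p0 p1 p2,
      x * y ∈ TT (F := F) b0 b1 b2 b3 b4 b5 s e o p0 p1 p2 := by
  have m0 := h.b0TT hp
  have m1 := h.rot.b0TT hp
  have m2 := h.rot.rot.b0TT hp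
  have m3 := h.rot.rot.rot.b0TT hp
  have m4 := h.rot.rot.rot.rot.b0TT hp
  have m5 := h.rot.rot.rot.rot.rot.b0TT hp
  have k0 := h.ctr1 hp
  have k1 := h.rot.ctr1 hp
  have k2 := h.rot.rot.ctr1 hp
  have k3 := h.rot.rot.rot.ctr1 hp
  have k4 := h.rot.rot.rot.rot.ctr1 hp
  have k5 := h.rot.rot.rot.rot.rot.ctr1 hp
  have l0 := h.ctr2 hp
  have l1 := h.rot.ctr2 hp
  have l2 := h.rot.rot.ctr2 hp
  have d0 := h.mem1 hp
  have d1 := h.rot.mem1 hp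
  simp only [TT_rot] at m1 m2 m3 m4 m5 k1 l1 l2
  simp only [Tm_rot] at d1
  set T := TT (F := F) b0 b1 b2 b3 b4 b5 s e o p0 p1 p2 with hT
  have H0 : Tp (F := F) b0 b1 b2 b3 b4 b5 s e o p0 ≤ T := Tp_le_TT
  have hle1 : Tm (F := F) b0 b1 b2 b3 b4 b5 s e o ≤ T := Tm_le_Tp.trans Tp_le_TT
  have H1 : Tp (F := F) b1 b2 b3 b4 b5 b0 s o e p1 ≤ T := by
    refine le_trans (Tp_le_TT (p1 := p2) (p2 := p0)) ?_
    rw [TT_rot (b0 := b0)]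
  have H2 : Tp (F := F) b2 b3 b4 b5 b0 b1 s e o p2 ≤ T := by
    refine le_trans (Tp_le_TT (p1 := p0) (p2 := p1)) ?_
    rw [TT_rot (b0 := b1), TT_rot (b0 := b0)]
  have H3 : Tp (F := F) b3 b4 b5 b0 b1 b2 s o e p0 ≤ T := by
    refine le_trans (Tp_le_TT (p1 := p1) (p2 := p2)) ?_
    rw [TT_rot (b0 := b2), TT_rot (b0 := b1), TT_rot (b0 := b0)]
  have H4 : Tp (F := F) b4 b5 b0 b1 b2 b3 s e o p1 ≤ T := by
    refine le_trans (Tp_le_TT (p1 := p2) (p2 := p0)) ?_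
    rw [TT_rot (b0 := b3), TT_rot (b0 := b2), TT_rot (b0 := b1), TT_rot (b0 := b0)]
  have H5 : Tp (F := F) b5 b0 b1 b2 b3 b4 s o e p2 ≤ T := by
    refine le_trans (Tp_le_TT (p1 := p0) (p2 := p1)) ?_
    rw [TT_rot (b0 := b4), TT_rot (b0 := b3), TT_rot (b0 := b2), TT_rot (b0 := b1), TT_rot (b0 := b0)]
  have ss := hle1 d0.2.2.2.2.2.2.2.2.1
  have ee := hle1 d0.2.2.2.2.2.2.2.2.2
  have oo := hle1 d1.2.2.2.2.2.2.2.2.2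
  have se := k0.2.2.2.2
  have so := k1.2.2.2.2
  have oe := l0.1
  have s0 := H0 k0.1
  have s1 := H1 k1.1
  have s2 := H2 k2.1
  have e0 := H0 k0.2.1
  have e2 := H2 k2.2.1
  have e1 := H4 k4.2.1
  have o1 := H1 k1.2.1
  have o0 := H3 k3.2.1
  have o2 := H5 k5.2.1
  have pp0 := l0.2.1
  have pp1 := l1.2.1
  have pp2 := l2.2.1
  have p01 : p0 * p1 ∈ T := by
    apply mem_of_smul hp.h2
    have : (2 : F) • (p0 * p1) = (p1 + p2) * p0 + (p2 + p0) * p1 - (p0 + p1) * p2 := by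
      rw [add_mul, add_mul, add_mul, mul_comm p1 p0, mul_comm p2 p0, mul_comm p2 p1]; module
    rw [this]
    exact Submodule.sub_mem _ (Submodule.add_mem _ l0.2.2 l1.2.2) l2.2.2
  have p02 : p0 * p2 ∈ T := by
    have := Submodule.sub_mem _ l0.2.2 p01
    rwa [add_mul, mul_comm p1 p0, add_sub_cancel_left, mul_comm] at this
  have p12 : p1 * p2 ∈ T := by
    have := Submodule.sub_mem _ l2.2.2 p02
    rwa [add_mul, add_sub_cancel_left] at this
  obtain ⟨i0, i1, i2, i3, i4, i5, is, ie, io, ip0, ip1, ip2⟩ := TT_gen (F := F) T hT.ge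
  have es : e * s ∈ T := by rwa [mul_comm]
  have os : o * s ∈ T := by rwa [mul_comm]
  have eo : e * o ∈ T := by rwa [mul_comm]
  have gs : ∀ x ∈ T, s * x ∈ T := by
    apply span_map_le (LinearMap.mulLeft F s)
    simp only [Set.mem_insert_iff, Set.mem_singleton_iff, LinearMap.mulLeft_apply]
    rintro x (rfl | rfl | rfl | rfl | rfl | rfl | rfl | rfl | rfl | rfl | rfl | rfl)
    all_goals first | assumption | (rw [mul_comm]; first | exact m0 _ is | exact m1 _ is | exact m2 _ is | exact m3 _ is | exact m4 _ is | exact m5 _ is)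
  have ge : ∀ x ∈ T, e * x ∈ T := by
    apply span_map_le (LinearMap.mulLeft F e)
    simp only [Set.mem_insert_iff, Set.mem_singleton_iff, LinearMap.mulLeft_apply]
    rintro x (rfl | rfl | rfl | rfl | rfl | rfl | rfl | rfl | rfl | rfl | rfl | rfl)
    all_goals first | assumption | (rw [mul_comm]; first | exact m0 _ ie | exact m1 _ ie | exact m2 _ ie | exact m3 _ ie | exact m4 _ ie | exact m5 _ ie)
  have go : ∀ x ∈ T, o * x ∈ T := by
    apply span_map_le (LinearMap.mulLeft F o)
    simp only [Set.mem_insert_iff, Set.mem_singleton_iff, LinearMap.mulLeft_apply]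
    rintro x (rfl | rfl | rfl | rfl | rfl | rfl | rfl | rfl | rfl | rfl | rfl | rfl)
    all_goals first | assumption | (rw [mul_comm]; first | exact m0 _ io | exact m1 _ io | exact m2 _ io | exact m3 _ io | exact m4 _ io | exact m5 _ io)
  have g0 : ∀ x ∈ T, p0 * x ∈ T := by
    apply span_map_le (LinearMap.mulLeft F p0)
    simp only [Set.mem_insert_iff, Set.mem_singleton_iff, LinearMap.mulLeft_apply]
    rintro x (rfl | rfl | rfl | rfl | rfl | rfl | rfl | rfl | rfl | rfl | rfl | rfl)
    all_goals first | assumption | (rw [mul_comm]; first | assumption | exact m0 _ ip0 | exact m1 _ ip0 | exact m2 _ ip0 | exact m3 _ ip0 | exact m4 _ ip0 | exact m5 _ ip0)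
  have g1 : ∀ x ∈ T, p1 * x ∈ T := by
    apply span_map_le (LinearMap.mulLeft F p1)
    simp only [Set.mem_insert_iff, Set.mem_singleton_iff, LinearMap.mulLeft_apply]
    rintro x (rfl | rfl | rfl | rfl | rfl | rfl | rfl | rfl | rfl | rfl | rfl | rfl)
    all_goals first | assumption | (rw [mul_comm]; first | assumption | exact m0 _ ip1 | exact m1 _ ip1 | exact m2 _ ip1 | exact m3 _ ip1 | exact m4 _ ip1 | exact m5 _ ip1)
  have g2 : ∀ x ∈ T, p2 * x ∈ T := by
    apply span_map_le (LinearMap.mulLeft F p2)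
    simp only [Set.mem_insert_iff, Set.mem_singleton_iff, LinearMap.mulLeft_apply]
    rintro x (rfl | rfl | rfl | rfl | rfl | rfl | rfl | rfl | rfl | rfl | rfl | rfl)
    all_goals first | assumption | (rw [mul_comm]; first | assumption | exact m0 _ ip2 | exact m1 _ ip2 | exact m2 _ ip2 | exact m3 _ ip2 | exact m4 _ ip2 | exact m5 _ ip2)
  intro x hx y hy
  revert x
  apply span_map_le (LinearMap.mulRight F y)
  simp only [Set.mem_insert_iff, Set.mem_singleton_iff, LinearMap.mulRight_apply]
  rintro x (rfl | rfl | rfl | rfl | rfl | rfl | rfl | rfl | rfl | rfl | rfl | rfl)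
  · exact m0 _ hy
  · exact m1 _ hy
  · exact m2 _ hy
  · exact m3 _ hy
  · exact m4 _ hy
  · exact m5 _ hy
  · exact gs _ hy
  · exact ge _ hy
  · exact go _ hy
  · exact g0 _ hy
  · exact g1 _ hy
  · exact g2 _ hy

theorem Hx.prim (hp : Par α β) (h : Hx α β l l' m m' n n' b0 b1 b2 b3 b4 b5 s e o p0 p1 p2) :
    ∀ x ∈ TT (F := F) b0 b1 b2 b3 b4 b5 s e o p0 p1 p2, b0 * x = x →
      x ∈ Submodule.span F {b0} := by
  intro x hx hb
  obtain ⟨P, τ, c, h1, h2, h3, q1, q2, q3⟩ := h.L0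
  have := h.PTT hp c h1 h2 q1 q2 q3 x hx
  rwa [c.P_one x hb] at this

end Clos3

set_option linter.all false
section Quo
variable {F}

structure EqAx {A : Type*} [NonUnitalNonAssocCommRing A] [Module F A] (α β : F) (a : A) : Prop where
  idem : a * a = a
  quart : ∀ x, a * (a * (a * (a * x))) = (1 + α + β) • (a * (a * (a * x)))
    - (α + β + α * β) • (a * (a * x)) + (α * β) • (a * x)
  f00 : ∀ u w, a * u = 0 → a * w = 0 → a * (u * w) = 0
  f0a : ∀ u w, a * u = 0 → a * w = α • w → a * (u * w) = α • (u * w)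
  f0b : ∀ u w, a * u = 0 → a * w = β • w → a * (u * w) = β • (u * w)
  faa : ∀ u w, a * u = α • u → a * w = α • w → a * (a * (u * w)) = a * (u * w)
  fab : ∀ u w, a * u = α • u → a * w = β • w → a * (u * w) = β • (u * w)
  fbb : ∀ u w, a * u = β • u → a * w = β • w →
    a * (a * (a * (u * w))) = (1 + α) • (a * (a * (u * w))) - α • (a * (u * w))

theorem IsAxis.eqAx {α β : F} {a : V} (h : IsAxis F α β a) : EqAx α β a where
  idem := h.idem
  quart := by
    intro x
    obtain ⟨x1, x0, xa, xb, h1, h0, ha, hb, rfl⟩ := h.dec x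
    simp only [mul_add, h1, h0, ha, hb, mul_smul_comm, mul_zero]
    module
  f00 := by
    intro u w hu hw
    have := h.fusion_zero_zero u (by rw [mem_eigSp, hu, zero_smul]) w
      (by rw [mem_eigSp, hw, zero_smul])
    rwa [mem_eigSp, zero_smul] at this
  f0a := by
    intro u w hu hw
    exact h.fusion_zero_alpha u (by rw [mem_eigSp, hu, zero_smul]) w hw
  f0b := by
    intro u w hu hw
    exact h.fusion_zero_beta u (by rw [mem_eigSp, hu, zero_smul]) w hw
  faa := by
    intro u w hu hw
    obtain ⟨r1, h1, r0, h0, e⟩ := Submodule.mem_sup.1 (h.fusion_alpha_alpha u hu w hw)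
    rw [mem_eigSp] at h1 h0
    rw [← e, mul_add, h1, h0, one_smul, zero_smul, add_zero, h1, one_smul]
  fab := fun u w hu hw => h.fusion_alpha_beta u hu w hw
  fbb := by
    intro u w hu hw
    obtain ⟨r, hr, ra, ha, e⟩ := Submodule.mem_sup.1 (h.fusion_beta_beta u hu w hw)
    obtain ⟨r1, h1, r0, h0, e'⟩ := Submodule.mem_sup.1 hr
    rw [mem_eigSp] at h1 h0 ha
    rw [← e, ← e']
    simp only [mul_add, h1, h0, ha, mul_smul_comm, smul_add]
    module

theorem EqAx.prod {A B : Type*} [NonUnitalNonAssocCommRing A] [Module F A]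
    [NonUnitalNonAssocCommRing B] [Module F B] {α β : F} {a : A} {b : B} (h : EqAx α β a)
    (k : EqAx α β b) : EqAx α β ((a, b) : A × B) where
  idem := by simp [h.idem, k.idem]
  quart := by
    rintro ⟨x, y⟩
    simp only [Prod.mk_mul_mk, Prod.smul_mk, Prod.mk_add_mk, Prod.mk_sub_mk, ← h.quart, ← k.quart]
  f00 := by
    rintro ⟨x, y⟩ ⟨x', y'⟩ h1 h2
    simp only [Prod.mk_mul_mk, Prod.smul_mk, Prod.mk.injEq, Prod.mk_eq_zero] at *
    exact ⟨h.f00 _ _ h1.1 h2.1, k.f00 _ _ h1.2 h2.2⟩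
  f0a := by
    rintro ⟨x, y⟩ ⟨x', y'⟩ h1 h2
    simp only [Prod.mk_mul_mk, Prod.smul_mk, Prod.mk.injEq, Prod.mk_eq_zero] at *
    exact ⟨h.f0a _ _ h1.1 h2.1, k.f0a _ _ h1.2 h2.2⟩
  f0b := by
    rintro ⟨x, y⟩ ⟨x', y'⟩ h1 h2
    simp only [Prod.mk_mul_mk, Prod.smul_mk, Prod.mk.injEq, Prod.mk_eq_zero] at *
    exact ⟨h.f0b _ _ h1.1 h2.1, k.f0b _ _ h1.2 h2.2⟩
  faa := by
    rintro ⟨x, y⟩ ⟨x', y'⟩ h1 h2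
    simp only [Prod.mk_mul_mk, Prod.smul_mk, Prod.mk.injEq, Prod.mk_eq_zero] at *
    exact ⟨h.faa _ _ h1.1 h2.1, k.faa _ _ h1.2 h2.2⟩
  fab := by
    rintro ⟨x, y⟩ ⟨x', y'⟩ h1 h2
    simp only [Prod.mk_mul_mk, Prod.smul_mk, Prod.mk.injEq, Prod.mk_eq_zero] at *
    exact ⟨h.fab _ _ h1.1 h2.1, k.fab _ _ h1.2 h2.2⟩
  fbb := by
    rintro ⟨x, y⟩ ⟨x', y'⟩ h1 h2
    simp only [Prod.mk_mul_mk, Prod.smul_mk, Prod.mk.injEq, Prod.mk_eq_zero, Prod.mk_sub_mk] at *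
    exact ⟨h.fbb _ _ h1.1 h2.1, k.fbb _ _ h1.2 h2.2⟩

theorem EqAx.of_inj {A B : Type*} [NonUnitalNonAssocCommRing A] [Module F A]
    [NonUnitalNonAssocCommRing B] [Module F B] {α β : F} {b : B} (f : B →ₗ[F] A)
    (fm : ∀ x y, f (x * y) = f x * f y) (fi : Function.Injective f) (h : EqAx α β (f b)) :
    EqAx α β b where
  idem := fi (by rw [fm, h.idem])
  quart := by intro x; apply fi; simp only [fm, map_add, map_sub, map_smul, h.quart]
  f00 := by
    intro u w hu hw; apply fi
    have hu := congrArg f hu; have hw := congrArg f hw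
    simp only [fm, map_smul, map_zero] at *
    exact h.f00 _ _ hu hw
  f0a := by
    intro u w hu hw; apply fi
    have hu := congrArg f hu; have hw := congrArg f hw
    simp only [fm, map_smul, map_zero] at *
    exact h.f0a _ _ hu hw
  f0b := by
    intro u w hu hw; apply fi
    have hu := congrArg f hu; have hw := congrArg f hw
    simp only [fm, map_smul, map_zero] at *
    exact h.f0b _ _ hu hw
  faa := by
    intro u w hu hw; apply fi
    have hu := congrArg f hu; have hw := congrArg f hw
    simp only [fm, map_smul, map_zero] at *
    exact h.faa _ _ hu hw
  fab := by
    intro u w hu hw; apply fi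
    have hu := congrArg f hu; have hw := congrArg f hw
    simp only [fm, map_smul, map_zero] at *
    exact h.fab _ _ hu hw
  fbb := by
    intro u w hu hw; apply fi
    have hu := congrArg f hu; have hw := congrArg f hw
    simp only [fm, map_smul, map_zero, map_sub] at *
    exact h.fbb _ _ hu hw

theorem EqAx.isAxis {α β : F} (hp : Par α β) {a : V} (h : EqAx α β a)
    (pr : ∀ x, a * x = x → x ∈ Submodule.span F {a}) : IsAxis F α β a := by
  have a1 : α ≠ 1 := sub_ne_zero.1 hp.a1
  have b1 : β ≠ 1 := sub_ne_zero.1 hp.b1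
  have ab : α ≠ β := sub_ne_zero.1 hp.ab
  have n1 : (1 - α) ≠ 0 := sub_ne_zero.2 a1.symm
  have n2 : (1 - β) ≠ 0 := sub_ne_zero.2 b1.symm
  have m1 : ∀ u, u ∈ eigSp F a 1 → ∃ t : F, u = t • a := by
    intro u hu
    rw [mem_eigSp, one_smul] at hu
    obtain ⟨t, ht⟩ := Submodule.mem_span_singleton.1 (pr u hu)
    exact ⟨t, ht.symm⟩
  have dec2 : ∀ x, a * (a * x) = a * x → x ∈ eigSp F a 1 ⊔ eigSp F a 0 := by
    intro x hx
    rw [Submodule.mem_sup]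
    refine ⟨a * x, ?_, x - a * x, ?_, by abel⟩
    · rw [mem_eigSp, hx, one_smul]
    · rw [mem_eigSp, mul_sub, hx, sub_self, zero_smul]
  have dec3 : ∀ x, a * (a * (a * x)) = (1 + α) • (a * (a * x)) - α • (a * x) →
      x ∈ eigSp F a 1 ⊔ eigSp F a 0 ⊔ eigSp F a α := by
    intro x hx
    have key : a * (a * x - a * (a * x)) = α • (a * x - a * (a * x)) := by
      rw [mul_sub, hx]; module
    rw [Submodule.mem_sup]
    refine ⟨x - (α * (1 - α))⁻¹ • (a * x - a * (a * x)), dec2 _ ?_,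
      (α * (1 - α))⁻¹ • (a * x - a * (a * x)), ?_, by abel⟩
    · rw [mul_sub, mul_smul_comm, key, mul_sub, mul_smul_comm, mul_smul_comm, key]
      have e : a * x - a * (a * x) = (α * (1 - α))⁻¹ • ((α * (1 - α)) • (a * x - a * (a * x))) := by
        rw [smul_smul, inv_mul_cancel₀ (mul_ne_zero hp.a0 n1), one_smul]
      linear_combination (norm := module) -e
    · rw [mem_eigSp, mul_smul_comm, key, smul_comm]
  refine ⟨h.idem, ?_, ?_, ?_, ?_, ?_, ?_, ?_, ?_, ?_, ?_, ?_⟩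
  · apply le_antisymm
    · intro x hx
      rw [mem_eigSp, one_smul] at hx
      exact pr x hx
    · rw [Submodule.span_singleton_le_iff_mem, mem_eigSp, one_smul, h.idem]
  · rw [eq_top_iff]
    intro x _
    set y := a * (a * (a * x)) - (1 + α) • (a * (a * x)) + α • (a * x) with hy
    have key : a * y = β • y := by
      rw [hy, mul_add, mul_sub, mul_smul_comm, mul_smul_comm, h.quart]; module
    have nz : β * (β - 1) * (β - α) ≠ 0 :=
      mul_ne_zero (mul_ne_zero hp.b0 hp.b1) (sub_ne_zero.2 ab.symm)
    rw [Submodule.mem_sup]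
    refine ⟨x - (β * (β - 1) * (β - α))⁻¹ • y, dec3 _ ?_,
      (β * (β - 1) * (β - α))⁻¹ • y, ?_, by abel⟩
    · simp only [mul_sub, mul_smul_comm, key]
      have e : y = (β * (β - 1) * (β - α))⁻¹ • ((β * (β - 1) * (β - α)) • y) := by
        rw [smul_smul, inv_mul_cancel₀ nz, one_smul]
      linear_combination (norm := module) e - hy
    · rw [mem_eigSp, mul_smul_comm, key, smul_comm]
  · intro u hu w hw
    obtain ⟨t, rfl⟩ := m1 u hu
    rw [mem_eigSp] at hw
    rw [smul_mul_assoc, hw, zero_smul, smul_zero]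
  · intro u hu w hw
    obtain ⟨t, rfl⟩ := m1 u hu
    have hw' := hw
    rw [mem_eigSp] at hw
    rw [smul_mul_assoc, hw]
    exact Submodule.smul_mem _ _ (Submodule.smul_mem _ _ hw')
  · intro u hu w hw
    obtain ⟨t, rfl⟩ := m1 u hu
    have hw' := hw
    rw [mem_eigSp] at hw
    rw [smul_mul_assoc, hw]
    exact Submodule.smul_mem _ _ (Submodule.smul_mem _ _ hw')
  · intro u hu w hw
    rw [mem_eigSp, zero_smul] at *
    exact h.f00 u w hu hw
  · intro u hu w hw
    rw [mem_eigSp] at *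
    rw [zero_smul] at hu
    exact h.f0a u w hu hw
  · intro u hu w hw
    rw [mem_eigSp] at *
    rw [zero_smul] at hu
    exact h.f0b u w hu hw
  · intro u hu w hw
    exact dec2 _ (h.faa u w hu hw)
  · intro u hu w hw
    exact h.fab u w hu hw
  · intro u hu w hw
    exact dec3 _ (h.fbb u w hu hw)

abbrev UW {A : Type v} [NonUnitalNonAssocCommRing A] [Module F A]
    (W : NonUnitalSubalgebra F A) : Type (max u v) := ULift.{u} W

instance uwRing {A : Type v} [NonUnitalNonAssocCommRing A] [Module F A]
    (W : NonUnitalSubalgebra F A) : NonUnitalNonAssocCommRing (UW W) :=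
  { (inferInstance : NonUnitalNonAssocRing (ULift.{u} W)) with
    mul_comm := fun x y => by
      apply ULift.ext; apply Subtype.ext
      exact mul_comm (x.down : A) y.down }

theorem quot_of_hx {α β : F} (hp : Par α β) {a₀ a₁ : V}
    (hV : NonUnitalAlgebra.adjoin F {a₀, a₁} = ⊤)
    {A : Type v} [NonUnitalNonAssocCommRing A] [Module F A] [SMulCommClass F A A]
    [IsScalarTower F A A] {l l' m m' n n' : F} {b0 b1 b2 b3 b4 b5 s e o p0 p1 p2 : A}
    (h : Hx α β l l' m m' n n' b0 b1 b2 b3 b4 b5 s e o p0 p1 p2) (h0 : EqAx α β b0)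
    (h1 : EqAx α β b1) (g : A →ₗ[F] A) (gm : ∀ x y, g (x * y) = g x * g y)
    (gg : ∀ x, g (g x) = x) (g0 : g b0 = b1)
    (θ : A →ₗ[F] V) (θm : ∀ x y, θ (x * y) = θ x * θ y) (t0 : θ b0 = a₀) (t1 : θ b1 = a₁) :
    IsQuotientOfSymmetric F α β a₀ a₁ := by
  have g1 : g b1 = b0 := by rw [← g0, gg]
  set W : NonUnitalSubalgebra F A := NonUnitalAlgebra.adjoin F {b0, b1} with hW
  have w0 : b0 ∈ W := NonUnitalAlgebra.subset_adjoin F (by simp)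
  have w1 : b1 ∈ W := NonUnitalAlgebra.subset_adjoin F (by simp)
  have hTT : ∀ x ∈ W, x ∈ TT (F := F) b0 b1 b2 b3 b4 b5 s e o p0 p1 p2 := by
    intro x hx
    induction hx using NonUnitalAlgebra.adjoin_induction with
    | mem z hz =>
      simp only [Set.mem_insert_iff, Set.mem_singleton_iff] at hz
      rcases hz with rfl | rfl <;> exact Submodule.subset_span (by simp)
    | zero => exact zero_mem _
    | mul x y _ _ h₁ h₂ => exact h.closed hp x h₁ y h₂
    | add x y _ _ h₁ h₂ => exact add_mem h₁ h₂
    | smul r x _ h => exact Submodule.smul_mem _ _ h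
  have gW : ∀ x ∈ W, g x ∈ W := by
    intro x hx
    induction hx using NonUnitalAlgebra.adjoin_induction with
    | mem z hz =>
      simp only [Set.mem_insert_iff, Set.mem_singleton_iff] at hz
      rcases hz with rfl | rfl
      · rwa [g0]
      · rwa [g1]
    | zero => rw [map_zero]; exact zero_mem _
    | mul x y _ _ h₁ h₂ => rw [gm]; exact mul_mem h₁ h₂
    | add x y _ _ h₁ h₂ => rw [map_add]; exact add_mem h₁ h₂
    | smul r x _ h => rw [map_smul]; exact SMulMemClass.smul_mem r h
  let f : UW W →ₗ[F] A :=
    { toFun := fun x => (x.down : A), map_add' := fun _ _ => rfl, map_smul' := fun _ _ => rfl }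
  have fm : ∀ x y, f (x * y) = f x * f y := fun _ _ => rfl
  have fi : Function.Injective f := fun x y hxy => ULift.ext _ _ (Subtype.ext hxy)
  have fW : ∀ x, f x ∈ W := fun x => x.down.2
  let mk : ∀ x ∈ W, UW W := fun x hx => ⟨⟨x, hx⟩⟩
  have fmk : ∀ x hx, f (mk x hx) = x := fun _ _ => rfl
  haveI : SMulCommClass F (UW W) (UW W) := ⟨fun r x y => fi (by
    rw [smul_eq_mul, smul_eq_mul, map_smul, fm, fm, map_smul, mul_smul_comm])⟩
  haveI : IsScalarTower F (UW W) (UW W) := ⟨fun r x y => fi (by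
    rw [smul_eq_mul, smul_eq_mul, map_smul, fm, fm, map_smul, smul_mul_assoc])⟩
  let c0 : UW W := mk b0 w0
  let c1 : UW W := mk b1 w1
  have gen : NonUnitalAlgebra.adjoin F {c0, c1} = ⊤ := by
    rw [eq_top_iff]
    have : ∀ x (hx : x ∈ W), mk x hx ∈ NonUnitalAlgebra.adjoin F {c0, c1} := by
      intro x hx
      induction hx using NonUnitalAlgebra.adjoin_induction with
      | mem z hz =>
        simp only [Set.mem_insert_iff, Set.mem_singleton_iff] at hz
        rcases hz with rfl | rfl
        · exact NonUnitalAlgebra.subset_adjoin F (by simp [c0])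
        · exact NonUnitalAlgebra.subset_adjoin F (by simp [c1])
      | zero => exact zero_mem _
      | mul x y _ _ h₁ h₂ => exact mul_mem h₁ h₂
      | add x y _ _ h₁ h₂ => exact add_mem h₁ h₂
      | smul r x _ h => exact SMulMemClass.smul_mem r h
    intro x _
    exact this (f x) (fW x)
  have ax0 : IsAxis F α β c0 := by
    apply EqAx.isAxis hp (EqAx.of_inj f fm fi h0)
    intro x hx
    have := h.prim hp (f x) (hTT _ (fW x)) ((fm _ _).symm.trans (congrArg f hx))
    obtain ⟨t, ht⟩ := Submodule.mem_span_singleton.1 this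
    exact Submodule.mem_span_singleton.2 ⟨t, fi (by rw [map_smul]; exact ht)⟩
  have ax1 : IsAxis F α β c1 := by
    apply EqAx.isAxis hp (EqAx.of_inj f fm fi h1)
    intro x hx
    have := h.rot.prim hp (f x) (by rw [TT_rot]; exact hTT _ (fW x)) ((fm _ _).symm.trans (congrArg f hx))
    obtain ⟨t, ht⟩ := Submodule.mem_span_singleton.1 this
    exact Submodule.mem_span_singleton.2 ⟨t, fi (by rw [map_smul]; exact ht)⟩
  let G : UW W →ₗ[F] UW W :=
    { toFun := fun x => mk (g (f x)) (gW _ (fW x))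
      map_add' := fun x y => fi (by
        show g (f (x + y)) = g (f x) + g (f y)
        rw [map_add, map_add])
      map_smul' := fun r x => fi (by
        show g (f (r • x)) = r • g (f x)
        rw [map_smul, map_smul]) }
  have fG : ∀ x, f (G x) = g (f x) := fun _ => rfl
  have GG : G ∘ₗ G = LinearMap.id := by
    apply LinearMap.ext
    intro x
    apply fi
    show g (g (f x)) = f x
    rw [gg]
  refine ⟨⟨UW W⟩, c0, c1, ⟨ax0, ax1, gen⟩, ⟨LinearEquiv.ofLinear G G GG GG, ?_, ?_, ?_⟩, θ ∘ₗ f, ?_, ?_, ?_⟩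
  · intro x y
    apply fi
    show f (G (x * y)) = f (G x * G y)
    rw [fm, fG, fG, fG, fm, gm]
  · exact fi g0
  · exact fi g1
  · intro x
    have hx : x ∈ NonUnitalAlgebra.adjoin F {a₀, a₁} := by rw [hV]; trivial
    induction hx using NonUnitalAlgebra.adjoin_induction with
    | mem z hz =>
      simp only [Set.mem_insert_iff, Set.mem_singleton_iff] at hz
      rcases hz with rfl | rfl
      · exact ⟨c0, t0⟩
      · exact ⟨c1, t1⟩
    | zero => exact ⟨0, map_zero _⟩
    | mul x y _ _ h₁ h₂ =>
      obtain ⟨x, rfl⟩ := h₁; obtain ⟨y, rfl⟩ := h₂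
      exact ⟨x * y, by rw [LinearMap.comp_apply, fm, θm]; rfl⟩
    | add x y _ _ h₁ h₂ =>
      obtain ⟨x, rfl⟩ := h₁; obtain ⟨y, rfl⟩ := h₂
      exact ⟨x + y, map_add _ _ _⟩
    | smul r x _ h => obtain ⟨x, rfl⟩ := h; exact ⟨r • x, map_smul _ _ _⟩
  · intro x y
    rw [LinearMap.comp_apply, fm, θm]; rfl
  · show ({θ b0, θ b1} : Set V) = _
    rw [t0, t1]

end Quo

set_option linter.all false
section PartB
variable {F}
variable {A : Type*} [NonUnitalNonAssocCommRing A] [Module F A] [SMulCommClass F A A]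
  [IsScalarTower F A A]
variable {α β l l' m m' n n' : F} {b0 b1 b2 b3 b4 b5 s e o p0 p1 p2 : A}

theorem Hx.nu1 (hp : Par α β) (h : Hx α β l l' m m' n n' b0 b1 b2 b3 b4 b5 s e o p0 p1 p2) :
    (α*(1-2*α)+2*α*n-2*(1-α)*n') • p0 + ((2*α-1)*n*(α-2*n)) • b0 = 0 ∧
    (∀ t : F, p0 = t • b0 → p0 = n • b0) ∧ (b3 = b0 → b0 = n • b0) := by
  obtain ⟨P, τ, c, h1, h2, h3, h4, h5, h6, -⟩ := h.cen
  obtain ⟨P', τ', c3, -⟩ := h.L3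
  have k := c.J'g h3 h3 h6 h6
  have q := h.b0p0
  have q3 := h.rot.rot.rot.b0p0
  rw [h.p03, c3.idem, h.p03, h6, q3, mul_add, mul_smul_comm, mul_smul_comm, q, h.p03] at k
  refine ⟨?_, ?_, ?_⟩
  · linear_combination (norm := module) k
  · intro t ht
    have := c.P_mul b3
    rw [h.p03, h6, ht, map_smul, c.P_c] at this
    rw [ht, this]
  · intro hb
    rw [hb, c.P_c] at h6
    exact h6

theorem Hx.nu2 (hp : Par α β) (h : Hx α β l l' m m' n n' b0 b1 b2 b3 b4 b5 s e o p0 p1 p2)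
    (hX : α*(1-2*α)+2*α*n-2*(1-α)*n' ≠ 0) : p0 = n • b0 := by
  obtain ⟨k, k2, -⟩ := h.nu1 hp
  set X := α*(1-2*α)+2*α*n-2*(1-α)*n'
  apply k2 (-(X⁻¹ * ((2*α-1)*n*(α-2*n))))
  have : p0 = X⁻¹ • (X • p0) := by rw [smul_smul, inv_mul_cancel₀ hX, one_smul]
  rw [this]
  linear_combination (norm := module) X⁻¹ • k

theorem Hx.nu3 (hp : Par α β) (h : Hx α β l l' m m' n n' b0 b1 b2 b3 b4 b5 s e o p0 p1 p2)
    (hX : α*(1-2*α)+2*α*n-2*(1-α)*n' ≠ 0) (z0 : b0 ≠ 0) (z3 : b3 ≠ 0) : n = n' := by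
  have q := h.nu2 hp hX
  have q3 := h.rot.rot.rot.b0p0
  obtain ⟨P, τ, c, -⟩ := h.L0
  obtain ⟨P', τ', c3, -⟩ := h.L3
  have e1 : b3 * p0 = (n * n) • b0 := by
    rw [q, mul_smul_comm, mul_comm, h.p03, q, smul_smul]
  rw [e1] at q3
  have n1 : (1 - α) ≠ 0 := by intro h; apply hp.a1; linear_combination -h
  by_cases hn : n' = 0
  · have : (n * (n - α)) • b0 = 0 := by
      rw [hn] at q3
      linear_combination (norm := module) q3 + α • q
    rcases smul_eq_zero.1 this with h0 | h0
    · rcases mul_eq_zero.1 h0 with h0 | h0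
      · rw [h0, hn]
      · exfalso
        have hna : n = α := sub_eq_zero.1 h0
        have := h.rot.rot.rot.nu2 hp (by
          rw [hn, hna]; intro hh; apply hp.a0; linear_combination -hh)
        rw [hn, q, zero_smul, hna] at this
        rcases smul_eq_zero.1 this with h1 | h1
        · exact hp.a0 h1
        · exact z0 h1
    · exact absurd h0 z0
  · have hb : b3 = (((1 - α) * n')⁻¹ * (n * n - α * n)) • b0 := by
      have : b3 = ((1 - α) * n')⁻¹ • (((1 - α) * n') • b3) := by
        rw [smul_smul, inv_mul_cancel₀ (mul_ne_zero n1 hn), one_smul]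
      rw [this]
      linear_combination (norm := module) ((1 - α) * n')⁻¹ • (-q3 - α • q)
    set t := ((1 - α) * n')⁻¹ * (n * n - α * n)
    have i3 := c3.idem
    rw [hb, smul_mul_smul_comm, c.idem, ← sub_eq_zero, ← sub_smul] at i3
    have t0 : t ≠ 0 := by intro h0; rw [h0, zero_smul] at hb; exact z3 hb
    have t1 : t = 1 := by
      rcases smul_eq_zero.1 i3 with h1 | h1
      · have : t * (t - 1) = 0 := by linear_combination h1
        exact sub_eq_zero.1 ((mul_eq_zero.1 this).resolve_left t0)
      · exact absurd h1 z0
    rw [t1, one_smul] at hb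
    obtain ⟨-, -, r0⟩ := h.nu1 hp
    obtain ⟨-, -, r3⟩ := h.rot.rot.rot.nu1 hp
    have r0 := r0 hb
    have r3 := r3 hb.symm
    have a0 : (1 - n) • b0 = 0 := by linear_combination (norm := module) r0
    have a3 : (1 - n') • b3 = 0 := by linear_combination (norm := module) r3
    have a0 := (smul_eq_zero.1 a0).resolve_right z0
    have a3 := (smul_eq_zero.1 a3).resolve_right z3
    linear_combination a3 - a0

theorem Hx.nu (hp : Par α β) (h : Hx α β l l' m m' n n' b0 b1 b2 b3 b4 b5 s e o p0 p1 p2)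
    (z0 : b0 ≠ 0) (z3 : b3 ≠ 0) : n = n' := by
  by_cases hX : α*(1-2*α)+2*α*n-2*(1-α)*n' = 0
  · by_cases hX' : α*(1-2*α)+2*α*n'-2*(1-α)*n = 0
    · have : 2 * (n - n') = 0 := by linear_combination hX - hX'
      exact sub_eq_zero.1 ((mul_eq_zero.1 this).resolve_left hp.h2)
    · exact (h.rot.rot.rot.nu3 hp hX' z3 z0).symm
  · exact h.nu3 hp hX z0 z3

/-- multiply a linear relation by `b0` and remove the `b0`-component -/
theorem Hx.relmul (hp : Par α β) (h : Hx α β l l' m m' n n' b0 b1 b2 b3 b4 b5 s e o p0 p1 p2)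
    {x y z w v : F}
    (r : x • (b0 + b2 + b4) + y • (b1 + b3 + b5) + z • e + w • o + v • s = 0) :
    (2*(α-2*β)*x + (α-2*β)*(α-β)*z + 2*β*(α-β)*w) •
      ((2 : F) • e + β • (b2 + b4) + (2 * (β - m)) • b0)
    + (2*(α-2*β)*y + (4*α^2-2*α*β+4*β^2-α-2*β-4*α*(l+l')+4*l')*w + (α-2*β)*(α-β)*v) •
      ((2 : F) • s + β • (b1 + b5) + (2 * (β - l)) • b0)
    + (2*(α-2*β)*y) • (p0 - n • b0) = 0 := by
  obtain ⟨P, τ, c, h1, h2, h3, h4, h5, h6, -⟩ := h.cen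
  have po := h.Po hp.h2 hp.ab c h1 h4 h5
  have ps := c.Ps h4 h.ct1
  have pe := c.Ps h5 h.ct2
  have hs := h.b0s
  have he := h.b0e
  have ho := h.b0o hp.h2 hp.ab
  have r1 := congrArg (fun t => b0 * t) r
  have r2 := congrArg P r
  have e1 : b0 + b2 + b4 = b0 + (b2 + b4) := by abel
  have e2 : b1 + b3 + b5 = b3 + (b1 + b5) := by abel
  rw [e1, e2] at r1 r2
  beta_reduce at r1
  rw [mul_add, mul_add, mul_add, mul_add, mul_smul_comm, mul_smul_comm, mul_smul_comm,
    mul_smul_comm, mul_smul_comm,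
    mul_add b0 b0, mul_add b0 b3, c.idem, h.ct1, h.ct2, h.p03, mul_zero] at r1
  rw [map_add, map_add, map_add, map_add, map_smul, map_smul, map_smul, map_smul, map_smul,
    map_add P b0, map_add P b3, c.P_c, h4, h5, h6, po, map_zero] at r2
  linear_combination (norm := module) (2*(α-2*β)) • r1 - (2*(α-2*β)) • r2 - ((α-2*β)*v) • hs
    - ((α-2*β)*z) • he - w • ho + ((α-2*β)*v) • ps + ((α-2*β)*z) • pe

end PartB

set_option linter.all false
section PartB2
variable {F}
variable {A : Type*} [NonUnitalNonAssocCommRing A] [Module F A] [SMulCommClass F A A]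
  [IsScalarTower F A A]
variable {α β l l' m m' n n' : F} {b0 b1 b2 b3 b4 b5 s e o p0 p1 p2 : A}

set_option maxHeartbeats 1000000 in
theorem Hx.caseII (hp : Par α β) (h : Hx α β l l' m m' n n' b0 b1 b2 b3 b4 b5 s e o p0 p1 p2)
    (nn : n = n') (z0 : b0 ≠ 0) (z3 : b3 ≠ 0) (d02 : b0 ≠ b2) {k : F} (hk : k ≠ 0)
    (E : b3 - b5 = k • (b0 - b2)) : l = l' ∧ m = m' := by
  have dz : b0 - b2 ≠ 0 := sub_ne_zero.2 d02
  obtain ⟨P, τ, c, h1, h2, h3, h4, h5, h6⟩ := h.L0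
  obtain ⟨P', τ', c3, h1', h2', h3', h4', h5', h6'⟩ := h.L3
  obtain ⟨_, _, c2, -⟩ := h.L2
  obtain ⟨_, _, c5, -⟩ := h.L5
  have E1 : b3 - b1 = k • (b0 - b4) := by
    have := congrArg τ E
    rw [map_sub, map_smul, map_sub, c.τ_c, h3, h2, ← h1, c.τ_τ] at this
    exact this
  obtain ⟨d, hd⟩ : ∃ d, d = b3 - k • b0 := ⟨_, rfl⟩
  have e3 : b3 = d + k • b0 := by rw [hd]; abel
  have e5 : b5 = d + k • b2 := by rw [hd]; linear_combination (norm := module) -E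
  have e1 : b1 = d + k • b4 := by rw [hd]; linear_combination (norm := module) -E1
  obtain ⟨u0, hu0⟩ : ∃ u, u = b0 * d := ⟨_, rfl⟩
  obtain ⟨u2, hu2⟩ : ∃ u, u = b2 * d := ⟨_, rfl⟩
  have uu : u2 - u0 = (β * (1 - k)) • (b2 - b0) := by
    have a := h.s12
    have b := h.s01
    rw [mul_comm b0 b1] at b
    rw [e1, add_mul, smul_mul_assoc, mul_comm d, ← hu2, mul_comm b4, h.e24] at a
    rw [e1, add_mul, smul_mul_assoc, mul_comm d, ← hu0, h.e40] at b
    linear_combination (norm := module) a - b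
  have dd0 : d * d + (2 * k) • u0 + (k * k) • b0 = d + k • b0 := by
    have := c3.idem
    rw [e3, add_mul, mul_add, mul_add, smul_mul_assoc, smul_mul_assoc, mul_smul_comm, mul_smul_comm,
      mul_comm d b0, ← hu0, c.idem] at this
    linear_combination (norm := module) this
  have dd2 : d * d + (2 * k) • u2 + (k * k) • b2 = d + k • b2 := by
    have := c5.idem
    rw [e5, add_mul, mul_add, mul_add, smul_mul_assoc, smul_mul_assoc, mul_smul_comm, mul_smul_comm,
      mul_comm d b2, ← hu2, c2.idem] at this
    linear_combination (norm := module) this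
  have hb : (1 - k) * (1 - 2 * β) = 0 := by
    have : (k * ((1 - k) * (1 - 2 * β))) • (b0 - b2) = 0 := by
      linear_combination (norm := module) dd2 - dd0 - (2 * k) • uu
    exact (mul_eq_zero.1 ((smul_eq_zero.1 this).resolve_right dz)).resolve_left hk
  obtain ⟨g, hg⟩ : ∃ g, g = β * (1 - k) := ⟨_, rfl⟩
  have hg2 : 2 * g = 1 - k := by rw [hg]; linear_combination -hb
  rw [← hg] at uu
  obtain ⟨f, hf⟩ : ∃ f, f = u0 - g • b0 := ⟨_, rfl⟩
  have f0 : u0 = f + g • b0 := by rw [hf]; abel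
  have f2 : u2 = f + g • b2 := by rw [hf]; linear_combination (norm := module) uu
  have dk : d * d = d - (2 * k) • f := by
    have : (k * (2 * g - (1 - k))) • b0 = 0 := by rw [hg2, sub_self, mul_zero, zero_smul]
    linear_combination (norm := module) dd0 - (2 * k) • f0 - this
  have P0 : p0 = f + (g + k) • b0 := by
    rw [← h.p03, e3, mul_add, mul_smul_comm, c.idem, ← hu0, f0]; module
  have P2 : p2 = f + (g + k) • b2 := by
    rw [← h.p25, e5, mul_add, mul_smul_comm, c2.idem, ← hu2, f2]; module
  have df0 := h.rot.rot.rot.b0p0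
  have df2 := h.rot.rot.rot.rot.rot.b0p0
  have bf0 := h.b0p0
  have bf2 := h.rot.rot.b0p0
  rw [P0, mul_add, mul_smul_comm, c.idem] at bf0
  rw [P2, mul_add, mul_smul_comm, c2.idem] at bf2
  rw [P0, e3, mul_add, mul_smul_comm, add_mul, add_mul, smul_mul_assoc, smul_mul_assoc,
    mul_comm d b0, ← hu0, c.idem, f0] at df0
  rw [P2, e5, mul_add, mul_smul_comm, add_mul, add_mul, smul_mul_assoc, smul_mul_assoc,
    mul_comm d b2, ← hu2, c2.idem, f2] at df2
  have key : ((g + k) * (α - (g + k) + k - k * α)) • (b0 - b2) = 0 := by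
    rw [← nn] at df0 df2
    linear_combination (norm := module) df2 - df0 + k • bf0 - k • bf2
  have key := (smul_eq_zero.1 key).resolve_right dz
  have hkk : k * k = 1 := by
    have a : (1 + k) * ((1 - k) * (2 * α - 1)) = 0 := by
      linear_combination 4 * key + (-2*α + (1 + k) - 2 * k + 2 * k * α + 2 * (g + k)) * hg2
    have key2 : (1 - k) * (1 + k) * (α - β) = 0 := by
      apply mul_left_cancel₀ hp.h2
      linear_combination a + (1 + k) * hb
    have := (mul_eq_zero.1 key2).resolve_right hp.ab
    linear_combination -this
  have ho : o = e + (1 - 2 * β) • d := by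
    have a := h.o35
    rw [e3, e5, add_mul, mul_add, mul_add, smul_mul_assoc, smul_mul_assoc, mul_smul_comm,
      mul_smul_comm, mul_comm d b2, ← hu0, ← hu2, h.e02, f0, f2, dk] at a
    have z1 : (k * (g - β * (1 - k))) • (b0 + b2) = 0 := by rw [hg, sub_self, mul_zero, zero_smul]
    have z2 : (k * k - 1) • e = 0 := by rw [hkk, sub_self, zero_smul]
    linear_combination (norm := module) -a + z1 + z2
  have hm : m = m' := by
    have a3 := h.rot.rot.rot.b0e
    have a5 := h.rot.rot.rot.rot.rot.b0e
    have a0 := h.b0e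
    have a2 := h.rot.rot.b0e
    have : (2 : F) • ((b3 - b5) * o) = (2 : F) • (k • ((b0 - b2) * e) + (k * (1 - 2 * β)) • (u0 - u2)) := by
      rw [E, smul_mul_assoc, ho, mul_add, mul_smul_comm, sub_mul b0 b2 d, ← hu0, ← hu2]; module
    rw [sub_mul, sub_mul] at this
    have z : (k * (1 - 2 * β) * g) • (b0 - b2) = 0 := by
      have : (1 - 2 * β) * g = 0 := by rw [hg]; linear_combination β * hb
      rw [mul_assoc, this, mul_zero, zero_smul]
    have r : (k * (2 * ((1 - α) * (m - m')))) • (b0 - b2) = 0 := by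
      linear_combination (norm := module) a3 - a5 - this - k • a0 + k • a2
        + (2 * k * (1 - 2 * β)) • uu - (2 : F) • z
          + (2 * ((1 - α) * m' + β * (α - β - 1)) - β * (α - β)) • E
    have r := (mul_eq_zero.1 ((smul_eq_zero.1 r).resolve_right dz)).resolve_left hk
    have r := (mul_eq_zero.1 r).resolve_left hp.h2
    rcases mul_eq_zero.1 r with r | r
    · exact absurd (by linear_combination -r) hp.a1
    · exact sub_eq_zero.1 r
  refine ⟨?_, hm⟩
  have x1 : l = n - k + k * m := by
    have a := congrArg P E1
    have h5b : P b4 = m • b0 := by rw [← h2, c.P_τ, h5]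
    rw [map_sub, map_smul, map_sub, h6, h4, h5b, c.P_c] at a
    have : (l - (n - k + k * m)) • b0 = 0 := by linear_combination (norm := module) -a
    exact sub_eq_zero.1 ((smul_eq_zero.1 this).resolve_right z0)
  have x2 : m' = 1 - k * n' + k * l' := by
    have a := congrArg P' E1
    have h5b : P' b1 = m' • b3 := by rw [← h2', c3.P_τ, h5']
    rw [map_sub, map_smul, map_sub, h6', h4', h5b, c3.P_c] at a
    have : (m' - (1 - k * n' + k * l')) • b3 = 0 := by linear_combination (norm := module) -a
    exact sub_eq_zero.1 ((smul_eq_zero.1 this).resolve_right z3)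
  rw [x1, nn, hm, x2]
  linear_combination (l' - n') * hkk

end PartB2

set_option linter.all false
section PartB3
variable {F}
variable {A : Type*} [NonUnitalNonAssocCommRing A] [Module F A] [SMulCommClass F A A]
  [IsScalarTower F A A]
variable {α β l l' m m' n n' : F} {b0 b1 b2 b3 b4 b5 s e o p0 p1 p2 : A}

def Ind (F : Type*) [Field F] {A : Type*} [AddCommGroup A] [Module F A] (u w : A) : Prop :=
  ∀ x y : F, x • u + y • w = 0 → x = 0 ∧ y = 0

theorem Ind.swap {A : Type*} [AddCommGroup A] [Module F A] {u w : A} (h : Ind F u w) :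
    Ind F w u := fun x y r => (h y x (by rw [add_comm]; exact r)).symm

theorem szr {A : Type*} [AddCommGroup A] [Module F A] {c : F} {t : A} (hc : c ≠ 0)
    (h : c • t = 0) : t = 0 := (smul_eq_zero.1 h).resolve_left hc

def C0 (α β l l' m : F) : F :=
  -2*α^3*β+4*α^3*l-16*α^2*β^2+16*α^2*β*l+4*α^2*β*l'+2*α^2*β*m-12*α^2*l^2-4*α^2*l*l'+26*α*β^3
        -24*α*β^2*l-2*α*β^2*m+8*α*β^2+16*α*β*l^2-12*α*β*l-4*α*β*l'+4*α*l^2+4*α*l*l'-8*β^4-8*β^3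
        +16*β^2*l-8*β*l^2

theorem Hx.coef (hp : Par α β) (h : Hx α β l l' m m' n n' b0 b1 b2 b3 b4 b5 s e o p0 p1 p2)
    (ind : Ind F (b0 - b2) (b3 - b5)) :
    -2*(α-1)*(α-4*β)*l'+4*α*β*l+β*(4*β^2-10*α*β-α+6*β) = 0 ∧
    C0 α β l l' m = β*(α-β)^2*(α-4*β) := by
  have r0 := h.ss hp.h2 hp.ab
  have r2 := h.rot.rot.ss hp.h2 hp.ab
  have := ind (2 * (C0 α β l l' m - β*(α-β)^2*(α-4*β)))
    (-(2 * ((α-β)*(-2*(α-1)*(α-4*β)*l'+4*α*β*l+β*(4*β^2-10*α*β-α+6*β))))) (by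
      unfold C0
      linear_combination (norm := module) r2 - r0)
  obtain ⟨u, w⟩ := this
  constructor
  · have w := (mul_eq_zero.1 (neg_eq_zero.1 w)).resolve_left hp.h2
    exact (mul_eq_zero.1 w).resolve_left hp.ab
  · exact sub_eq_zero.1 ((mul_eq_zero.1 u).resolve_left hp.h2)

theorem Hx.star (hp : Par α β) (h : Hx α β l l' m m' n n' b0 b1 b2 b3 b4 b5 s e o p0 p1 p2)
    (ind : Ind F (b0 - b2) (b3 - b5)) {θ : F}
    (hθ : β * (α - β)^2 * θ = 4 * α * (α - 2 * β + 1) * (l - l')) :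
    (α - 4 * β) • (b0 + b2 + b4) + (-(α - 4 * β)) • (b1 + b3 + b5) + (-4 : F) • e + (4 : F) • o
      + θ • s = 0 := by
  have r0 := h.ss hp.h2 hp.ab
  have r3 := h.rot.rot.rot.ss hp.h2 hp.ab
  obtain ⟨c1, c0⟩ := h.coef hp ind
  obtain ⟨c1', c0'⟩ := h.rot.rot.rot.coef hp ind.swap
  rw [← C0, c1, c0] at r0
  rw [← C0, c1', c0'] at r3
  have z : (2 * (β * (α - β)^2)) ≠ 0 :=
    mul_ne_zero hp.h2 (mul_ne_zero hp.b0 (pow_ne_zero _ hp.ab))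
  have z2 : (2 * (β * (α - β)^2 * θ - 4 * α * (α - 2 * β + 1) * (l - l'))) • s = 0 := by
    rw [hθ, sub_self, mul_zero, zero_smul]
  refine szr (c := (2 * (β * (α - β)^2))) (z) ?_
  linear_combination (norm := module) r3 - r0 + z2

theorem Hx.pform (hp : Par α β) (h : Hx α β l l' m m' n n' b0 b1 b2 b3 b4 b5 s e o p0 p1 p2)
    {θ k' Y : F}
    (st : (α - 4 * β) • (b0 + b2 + b4) + (-(α - 4 * β)) • (b1 + b3 + b5) + (-4 : F) • e
      + (4 : F) • o + θ • s = 0)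
    (hk : (α - 2 * β) * k' = (α - 4 * β) * α)
    (hY : 2 * (α - 2 * β) * Y = -2 * (α - 2 * β) * (α - 4 * β) +
      4 * (4*α^2-2*α*β+4*β^2-α-2*β-4*α*(l+l')+4*l') + (α - 2 * β) * θ * (α - β)) :
    (α - 4 * β) • (p0 - n • b0) = (-k') • ((2 : F) • e + β • (b2 + b4) + (2 * (β - m)) • b0)
      + Y • ((2 : F) • s + β • (b1 + b5) + (2 * (β - l)) • b0) := by
  have r := h.relmul hp st
  obtain ⟨V2, hV2⟩ : ∃ V2, V2 = ((2 : F) • e + β • (b2 + b4) + (2 * (β - m)) • b0) := ⟨_, rfl⟩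
  obtain ⟨V1, hV1⟩ : ∃ V1, V1 = ((2 : F) • s + β • (b1 + b5) + (2 * (β - l)) • b0) := ⟨_, rfl⟩
  rw [← hV1, ← hV2] at r ⊢
  have z1 : (2 * ((α - 2 * β) * k' - (α - 4 * β) * α)) • V2 = 0 := by
    rw [hk, sub_self, mul_zero, zero_smul]
  have z2 : (2 * (α - 2 * β) * Y - (-2 * (α - 2 * β) * (α - 4 * β) +
      4 * (4*α^2-2*α*β+4*β^2-α-2*β-4*α*(l+l')+4*l') + (α - 2 * β) * θ * (α - β))) • V1 = 0 := by
    rw [hY, sub_self, zero_smul]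
  apply sub_eq_zero.1
  refine szr (c := (2 * (α - 2 * β))) ((mul_ne_zero hp.h2 hp.ab2)) ?_
  linear_combination (norm := module) z1 - z2 - r

theorem Hx.G (hp : Par α β) (h : Hx α β l l' m m' n n' b0 b1 b2 b3 b4 b5 s e o p0 p1 p2)
    (ind : Ind F (b0 - b2) (b3 - b5)) {θ k' Y : F}
    (st : (α - 4 * β) • (b0 + b2 + b4) + (-(α - 4 * β)) • (b1 + b3 + b5) + (-4 : F) • e
      + (4 : F) • o + θ • s = 0)
    (hk : (α - 2 * β) * k' = (α - 4 * β) * α)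
    (hY : 2 * (α - 2 * β) * Y = -2 * (α - 2 * β) * (α - 4 * β) +
      4 * (4*α^2-2*α*β+4*β^2-α-2*β-4*α*(l+l')+4*l') + (α - 2 * β) * θ * (α - β))
    {x y v : F} (r : x • (b0 + b2 + b4) + y • (b1 + b3 + b5) + v • s = 0) :
    2 * y * (α - 4 * β + Y) + (α - 4 * β) * v * (α - β) = 0 ∧
    ((α - 4 * β) * x - y * k' = 0 ∨ (β = 2 * m ∧ (2 : F) • e + β • (b0 + b2 + b4) = 0)) := by
  have q0 := h.pform hp st hk hY
  have st2 : (α - 4 * β) • (b2 + b4 + b0) + (-(α - 4 * β)) • (b3 + b5 + b1) + (-4 : F) • e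
      + (4 : F) • o + θ • s = 0 := by linear_combination (norm := module) st
  have q2 := h.rot.rot.pform hp st2 hk hY
  have r0 := h.relmul hp (show x • (b0 + b2 + b4) + y • (b1 + b3 + b5) + (0 : F) • e + (0 : F) • o
    + v • s = 0 by linear_combination (norm := module) r)
  have r2 := h.rot.rot.relmul hp (show x • (b2 + b4 + b0) + y • (b3 + b5 + b1) + (0 : F) • e
    + (0 : F) • o + v • s = 0 by linear_combination (norm := module) r)
  obtain ⟨a, ha⟩ : ∃ a, a = (α - 4 * β) * x - y * k' := ⟨_, rfl⟩
  obtain ⟨b, hb⟩ : ∃ b, b = 2 * y * (α - 4 * β + Y) + (α - 4 * β) * v * (α - β) := ⟨_, rfl⟩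
  have f0 : (2 * a) • ((2 : F) • e + β • (b2 + b4) + (2 * (β - m)) • b0)
      + b • ((2 : F) • s + β • (b1 + b5) + (2 * (β - l)) • b0) = 0 := by
    refine szr (c := (α - 2 * β)) (hp.ab2) ?_
    rw [ha, hb]
    linear_combination (norm := module) (α - 4 * β) • r0 - (2 * (α - 2 * β) * y) • q0
  have f2 : (2 * a) • ((2 : F) • e + β • (b4 + b0) + (2 * (β - m)) • b2)
      + b • ((2 : F) • s + β • (b3 + b1) + (2 * (β - l)) • b2) = 0 := by
    refine szr (c := (α - 2 * β)) (hp.ab2) ?_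
    rw [ha, hb]
    linear_combination (norm := module) (α - 4 * β) • r2 - (2 * (α - 2 * β) * y) • q2
  obtain ⟨t1, t2⟩ := ind (2 * a * (2 * (β - m) - β) + b * (2 * (β - l))) (-(b * β)) (by
    linear_combination (norm := module) f0 - f2)
  have b0' : b = 0 := (mul_eq_zero.1 (neg_eq_zero.1 t2)).resolve_right hp.b0
  rw [← hb, ← ha]
  refine ⟨b0', ?_⟩
  by_cases az : a = 0
  · exact Or.inl az
  right
  rw [b0', zero_mul, add_zero] at t1
  have t1 := (mul_eq_zero.1 t1).resolve_left (mul_ne_zero hp.h2 az)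
  refine ⟨by linear_combination t1, ?_⟩
  rw [b0', zero_smul, add_zero] at f0
  have f0 := (smul_eq_zero.1 f0).resolve_left (mul_ne_zero hp.h2 az)
  have t3 : (2 * (β - m) - β) • b0 = 0 := by rw [t1, zero_smul]
  linear_combination (norm := module) f0 - t3

theorem Hx.rL (hp : Par α β) (h : Hx α β l l' m m' n n' b0 b1 b2 b3 b4 b5 s e o p0 p1 p2)
    (ind : Ind F (b0 - b2) (b3 - b5)) (nn : n = n') {θ k' Y Y' : F}
    (st : (α - 4 * β) • (b0 + b2 + b4) + (-(α - 4 * β)) • (b1 + b3 + b5) + (-4 : F) • e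
      + (4 : F) • o + θ • s = 0)
    (hk : (α - 2 * β) * k' = (α - 4 * β) * α)
    (hY : 2 * (α - 2 * β) * Y = -2 * (α - 2 * β) * (α - 4 * β) +
      4 * (4*α^2-2*α*β+4*β^2-α-2*β-4*α*(l+l')+4*l') + (α - 2 * β) * θ * (α - β))
    (hY' : 2 * (α - 2 * β) * Y' = -2 * (α - 2 * β) * (α - 4 * β) +
      4 * (4*α^2-2*α*β+4*β^2-α-2*β-4*α*(l'+l)+4*l) + (α - 2 * β) * (-θ) * (α - β)) :
    (-((α - 4 * β) * α + 2 * β * Y')) • (b0 + b2 + b4) +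
    ((α - 4 * β) * α + 2 * β * Y) • (b1 + b3 + b5) + (4 * (Y - Y') - k' * θ) • s = 0 := by
  have q0 := h.pform hp st hk hY
  have q2 := h.rot.rot.pform hp (show (α - 4 * β) • (b2 + b4 + b0) +
    (-(α - 4 * β)) • (b3 + b5 + b1) + (-4 : F) • e
      + (4 : F) • o + θ • s = 0 by linear_combination (norm := module) st) hk hY
  have q3 := h.rot.rot.rot.pform hp (θ := -θ) (show (α - 4 * β) • (b3 + b5 + b1) +
    (-(α - 4 * β)) • (b4 + b0 + b2) + (-4 : F) • o
      + (4 : F) • e + (-θ) • s = 0 by linear_combination (norm := module) -st) hk hY'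
  have q5 := h.rot.rot.rot.rot.rot.pform hp (θ := -θ) (show (α - 4 * β) • (b5 + b1 + b3) +
    (-(α - 4 * β)) • (b0 + b2 + b4) + (-4 : F) • o
      + (4 : F) • e + (-θ) • s = 0 by linear_combination (norm := module) -st) hk hY'
  rw [← nn] at q3 q5
  obtain ⟨t1, t2⟩ := ind
    (-k' * (2 * (β - m)) + Y * (2 * (β - l)) + (α - 4 * β) * n + k' * β + Y' * β)
    (k' * (2 * (β - m')) - Y' * (2 * (β - l')) - (α - 4 * β) * n - k' * β - Y * β) (by
    linear_combination (norm := module) q2 - q0 + q3 - q5)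
  have t1' : (-k' * (2 * (β - m)) + Y * (2 * (β - l)) + (α - 4 * β) * n + k' * β + Y' * β) • b0 = 0 := by
    rw [t1, zero_smul]
  have t2' : (k' * (2 * (β - m')) - Y' * (2 * (β - l')) - (α - 4 * β) * n - k' * β - Y * β) • b3 = 0 := by
    rw [t2, zero_smul]
  have t3 : ((α - 2 * β) * k' - (α - 4 * β) * α) • (b0 + b2 + b4 - (b1 + b3 + b5)) = 0 := by
    rw [hk, sub_self, zero_smul]
  linear_combination (norm := module) (2 : F) • (q3 - q0) - (2 : F) • t1' - (2 : F) • t2' -  k' • st + t3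

theorem Hx.caseIaux (hp : Par α β) (h : Hx α β l l' m m' n n' b0 b1 b2 b3 b4 b5 s e o p0 p1 p2)
    (ind : Ind F (b0 - b2) (b3 - b5)) {θ : F}
    (st : (α - 4 * β) • (b0 + b2 + b4) + (-(α - 4 * β)) • (b1 + b3 + b5) + (-4 : F) • e
      + (4 : F) • o + θ • s = 0)
    (C : (2 : F) • e + β • (b0 + b2 + b4) = 0)
    (C' : ¬ (β = 2 * m' ∧ (2 : F) • o + β • (b3 + b5 + b1) = 0))
    {x y v : F} (hx : x ≠ 0) (hxy : (α - 2 * β) * y = α * x)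
    (r : x • (b0 + b2 + b4) + y • (b1 + b3 + b5) + v • s = 0) :
    ∃ a b : F, s = a • (b1 + b3 + b5) + b • o := by
  have hxy' : ((α - 2 * β) * y - α * x) • (b1 + b3 + b5) = 0 := by rw [hxy, sub_self, zero_smul]
  have q : (2 * (α - 2 * β) * x) • (b1 + b3 + b5) + (-4 * x) • o
      + ((α - 2 * β) * v - x * θ) • s = 0 := by
    linear_combination (norm := module) (α - 2 * β) • r - x • st - (2 * x) • C - hxy'
  by_cases hz : (α - 2 * β) * v - x * θ = 0
  · exfalso
    rw [hz, zero_smul, add_zero] at q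
    have q' : (α - 2 * β) • (b1 + b3 + b5) + (-2 : F) • o = 0 := by
      refine szr (c := (2 * x)) ((mul_ne_zero hp.h2 hx)) ?_
      linear_combination (norm := module) q
    have r3 := h.rot.rot.rot.relmul hp (show (α - 2 * β) • (b3 + b5 + b1) +
      (0 : F) • (b4 + b0 + b2) + (-2 : F) • o
      + (0 : F) • e + (0 : F) • s = 0 by linear_combination (norm := module) q')
    have r5 := h.rot.rot.rot.rot.rot.relmul hp (show (α - 2 * β) • (b5 + b1 + b3) +
      (0 : F) • (b0 + b2 + b4) + (-2 : F) • o
      + (0 : F) • e + (0 : F) • s = 0 by linear_combination (norm := module) q')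
    have nz : 2 * (α - 2 * β) * β ≠ 0 := mul_ne_zero (mul_ne_zero hp.h2 hp.ab2) hp.b0
    have v3 : ((2 : F) • o + β • (b5 + b1) + (2 * (β - m')) • b3) = 0 := by
      refine szr (c := (2 * (α - 2 * β) * β)) (nz) ?_
      linear_combination (norm := module) -r3
    have v5 : ((2 : F) • o + β • (b1 + b3) + (2 * (β - m')) • b5) = 0 := by
      refine szr (c := (2 * (α - 2 * β) * β)) (nz) ?_
      linear_combination (norm := module) -r5
    obtain ⟨-, t⟩ := ind 0 (2 * (β - m') - β) (by linear_combination (norm := module) v3 - v5)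
    apply C'
    refine ⟨by linear_combination t, ?_⟩
    have t3 : (2 * (β - m') - β) • b3 = 0 := by rw [t, zero_smul]
    linear_combination (norm := module) v3 - t3
  · obtain ⟨i, hi⟩ : ∃ i, i * ((α - 2 * β) * v - x * θ) = 1 := ⟨_, inv_mul_cancel₀ hz⟩
    refine ⟨-(i * (2 * (α - 2 * β) * x)), i * (4 * x), ?_⟩
    have hi' : (i * ((α - 2 * β) * v - x * θ) - 1) • s = 0 := by rw [hi, sub_self, zero_smul]
    linear_combination (norm := module) i • q - hi'

end PartB3

set_option linter.all false
section PartB4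
variable {F}
variable {A : Type*} [NonUnitalNonAssocCommRing A] [Module F A] [SMulCommClass F A A]
  [IsScalarTower F A A]
variable {α β l l' m m' n n' : F} {b0 b1 b2 b3 b4 b5 s e o p0 p1 p2 : A}

set_option maxHeartbeats 1000000 in
theorem Hx.caseI (hp : Par α β) (h : Hx α β l l' m m' n n' b0 b1 b2 b3 b4 b5 s e o p0 p1 p2)
    (ind : Ind F (b0 - b2) (b3 - b5)) (nn : n = n') :
    (l = l' ∧ m = m') ∨ (∃ a b : F, s = a • (b1 + b3 + b5) + b • o) ∨
      (∃ a b : F, s = a • (b0 + b2 + b4) + b • e) := by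
  obtain ⟨c1, c0⟩ := h.coef hp ind
  obtain ⟨c1', c0'⟩ := h.rot.rot.rot.coef hp ind.swap
  by_cases hl : l = l'
  · left
    refine ⟨hl, ?_⟩
    subst hl
    unfold C0 at c0 c0'
    have : 2 * α * β * (α - β) * (m - m') = 0 := by linear_combination c0 - c0'
    have := (mul_eq_zero.1 this).resolve_left
      (mul_ne_zero (mul_ne_zero (mul_ne_zero hp.h2 hp.a0) hp.b0) hp.ab)
    exact sub_eq_zero.1 this
  right
  have hl' : l - l' ≠ 0 := sub_ne_zero.2 hl
  have R0 : (α - 1) * (α - 4 * β) + 2 * α * β = 0 := by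
    have : (2 * (l - l')) * ((α - 1) * (α - 4 * β) + 2 * α * β) = 0 := by
      linear_combination c1 - c1'
    exact (mul_eq_zero.1 this).resolve_left (mul_ne_zero hp.h2 hl')
  have hκ : α - 4 * β ≠ 0 := by
    intro hz
    rw [hz] at R0
    exact mul_ne_zero (mul_ne_zero hp.h2 hp.a0) hp.b0 (by linear_combination R0)
  have hε1 : α - 2 * β + 1 ≠ 0 := by
    intro hz
    apply hp.h2
    linear_combination R0 - (α - 2) * hz
  have hD : β * (α - β)^2 ≠ 0 := mul_ne_zero hp.b0 (pow_ne_zero _ hp.ab)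
  have h4 : (4 : F) ≠ 0 := by
    have := mul_ne_zero hp.h2 hp.h2
    norm_num at this; exact this
  obtain ⟨θ, hθ⟩ : ∃ θ, β * (α - β)^2 * θ = 4 * α * (α - 2 * β + 1) * (l - l') :=
    ⟨(4 * α * (α - 2 * β + 1) * (l - l')) / (β * (α - β)^2), mul_div_cancel₀ _ hD⟩
  have θ0 : θ ≠ 0 := by
    rintro rfl
    rw [mul_zero] at hθ
    exact mul_ne_zero (mul_ne_zero (mul_ne_zero h4 hp.a0) hε1) hl' hθ.symm
  obtain ⟨k', hk⟩ : ∃ k', (α - 2 * β) * k' = (α - 4 * β) * α :=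
    ⟨((α - 4 * β) * α) / (α - 2 * β), mul_div_cancel₀ _ hp.ab2⟩
  have k0 : k' ≠ 0 := by
    rintro rfl
    rw [mul_zero] at hk
    exact mul_ne_zero hκ hp.a0 hk.symm
  have d2 : 2 * (α - 2 * β) ≠ 0 := mul_ne_zero hp.h2 hp.ab2
  obtain ⟨Y, hY⟩ : ∃ Y, 2 * (α - 2 * β) * Y = -2 * (α - 2 * β) * (α - 4 * β) +
      4 * (4*α^2-2*α*β+4*β^2-α-2*β-4*α*(l+l')+4*l') + (α - 2 * β) * θ * (α - β) :=
    ⟨_ / _, mul_div_cancel₀ _ d2⟩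
  obtain ⟨Y', hY'⟩ : ∃ Y, 2 * (α - 2 * β) * Y = -2 * (α - 2 * β) * (α - 4 * β) +
      4 * (4*α^2-2*α*β+4*β^2-α-2*β-4*α*(l'+l)+4*l) + (α - 2 * β) * (-θ) * (α - β) :=
    ⟨_ / _, mul_div_cancel₀ _ d2⟩
  have st := h.star hp ind hθ
  have st3 : (α - 4 * β) • (b3 + b5 + b1) +
    (-(α - 4 * β)) • (b4 + b0 + b2) + (-4 : F) • o
      + (4 : F) • e + (-θ) • s = 0 := by linear_combination (norm := module) -st
  have r := h.rL hp ind nn st hk hY hY'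
  obtain ⟨x, hx⟩ : ∃ x, x = -((α - 4 * β) * α + 2 * β * Y') := ⟨_, rfl⟩
  obtain ⟨y, hy⟩ : ∃ x, x = ((α - 4 * β) * α + 2 * β * Y) := ⟨_, rfl⟩
  obtain ⟨v, hv⟩ : ∃ x, x = (4 * (Y - Y') - k' * θ) := ⟨_, rfl⟩
  rw [← hx, ← hy, ← hv] at r
  have r3 : y • (b3 + b5 + b1) + x • (b4 + b0 + b2) + v • s = 0 := by
    linear_combination (norm := module) r
  obtain ⟨g, G⟩ := h.G hp ind st hk hY r
  obtain ⟨g', G'⟩ := h.rot.rot.rot.G hp ind.swap st3 hk hY' r3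
  have xy0 : ¬ (x = 0 ∧ y = 0) := by
    rintro ⟨hx0, hy0⟩
    rw [hy0, mul_zero, zero_mul, zero_add] at g
    have v0 := (mul_eq_zero.1 ((mul_eq_zero.1 g).resolve_right hp.ab)).resolve_left hκ
    have : (2 * β) * (Y - Y') = 0 := by linear_combination hx0 + hy0 - hx - hy
    have := (mul_eq_zero.1 this).resolve_left (mul_ne_zero hp.h2 hp.b0)
    exact mul_ne_zero k0 θ0 (by linear_combination 4 * this - v0 + hv)
  have A1 : (α - 4 * β) * x - y * k' = 0 → (α - 2 * β) * x = α * y := by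
    intro t
    have : (α - 4 * β) * ((α - 2 * β) * x - α * y) = 0 := by
      linear_combination (α - 2 * β) * t + y * hk
    exact sub_eq_zero.1 ((mul_eq_zero.1 this).resolve_left hκ)
  have A2 : (α - 4 * β) * y - x * k' = 0 → (α - 2 * β) * y = α * x := by
    intro t
    have : (α - 4 * β) * ((α - 2 * β) * y - α * x) = 0 := by
      linear_combination (α - 2 * β) * t + x * hk
    exact sub_eq_zero.1 ((mul_eq_zero.1 this).resolve_left hκ)
  by_cases C : β = 2 * m ∧ (2 : F) • e + β • (b0 + b2 + b4) = 0
  · by_cases C' : β = 2 * m' ∧ (2 : F) • o + β • (b3 + b5 + b1) = 0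
    · exfalso
      have w : (α - 2 * β) • (b0 + b2 + b4) + (-(α - 2 * β)) • (b1 + b3 + b5) + θ • s = 0 := by
        linear_combination (norm := module) st + (2 : F) • C.2 - (2 : F) • C'.2
      have w3 : (-(α - 2 * β)) • (b3 + b5 + b1) + (α - 2 * β) • (b4 + b0 + b2) + θ • s = 0 := by
        linear_combination (norm := module) w
      obtain ⟨gs, -⟩ := h.G hp ind st hk hY w
      obtain ⟨gs', -⟩ := h.rot.rot.rot.G hp ind.swap st3 hk hY' w3
      have nz : (α - 4 * β) * θ * (α - β) ≠ 0 := mul_ne_zero (mul_ne_zero hκ θ0) hp.ab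
      have e1 : (x + y) * ((α - 4 * β) * θ * (α - β)) = 0 := by
        linear_combination y * gs + x * gs' + (α - 2 * β) * g - (α - 2 * β) * g'
      have e1 := (mul_eq_zero.1 e1).resolve_right nz
      have : (2 * β) * (Y - Y') = 0 := by linear_combination e1 - hx - hy
      have := (mul_eq_zero.1 this).resolve_left (mul_ne_zero hp.h2 hp.b0)
      have e2 : 2 * ((α - 4 * β) * θ * (α - β)) = 0 := by
        linear_combination gs + gs' + 2 * (α - 2 * β) * this
      exact mul_ne_zero hp.h2 nz e2
    · left
      have t := A2 (G'.resolve_right C')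
      refine h.caseIaux hp ind st C.2 C' ?_ t r
      intro hx0
      rw [hx0, mul_zero] at t
      exact xy0 ⟨hx0, (mul_eq_zero.1 t).resolve_left hp.ab2⟩
  · by_cases C' : β = 2 * m' ∧ (2 : F) • o + β • (b3 + b5 + b1) = 0
    · right
      have t := A1 (G.resolve_right C)
      have hy0 : y ≠ 0 := by
        intro hx0
        rw [hx0, mul_zero] at t
        exact xy0 ⟨(mul_eq_zero.1 t).resolve_left hp.ab2, hx0⟩
      obtain ⟨a, b, hab⟩ := h.rot.rot.rot.caseIaux hp ind.swap st3 C'.2 C hy0 t r3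
      exact ⟨a, b, by rw [hab]; module⟩
    · exfalso
      have t1 := A1 (G.resolve_right C)
      have t2 := A2 (G'.resolve_right C')
      have z : 4 * β * (α - β) ≠ 0 := mul_ne_zero (mul_ne_zero h4 hp.b0) hp.ab
      have hx0 : (4 * β * (α - β)) * x = 0 := by
        linear_combination -(α - 2 * β) * t1 - α * t2
      have hx0 := (mul_eq_zero.1 hx0).resolve_left z
      rw [hx0, mul_zero] at t2
      exact xy0 ⟨hx0, (mul_eq_zero.1 t2).resolve_left hp.ab2⟩

theorem Hx.split (hp : Par α β) (h : Hx α β l l' m m' n n' b0 b1 b2 b3 b4 b5 s e o p0 p1 p2)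
    (z0 : b0 ≠ 0) (z3 : b3 ≠ 0) (d02 : b0 ≠ b2) (d35 : b3 ≠ b5) :
    (l = l' ∧ m = m') ∨ (∃ a b : F, s = a • (b1 + b3 + b5) + b • o) ∨
      (∃ a b : F, s = a • (b0 + b2 + b4) + b • e) := by
  have nn := h.nu hp z0 z3
  by_cases ind : Ind F (b0 - b2) (b3 - b5)
  · exact h.caseI hp ind nn
  left
  unfold Ind at ind
  push Not at ind
  obtain ⟨x, y, r, hxy⟩ := ind
  have dz : b0 - b2 ≠ 0 := sub_ne_zero.2 d02
  have dz' : b3 - b5 ≠ 0 := sub_ne_zero.2 d35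
  have hy : y ≠ 0 := by
    rintro rfl
    rw [zero_smul, add_zero] at r
    exact hxy ((smul_eq_zero.1 r).resolve_right dz) rfl
  have hx : x ≠ 0 := by
    rintro rfl
    rw [zero_smul, zero_add] at r
    exact hy ((smul_eq_zero.1 r).resolve_right dz')
  refine h.caseII hp nn z0 z3 d02 (k := -(y⁻¹ * x)) (neg_ne_zero.2 (mul_ne_zero (inv_ne_zero hy) hx)) ?_
  have : (y⁻¹ * y - 1) • (b3 - b5) = 0 := by rw [inv_mul_cancel₀ hy, sub_self, zero_smul]
  linear_combination (norm := module) y⁻¹ • r - this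

theorem Hx.sub_top (hp : Par α β) (h : Hx α β l l' m m' n n' b0 b1 b2 b3 b4 b5 s e o p0 p1 p2)
    {a b : F} (hs : s = a • (b1 + b3 + b5) + b • o) (B : NonUnitalSubalgebra F A)
    (m5 : b5 ∈ B) (m1 : b1 ∈ B) : b0 ∈ B := by
  have S : ∀ {c : F} {t : A}, c ≠ 0 → c • t ∈ B → t ∈ B := by
    intro c t hc ht
    have := SMulMemClass.smul_mem c⁻¹ ht
    rwa [smul_smul, inv_mul_cancel₀ hc, one_smul] at this
  have mo : o ∈ B := by
    have : o = b5 * b1 - β • (b5 + b1) := by rw [h.o51]; abel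
    rw [this]
    exact sub_mem (mul_mem m5 m1) (SMulMemClass.smul_mem _ (add_mem m5 m1))
  have nz := mul_ne_zero hp.b0 hp.ab
  have m3 : b3 ∈ B := by
    apply S nz
    have : (β * (α - β)) • b3 = (2 : F) • (b1 * o) - (2 * (α - β)) • o -
      (2 * ((1 - α) * m' + β * (α - β - 1))) • b1 - (β * (α - β)) • b5 := by
      have := h.rot.b0e
      linear_combination (norm := module) -this
    rw [this]
    refine sub_mem (sub_mem (sub_mem ?_ ?_) ?_) ?_
    · exact SMulMemClass.smul_mem _ (mul_mem m1 mo)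
    all_goals exact SMulMemClass.smul_mem _ (by assumption)
  have ms : s ∈ B := by
    rw [hs]
    exact add_mem (SMulMemClass.smul_mem _ (add_mem (add_mem m1 m3) m5)) (SMulMemClass.smul_mem _ mo)
  have key : ∀ {c u : A}, c ∈ B → (2 : F) • (c * s) = (2 * (α - β)) • s +
      (2 * ((1 - α) * l' + β * (α - β - 1))) • c + (β * (α - β)) • u → u ∈ B := by
    intro c u hc hu
    apply S nz
    have : (β * (α - β)) • u = (2 : F) • (c * s) - (2 * (α - β)) • s -
      (2 * ((1 - α) * l' + β * (α - β - 1))) • c := by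
      linear_combination (norm := module) -hu
    rw [this]
    exact sub_mem (sub_mem (SMulMemClass.smul_mem _ (mul_mem hc ms)) (SMulMemClass.smul_mem _ ms))
      (SMulMemClass.smul_mem _ hc)
  have k1 := key m1 h.rot.b0s
  have k3 := key m3 h.rot.rot.rot.b0s
  have k5 := key m5 h.rot.rot.rot.rot.rot.b0s
  apply S hp.h2
  have : (2 : F) • b0 = (b2 + b0) - (b4 + b2) + (b0 + b4) := by module
  rw [this]
  exact add_mem (sub_mem k1 k3) k5

end PartB4

set_option linter.all false
section Setup
variable {F}

theorem Loc.nb {A : Type*} [NonUnitalNonAssocCommRing A] [Module F A]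
    {α β l m n : F} {c x1 x5 x2 x4 x3 : A} (h : Loc α β l m n c x1 x5 x2 x4 x3) :
    c * x1 - β • x1 = c * x5 - β • x5 ∧ c * x2 - β • x2 = c * x4 - β • x4 := by
  obtain ⟨P, τ, h, h1, h2, h3, h4, h5, h6⟩ := h
  have a := h.neg x1
  have b := h.neg x2
  rw [h1, mul_sub] at a
  rw [h2, mul_sub] at b
  constructor
  · linear_combination (norm := module) a
  · linear_combination (norm := module) b

theorem Loc.map {A : Type*} [NonUnitalNonAssocCommRing A] [Module F A]
    {α β l m n : F} {c x1 x5 x2 x4 x3 : A} (h : Loc α β l m n c x1 x5 x2 x4 x3)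
    (g : A ≃ₗ[F] A) (hg : ∀ x y, g (x * y) = g x * g y) :
    Loc α β l m n (g c) (g x1) (g x5) (g x2) (g x4) (g x3) := by
  obtain ⟨P, τ, h, h1, h2, h3, h4, h5, h6⟩ := h
  exact ⟨_, _, h.map g hg, by simp [h1], by simp [h2], by simp [h3], by simp [h4], by simp [h5],
    by simp [h6]⟩

theorem Loc.prod {A B : Type*} [NonUnitalNonAssocCommRing A] [Module F A]
    [NonUnitalNonAssocCommRing B] [Module F B]
    {α β l m n : F} {c x1 x5 x2 x4 x3 : A} (h : Loc α β l m n c x1 x5 x2 x4 x3)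
    {d y1 y5 y2 y4 y3 : B} (k : Loc α β l m n d y1 y5 y2 y4 y3) :
    Loc α β l m n ((c, d) : A × B) (x1, y1) (x5, y5) (x2, y2) (x4, y4) (x3, y3) := by
  obtain ⟨P, τ, h, h1, h2, h3, h4, h5, h6⟩ := h
  obtain ⟨Q, σ, k, k1, k2, k3, k4, k5, k6⟩ := k
  exact ⟨_, _, h.prod k, by simp [h1, k1], by simp [h2, k2], by simp [h3, k3], by simp [h4, k4],
    by simp [h5, k5], by simp [h6, k6]⟩

theorem Hx.prod {A B : Type*} [NonUnitalNonAssocCommRing A] [Module F A]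
    [NonUnitalNonAssocCommRing B] [Module F B]
    {α β l l' m m' n n' : F} {b0 b1 b2 b3 b4 b5 s e o p0 p1 p2 : A}
    {c0 c1 c2 c3 c4 c5 s' e' o' q0 q1 q2 : B}
    (h : Hx α β l l' m m' n n' b0 b1 b2 b3 b4 b5 s e o p0 p1 p2)
    (k : Hx α β l l' m m' n n' c0 c1 c2 c3 c4 c5 s' e' o' q0 q1 q2) :
    Hx (A := A × B) α β l l' m m' n n' (b0, c0) (b1, c1) (b2, c2) (b3, c3) (b4, c4) (b5, c5)
      (s, s') (e, e') (o, o') (p0, q0) (p1, q1) (p2, q2) where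
  L0 := h.L0.prod k.L0
  L1 := h.L1.prod k.L1
  L2 := h.L2.prod k.L2
  L3 := h.L3.prod k.L3
  L4 := h.L4.prod k.L4
  L5 := h.L5.prod k.L5
  s01 := by ext <;> simp [h.s01, k.s01]
  s12 := by ext <;> simp [h.s12, k.s12]
  s23 := by ext <;> simp [h.s23, k.s23]
  s34 := by ext <;> simp [h.s34, k.s34]
  s45 := by ext <;> simp [h.s45, k.s45]
  s50 := by ext <;> simp [h.s50, k.s50]
  e02 := by ext <;> simp [h.e02, k.e02]
  e24 := by ext <;> simp [h.e24, k.e24]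
  e40 := by ext <;> simp [h.e40, k.e40]
  o13 := by ext <;> simp [h.o13, k.o13]
  o35 := by ext <;> simp [h.o35, k.o35]
  o51 := by ext <;> simp [h.o51, k.o51]
  p03 := by ext <;> simp [h.p03, k.p03]
  p14 := by ext <;> simp [h.p14, k.p14]
  p25 := by ext <;> simp [h.p25, k.p25]

theorem mk_hx {A : Type*} [NonUnitalNonAssocCommRing A] [Module F A]
    {α β l l' m m' n n' : F} {b0 b1 b2 b3 b4 b5 : A} (τ₀ τ₁ : A ≃ₗ[F] A)
    (m0 : ∀ x y, τ₀ (x * y) = τ₀ x * τ₀ y) (m1 : ∀ x y, τ₁ (x * y) = τ₁ x * τ₁ y)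
    (t0 : ∀ x, τ₀ (τ₀ x) = x) (t1 : ∀ x, τ₁ (τ₁ x) = x)
    (h00 : τ₀ b0 = b0) (h01 : τ₀ b1 = b5) (h02 : τ₀ b2 = b4) (h03 : τ₀ b3 = b3)
    (h11 : τ₁ b1 = b1) (h10 : τ₁ b0 = b2) (h15 : τ₁ b5 = b3) (h14 : τ₁ b4 = b4)
    (L0 : Loc α β l m n b0 b1 b5 b2 b4 b3) (L1 : Loc α β l' m' n' b1 b2 b0 b3 b5 b4) :
    Hx α β l l' m m' n n' b0 b1 b2 b3 b4 b5 (b0 * b1 - β • (b0 + b1)) (b0 * b2 - β • (b0 + b2))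
      (b1 * b3 - β • (b1 + b3)) (b0 * b3) (b1 * b4) (b2 * b5) := by
  have h05 : τ₀ b5 = b1 := by rw [← h01, t0]
  have h04 : τ₀ b4 = b2 := by rw [← h02, t0]
  have h12 : τ₁ b2 = b0 := by rw [← h10, t1]
  have h13 : τ₁ b3 = b5 := by rw [← h15, t1]
  have L2 := (L0.map τ₁ m1).symm
  rw [h10, h15, h11, h14, h12, h13] at L2
  have L5 := (L1.map τ₀ m0).symm
  rw [h01, h00, h02, h03, h05, h04] at L5
  have L4 := (L2.map τ₀ m0).symm
  rw [h02, h01, h03, h00, h04, h05] at L4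
  have L3 := (L5.map τ₁ m1).symm
  rw [h15, h14, h10, h13, h11, h12] at L3
  obtain ⟨u0, v0⟩ := L0.nb
  obtain ⟨u1, v1⟩ := L1.nb
  obtain ⟨u2, v2⟩ := L2.nb
  obtain ⟨u3, v3⟩ := L3.nb
  obtain ⟨u4, v4⟩ := L4.nb
  obtain ⟨u5, v5⟩ := L5.nb
  have s12 : b1 * b2 = b0 * b1 - β • (b0 + b1) + β • (b1 + b2) := by
    rw [mul_comm b0 b1]
    linear_combination (norm := module) u1
  have s23 : b2 * b3 = b0 * b1 - β • (b0 + b1) + β • (b2 + b3) := by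
    rw [mul_comm b2 b1, s12] at u2
    linear_combination (norm := module) u2
  have s34 : b3 * b4 = b0 * b1 - β • (b0 + b1) + β • (b3 + b4) := by
    rw [mul_comm b3 b2, s23] at u3
    linear_combination (norm := module) u3
  have s50 : b5 * b0 = b0 * b1 - β • (b0 + b1) + β • (b5 + b0) := by
    rw [mul_comm b5 b0]
    linear_combination (norm := module) -u0
  have s45 : b4 * b5 = b0 * b1 - β • (b0 + b1) + β • (b4 + b5) := by
    rw [mul_comm b4 b3, s34] at u4
    linear_combination (norm := module) u4
  refine ⟨L0, L1, L2, L3, L4, L5, by abel, s12, s23, s34, s45, s50, by abel, ?_, ?_, by abel, ?_, ?_,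
    rfl, rfl, rfl⟩
  · rw [mul_comm b2 b0] at v2
    linear_combination (norm := module) v2
  · rw [mul_comm b4 b0]
    linear_combination (norm := module) -v0
  · rw [mul_comm b3 b1] at v3
    linear_combination (norm := module) v3
  · rw [mul_comm b5 b1]
    linear_combination (norm := module) -v1

theorem orb {G X : Type*} [Group G] [MulAction G X] {s t : G} (hs : s * s = 1) (ht : t * t = 1)
    {x : X} (hx : s • x = x) {N : Set X}
    (hN : N = {w | ∃ g ∈ Subgroup.closure ({s, t} : Set G), g • x = w}) (h3 : N.ncard = 3) :
    Function.minimalPeriod (fun y : X => (t * s) • y) x = 3 := by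
  have si : s⁻¹ = s := inv_eq_of_mul_eq_one_left hs
  have ti : t⁻¹ = t := inv_eq_of_mul_eq_one_left ht
  have cs : ∀ i : ℤ, s * (t * s) ^ i = (t * s) ^ (-i) * s := by
    intro i
    have := conj_zpow (i := i) (a := s) (b := t * s)
    have e : s * (t * s) * s⁻¹ = (t * s)⁻¹ := by simp [mul_assoc, si, ti, hs]
    rw [e, inv_zpow', ] at this
    rw [this]; simp [mul_assoc]
  have key : N = MulAction.orbit (Subgroup.zpowers (t * s)) x := by
    rw [hN]
    ext w
    constructor
    · rintro ⟨g, hg, rfl⟩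
      suffices H : ∀ i : ℤ, ∃ j : ℤ, g • (t * s) ^ i • x = (t * s) ^ j • x by
        obtain ⟨j, hj⟩ := H 0
        rw [zpow_zero, one_smul] at hj
        exact ⟨⟨(t * s) ^ j, j, rfl⟩, hj.symm⟩
      have S : ∀ i : ℤ, ∃ j : ℤ, s • (t * s) ^ i • x = (t * s) ^ j • x := by
        intro i
        refine ⟨-i, ?_⟩
        rw [smul_smul, cs, mul_smul, hx]
      have T : ∀ i : ℤ, ∃ j : ℤ, t • (t * s) ^ i • x = (t * s) ^ j • x := by
        intro i
        refine ⟨1 + -i, ?_⟩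
        have : t = (t * s) * s := by rw [mul_assoc, hs, mul_one]
        have h2 : t * (t * s) ^ i = (t * s) * (s * (t * s) ^ i) := by
          rw [← mul_assoc, ← this]
        rw [smul_smul, h2, cs, ← mul_assoc, mul_smul, hx, zpow_add, zpow_one]
      induction hg using Subgroup.closure_induction'' with
      | mem g hg =>
        rcases hg with rfl | rfl
        · exact S
        · exact T
      | inv_mem g hg =>
        rcases hg with rfl | rfl
        · rw [si]; exact S
        · rw [ti]; exact T
      | one => intro i; exact ⟨i, one_smul _ _⟩
      | mul g k _ _ h1 h2 =>
        intro i
        obtain ⟨j, hj⟩ := h2 i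
        obtain ⟨j', hj'⟩ := h1 j
        exact ⟨j', by rw [mul_smul, hj, hj']⟩
    · rintro ⟨⟨g, i, rfl⟩, rfl⟩
      refine ⟨(t * s) ^ i, ?_, rfl⟩
      apply Subgroup.zpow_mem
      exact Subgroup.mul_mem _ (Subgroup.subset_closure (by simp)) (Subgroup.subset_closure (by simp))
  have fin : N.Finite := Set.finite_of_ncard_ne_zero (by rw [h3]; decide)
  rw [key] at fin h3
  haveI := fin.fintype
  have := MulAction.minimalPeriod_eq_card (a := t * s) (b := x)
  rw [← Nat.card_eq_fintype_card] at this
  exact this.trans h3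

end Setup

set_option linter.all false

theorem teo3 {α β : F}
    (hchar : (2 : F) ≠ 0)
    (hα0 : α ≠ 0) (hα1 : α ≠ 1) (hβ0 : β ≠ 0) (hβ1 : β ≠ 1) (hαβ : α ≠ β)
    (hα2β : α ≠ 2 * β)
    {a₀ a₁ : V} (hV : IsTwoGenerated F α β a₀ a₁)
    (τ₀ τ₁ : V ≃ₗ[F] V) (hτ₀ : IsMiyamoto F α β a₀ τ₀) (hτ₁ : IsMiyamoto F α β a₁ τ₁)
    (a : ℤ → V) (ha : a = axSeq F a₀ a₁ τ₀ τ₁)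
    (hreg : HasRegularAxet F a₀ a₁ τ₀ τ₁)
    (hn : (miyOrbit F τ₀ τ₁ a₀).ncard = 3) :
    IsQuotientOfSymmetric F α β a₀ a₁ ∨
    NonUnitalAlgebra.adjoin F ({a 0, a 2} : Set V) = ⊤ ∨
    NonUnitalAlgebra.adjoin F ({a (-1), a 1} : Set V) = ⊤ := by
  have hp : Par α β := ⟨hchar, hα0, sub_ne_zero.2 hα1, hβ0, sub_ne_zero.2 hβ1, sub_ne_zero.2 hαβ,
    sub_ne_zero.2 hα2β⟩
  have C0 := hV.axis₀.cen hchar hα0 hα1 hβ1 hτ₀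
  have C1 := hV.axis₁.cen hchar hα0 hα1 hβ1 hτ₁
  have t0 : ∀ x, τ₀ (τ₀ x) = x := C0.τ_τ
  have t1 : ∀ x, τ₁ (τ₁ x) = x := C1.τ_τ
  have t00 : τ₀ * τ₀ = 1 := LinearEquiv.ext t0
  have t11 : τ₁ * τ₁ = 1 := LinearEquiv.ext t1
  have h00 : τ₀ a₀ = a₀ := C0.τ_c
  have h11 : τ₁ a₁ = a₁ := C1.τ_c
  have hn1 : (miyOrbit F τ₀ τ₁ a₁).ncard = 3 := by
    rw [← hn]
    exact (Nat.card_congr hreg.some).symm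
  have per0 := orb (s := τ₀) (t := τ₁) t00 t11 (x := a₀) h00 rfl hn
  have per1 := orb (s := τ₁) (t := τ₀) t11 t00 (x := a₁) h11
    (N := miyOrbit F τ₀ τ₁ a₁) (by rw [Set.pair_comm]; rfl) hn1
  obtain ⟨b2, h10⟩ : ∃ b, τ₁ a₀ = b := ⟨_, rfl⟩
  obtain ⟨b5, h01⟩ : ∃ b, τ₀ a₁ = b := ⟨_, rfl⟩
  obtain ⟨b4, h02⟩ : ∃ b, τ₀ b2 = b := ⟨_, rfl⟩
  obtain ⟨b3, h15⟩ : ∃ b, τ₁ b5 = b := ⟨_, rfl⟩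
  have q0 : τ₁ (τ₀ (τ₁ (τ₀ (τ₁ (τ₀ a₀))))) = a₀ := by
    have := Function.isPeriodicPt_minimalPeriod (fun y : V => (τ₁ * τ₀) • y) a₀
    rw [per0] at this
    exact this
  have q1 : τ₀ (τ₁ (τ₀ (τ₁ (τ₀ (τ₁ a₁))))) = a₁ := by
    have := Function.isPeriodicPt_minimalPeriod (fun y : V => (τ₀ * τ₁) • y) a₁
    rw [per1] at this
    exact this
  have h14 : τ₁ b4 = b4 := by
    rw [h00, h10, h02] at q0
    have := congrArg (fun z => τ₀ (τ₁ z)) q0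
    simp only [t0, t1] at this
    rw [this, h10, h02]
  have h03 : τ₀ b3 = b3 := by
    rw [h11, h01, h15] at q1
    have := congrArg (fun z => τ₁ (τ₀ z)) q1
    simp only [t0, t1] at this
    rw [this, h01, h15]
  have d02 : a₀ ≠ b2 := by
    intro hE
    have : Function.minimalPeriod (fun y : V => (τ₁ * τ₀) • y) a₀ = 1 := by
      rw [Function.minimalPeriod_eq_one_iff_isFixedPt]
      change τ₁ (τ₀ a₀) = a₀
      rw [h00, h10, ← hE]
    omega
  have d15 : a₁ ≠ b5 := by
    intro hE
    have : Function.minimalPeriod (fun y : V => (τ₀ * τ₁) • y) a₁ = 1 := by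
      rw [Function.minimalPeriod_eq_one_iff_isFixedPt]
      change τ₀ (τ₁ a₁) = a₁
      rw [h11, h01, ← hE]
    omega
  have z0 : a₀ ≠ 0 := by
    intro hE
    apply d02
    rw [← h10, hE, map_zero]
  have z3 : b3 ≠ 0 := by
    intro hE
    rw [hE] at h15
    have e5 : b5 = 0 := by
      have := congrArg τ₁ h15
      rwa [t1, map_zero] at this
    have : a₁ = 0 := by
      have := congrArg τ₀ h01
      rwa [t0, e5, map_zero] at this
    exact d15 (by rw [this, e5])
  obtain ⟨l, hl⟩ := hV.axis₀.P_span hα1 hβ1 a₁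
  obtain ⟨m, hm⟩ := hV.axis₀.P_span hα1 hβ1 b2
  obtain ⟨n, hnn⟩ := hV.axis₀.P_span hα1 hβ1 b3
  obtain ⟨l', hl'⟩ := hV.axis₁.P_span hα1 hβ1 b2
  obtain ⟨m', hm'⟩ := hV.axis₁.P_span hα1 hβ1 b3
  obtain ⟨n', hnn'⟩ := hV.axis₁.P_span hα1 hβ1 b4
  have h12 : τ₁ b2 = a₀ := by rw [← h10, t1]
  have h13 : τ₁ b3 = b5 := by rw [← h15, t1]
  have L0 : Loc α β l m n a₀ a₁ b5 b2 b4 b3 := ⟨_, _, C0, h01, h02, h03, hl, hm, hnn⟩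
  have L1 : Loc α β l' m' n' a₁ b2 a₀ b3 b5 b4 := ⟨_, _, C1, h12, h13, h14, hl', hm', hnn'⟩
  have h := mk_hx τ₀ τ₁ hτ₀.map_mul hτ₁.map_mul t0 t1 h00 h01 h02 h03 h11 h10 h15 h14 L0 L1
  have d35 : b3 ≠ b5 := by
    intro hE
    have h4 : τ₀ b5 = b5 := by rw [hE] at h03; exact h03
    apply d15
    rw [← h4, ← h01, t0]
  have A0 : a 0 = a₀ := by rw [ha]; simp [axSeq]
  have A1 : a 1 = a₁ := by rw [ha]; simp [axSeq]
  have A2 : a 2 = b2 := by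
    rw [ha]
    have : axSeq F a₀ a₁ τ₀ τ₁ 2 = τ₁ (τ₀ a₀) := by
      simp only [axSeq]
      norm_num
    rw [this, h00, h10]
  have A5 : a (-1) = b5 := by
    rw [ha]
    have : axSeq F a₀ a₁ τ₀ τ₁ (-1) = τ₀ (τ₁ a₁) := by
      simp only [axSeq]
      norm_num
      rw [LinearEquiv.symm_apply_eq, LinearEquiv.symm_apply_eq, t0, t1]
    rw [this, h11, h01]
  rw [A0, A1, A2, A5]
  have top : ∀ B : NonUnitalSubalgebra F V, a₀ ∈ B → a₁ ∈ B → B = ⊤ := by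
    intro B x y
    rw [eq_top_iff, ← hV.generates]
    apply NonUnitalAlgebra.adjoin_le
    rintro z (rfl | rfl)
    · exact x
    · exact y
  have sub : ∀ x y : V, x ∈ NonUnitalAlgebra.adjoin F ({x, y} : Set V) ∧
      y ∈ NonUnitalAlgebra.adjoin F ({x, y} : Set V) := fun x y =>
    ⟨NonUnitalAlgebra.subset_adjoin F (by simp), NonUnitalAlgebra.subset_adjoin F (by simp)⟩
  have nn := h.nu hp z0 z3
  rcases h.split hp z0 z3 d02 d35 with ⟨el, em⟩ | ⟨x, y, hs⟩ | ⟨x, y, hs⟩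
  · left
    subst el em nn
    have H := h.prod h.rot.refl
    exact quot_of_hx hp hV.generates H (hV.axis₀.eqAx.prod hV.axis₁.eqAx)
      (hV.axis₁.eqAx.prod hV.axis₀.eqAx) (LinearEquiv.prodComm F V V).toLinearMap
      (fun _ _ => rfl) (fun _ => rfl) rfl (LinearMap.fst F V V) (fun _ _ => rfl) rfl rfl
  · right; right
    obtain ⟨s5, s1⟩ := sub b5 a₁
    exact top _ (h.sub_top hp hs _ s5 s1) s1
  · right; left
    obtain ⟨s0, s2⟩ := sub a₀ b2
    refine top _ s0 ?_
    exact h.rot.sub_top hp (a := x) (b := y) (by rw [hs]; module) _ s0 s2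

end AxialFormal
end

section
/- Let 𝒱 = (V, {a₀, a₁}) be a primitive 2-generated M(α,β)-axial algebra over F. Then (1) λ_{a₀}(s_{1,2}) = (2(α−1)/(α−β))·λ₁·(λ₁ − λ₁^f) + (1 − 2β)λ₁ + βλ₂ − β, and (2) λ_{a₁}(s_{0,2}) = (2(α−1)/(α−β))·λ₁^f·(λ₁^f − λ₁) + (1 − 2β)λ₁^f + βλ₂^f − β. -/
namespace AxialFormal

universe u v

variable (F : Type u) [Field F] {V : Type v} [NonUnitalNonAssocCommRing V]
  [Module F V] [SMulCommClass F V V] [IsScalarTower F V V]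

/-- `l` is the projection `λ_a(x)` of `x` onto the primitive axis `a`:
`x = l • a + x₀ + x_α + x_β` with `x_μ ∈ V_μ^a`. -/
def HasProj (α β : F) (a x : V) (l : F) : Prop :=
  ∃ v₀ ∈ eigSp F a 0, ∃ vα ∈ eigSp F a α, ∃ vβ ∈ eigSp F a β,
    x = l • a + v₀ + vα + vβ

theorem half {α β : F}
    (hchar : (2 : F) ≠ 0) (hαβ : α ≠ β)
    {a₀ a₁ : V} (h0 : IsAxis F α β a₀) (h1 : IsAxis F α β a₁)
    (τ₀ τ₁ : V ≃ₗ[F] V) (hτ₀ : IsMiyamoto F α β a₀ τ₀) (hτ₁ : IsMiyamoto F α β a₁ τ₁)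
    (l1 l1f l2 : F)
    (hl1 : HasProj F α β a₀ a₁ l1) (hl1f : HasProj F α β a₁ a₀ l1f)
    (hl2 : HasProj F α β a₀ (τ₁ a₀) l2) :
    HasProj F α β a₀ (τ₀ a₁ * a₁ - β • (τ₀ a₁ + a₁))
      (2 * (α - 1) / (α - β) * l1 * (l1 - l1f) + (1 - 2 * β) * l1 + β * l2 - β) := by
  obtain ⟨x0, hx0, xa, hxa, xb, hxb, hx⟩ := hl1
  obtain ⟨z0, hz0, za, hza, zb, hzb, hz⟩ := hl1f
  obtain ⟨w0, hw0, wa, hwa, wb, hwb, hw⟩ := hl2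
  have hd : α - β ≠ 0 := sub_ne_zero.mpr hαβ
  have self0 : a₀ ∈ eigSp F a₀ 1 := by
    change a₀ * a₀ = (1 : F) • a₀
    rw [h0.idem, one_smul]
  have self1 : a₁ ∈ eigSp F a₁ 1 := by
    change a₁ * a₁ = (1 : F) • a₁
    rw [h1.idem, one_smul]
  have t0 : τ₀ a₁ = l1 • a₀ + x0 + xa - xb := by
    have e : τ₀ (l1 • a₀ + x0 + xa) = l1 • a₀ + x0 + xa := hτ₀.fix_plus _
      (Submodule.add_mem_sup (Submodule.add_mem_sup (Submodule.smul_mem _ _ self0) hx0) hxa)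
    conv_lhs => rw [hx]
    rw [map_add, e, hτ₀.neg_beta _ hxb, sub_eq_add_neg]
  have t1 : τ₁ a₀ = l1f • a₁ + z0 + za - zb := by
    have e : τ₁ (l1f • a₁ + z0 + za) = l1f • a₁ + z0 + za := hτ₁.fix_plus _
      (Submodule.add_mem_sup (Submodule.add_mem_sup (Submodule.smul_mem _ _ self1) hz0) hza)
    conv_lhs => rw [hz]
    rw [map_add, e, hτ₁.neg_beta _ hzb, sub_eq_add_neg]
  have idm : τ₀ a₁ * τ₀ a₁ = τ₀ a₁ := by rw [← hτ₀.map_mul, h1.idem]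
  have m00 := h0.fusion_zero_zero _ hx0 _ hx0
  have m0a := h0.fusion_zero_alpha _ hx0 _ hxa
  have m0b := h0.fusion_zero_beta _ hx0 _ hxb
  have mab := h0.fusion_alpha_beta _ hxa _ hxb
  have ex0 : a₀ * x0 = 0 := by
    have : a₀ * x0 = (0 : F) • x0 := hx0
    simpa using this
  have exa : a₀ * xa = α • xa := hxa
  have exb : a₀ * xb = β • xb := hxb
  have ez0 : a₁ * z0 = 0 := by
    have : a₁ * z0 = (0 : F) • z0 := hz0
    simpa using this
  have eza : a₁ * za = α • za := hza
  have ezb : a₁ * zb = β • zb := hzb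
  have i0 := h0.idem
  have i1 := h1.idem
  -- the product of the two axes, computed in both ways
  have p0 : a₀ * a₁ = l1 • a₀ + α • xa + β • xb := by
    conv_lhs => rw [hx]
    simp only [mul_add, mul_smul_comm, i0, ex0, exa, exb, add_zero]
  have p1 : a₀ * a₁ = l1f • a₁ + α • za + β • zb := by
    rw [mul_comm]
    conv_lhs => rw [hz]
    simp only [mul_add, mul_smul_comm, i1, ez0, eza, ezb, add_zero]
  have hs : (l1 - β - β * l1) • a₀ - β • x0 + (α - β) • xa
      = (l1f - β - β * l1f) • a₁ - β • z0 + (α - β) • za := by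
    linear_combination (norm := module) p1 - p0 + β • hx - β • hz
  have ms : a₁ * ((l1 - β - β * l1) • a₀ - β • x0 + (α - β) • xa)
      = (l1f - β - β * l1f) • a₁ + ((α - β) * α) • za := by
    rw [hs]
    simp only [mul_add, mul_sub, mul_smul_comm, i1, ez0, eza, smul_zero, sub_zero, smul_smul]
  have ms2 : a₁ * ((l1 - β - β * l1) • a₀ - β • x0 + (α - β) • xa)
      = (l1 * (l1 - β - β * l1)) • a₀ + ((l1 - β - β * l1) * α) • xa
        + ((l1 - β - β * l1) * β) • xb - β • (x0 * x0) - β • (x0 * xa) - β • (x0 * xb)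
        + (α - β) • ((l1 * α) • xa + x0 * xa + xa * xa + xa * xb) := by
    conv_lhs => rw [hx]
    simp only [mul_add, add_mul, mul_sub, mul_smul_comm, smul_mul_assoc, i0, ex0, exa,
      mul_comm xa a₀, mul_comm xb a₀, mul_comm x0 a₀, exb, mul_comm xa x0, mul_comm xb x0,
      mul_comm xb xa]
    module
  have hS : τ₀ a₁ * a₁ - β • (τ₀ a₁ + a₁) = (2 : F) • ((l1 ^ 2) • a₀ + x0 * x0 + xa * xa
      + (2 * l1 * α) • xa + (2 : F) • (x0 * xa)) - (1 + 2 * β) • (l1 • a₀ + x0 + xa) := by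
    have q1 : (l1 • a₀ + x0 + xa + xb) * (l1 • a₀ + x0 + xa + xb) = l1 • a₀ + x0 + xa + xb := by
      rw [← hx, i1]
    rw [t0] at idm ⊢
    have e : ∀ y x : V, (y + x) * (y + x) = y + x → (y - x) * (y - x) = y - x →
        (y - x) * (y + x) = (2 : F) • (y * y) - y := by
      intro y x g1 g2
      simp only [mul_add, add_mul, mul_sub, sub_mul, mul_comm x y] at g1 g2 ⊢
      apply smul_right_injective V hchar
      simp only
      linear_combination (norm := module) (-1 : F) • g1 - (1 : F) • g2
    have e1 := e _ _ q1 idm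
    have e2 : (l1 • a₀ + x0 + xa) * (l1 • a₀ + x0 + xa) = (l1 ^ 2) • a₀ + x0 * x0 + xa * xa
      + (2 * l1 * α) • xa + (2 : F) • (x0 * xa) := by
      simp only [mul_add, add_mul, mul_smul_comm, smul_mul_assoc, i0, ex0, exa,
        mul_comm xa a₀, mul_comm x0 a₀, mul_comm xa x0]
      module
    rw [e2] at e1
    conv_lhs => rw [hx]
    linear_combination (norm := module) e1
  generalize τ₀ a₁ * a₁ - β • (τ₀ a₁ + a₁) = S at hS ⊢
  set k := l1 - β - β * l1 with hk
  set kf := l1f - β - β * l1f with hkf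
  set m := 2 * kf - 2 * (α - β) * (l1f - β) with hm
  -- the three components of `(α - β) • S`
  refine ⟨(α - β)⁻¹ • ((2 * (α - β) + 2 * β) • (x0 * x0)
      + (m - (α - β) * (1 + 2 * β) - 2 * (α - β) * β) • x0 + ((α - β) * β) • w0), ?_,
    (α - β)⁻¹ • ((4 * (α - β) + 2 * β - 2 * (α - β)) • (x0 * xa)
      + (4 * (α - β) * l1 * α - 2 * k * α - 2 * (α - β) * l1 * α + m + 2 * (α - β) * (α - β)
         - (α - β) * (1 + 2 * β)) • xa + ((α - β) * β) • wa), ?_,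
    (α - β)⁻¹ • ((2 * β) • (x0 * xb) - (2 * (α - β)) • (xa * xb)
      + (m - 2 * k * β) • xb + ((α - β) * β) • wb), ?_, ?_⟩
  · exact Submodule.smul_mem _ _ (add_mem (add_mem (Submodule.smul_mem _ _ m00)
      (Submodule.smul_mem _ _ hx0)) (Submodule.smul_mem _ _ hw0))
  · exact Submodule.smul_mem _ _ (add_mem (add_mem (Submodule.smul_mem _ _ m0a)
      (Submodule.smul_mem _ _ hxa)) (Submodule.smul_mem _ _ hwa))
  · exact Submodule.smul_mem _ _ (add_mem (add_mem (sub_mem (Submodule.smul_mem _ _ m0b)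
      (Submodule.smul_mem _ _ mab)) (Submodule.smul_mem _ _ hxb)) (Submodule.smul_mem _ _ hwb))
  · apply smul_right_injective V hd
    simp only [smul_add (α - β), smul_smul (α - β) (α - β)⁻¹, mul_inv_cancel₀ hd, one_smul,
      smul_smul (α - β) _ a₀]
    have hL : (α - β) * (2 * (α - 1) / (α - β) * l1 * (l1 - l1f) + (1 - 2 * β) * l1 + β * l2 - β)
        = 2 * (α - 1) * l1 * (l1 - l1f) + (α - β) * ((1 - 2 * β) * l1 + β * l2 - β) := by
      field_simp
      ring
    rw [hL]
    have hc : τ₁ a₀ + a₀ = (2 : F) • (l1f • a₁ + z0 + za) := by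
      rw [t1]
      linear_combination (norm := module) hz
    rw [hw] at hc
    have ms3 := ms2.symm.trans ms
    rw [hS]
    clear_value m kf k
    subst hm hkf hk
    linear_combination (norm := module) (2 : F) • ms3
      + (2 * (l1f - β - β * l1f) - 2 * (α - β) * (l1f - β)) • hx - ((α - β) * β) • hc - (2 * (α - β)) • hs

/-- The projections `λ_{a₀}(s_{1,2})` and `λ_{a₁}(s_{0,2})`. -/
theorem cor_lambda_s12 {α β : F}
    (hchar : (2 : F) ≠ 0)
    (hα0 : α ≠ 0) (hα1 : α ≠ 1) (hβ0 : β ≠ 0) (hβ1 : β ≠ 1) (hαβ : α ≠ β)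
    {a₀ a₁ : V} (hV : IsTwoGenerated F α β a₀ a₁)
    (τ₀ τ₁ : V ≃ₗ[F] V) (hτ₀ : IsMiyamoto F α β a₀ τ₀) (hτ₁ : IsMiyamoto F α β a₁ τ₁)
    (a : ℤ → V) (ha : a = axSeq F a₀ a₁ τ₀ τ₁)
    (l1 l1f l2 l2f : F)
    (hl1 : HasProj F α β a₀ a₁ l1) (hl1f : HasProj F α β a₁ a₀ l1f)
    (hl2 : HasProj F α β a₀ (a 2) l2) (hl2f : HasProj F α β a₁ (a (-1)) l2f) :
    HasProj F α β a₀ (a (-1) * a 1 - β • (a (-1) + a 1))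
      (2 * (α - 1) / (α - β) * l1 * (l1 - l1f) + (1 - 2 * β) * l1 + β * l2 - β) ∧
    HasProj F α β a₁ (a 0 * a 2 - β • (a 0 + a 2))
      (2 * (α - 1) / (α - β) * l1f * (l1f - l1) + (1 - 2 * β) * l1f + β * l2f - β) := by
  have e0 : a 0 = a₀ := by subst ha; simp [axSeq]
  have e1 : a 1 = a₁ := by subst ha; simp [axSeq]
  have invol : ∀ (b : V) (τ : V ≃ₗ[F] V), IsAxis F α β b → IsMiyamoto F α β b τ →
      ∀ v, τ (τ v) = v := by
    intro b τ hb hτ v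
    have hv : v ∈ eigSp F b 1 ⊔ eigSp F b 0 ⊔ eigSp F b α ⊔ eigSp F b β := by
      rw [hb.decomp]; trivial
    obtain ⟨y, hy, z, hz, rfl⟩ := Submodule.mem_sup.mp hv
    simp [hτ.fix_plus y hy, hτ.neg_beta z hz]
  have fixax : ∀ (b : V) (τ : V ≃ₗ[F] V), IsAxis F α β b → IsMiyamoto F α β b τ → τ b = b := by
    intro b τ hb hτ
    apply hτ.fix_plus
    apply Submodule.mem_sup_left
    apply Submodule.mem_sup_left
    change b * b = (1 : F) • b
    rw [hb.idem, one_smul]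
  have e2 : a 2 = τ₁ a₀ := by
    subst ha
    simp [axSeq, fixax _ _ hV.axis₀ hτ₀]
  have em : a (-1) = τ₀ a₁ := by
    have h : a (-1) = ((τ₁ * τ₀) ^ (-1 : ℤ)) a₁ := by
      subst ha
      simp [axSeq]
    rw [h, zpow_neg_one]
    apply (τ₁ * τ₀).injective
    have h2 : (τ₁ * τ₀) ((τ₁ * τ₀)⁻¹ a₁) = a₁ := (τ₁ * τ₀).apply_symm_apply a₁
    rw [h2, LinearEquiv.mul_apply, invol _ _ hV.axis₀ hτ₀, fixax _ _ hV.axis₁ hτ₁]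
  rw [e2] at hl2
  rw [em] at hl2f
  rw [e0, e1, e2, em]
  refine ⟨half F hchar hαβ hV.axis₀ hV.axis₁ τ₀ τ₁ hτ₀ hτ₁ l1 l1f l2 hl1 hl1f hl2, ?_⟩
  rw [mul_comm, add_comm a₀]
  exact half F hchar hαβ hV.axis₁ hV.axis₀ τ₁ τ₀ hτ₁ hτ₀ l1f l1 l2f hl1f hl1 hl2f

end AxialFormal
end
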